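/- Let δ ∈ (0, 1/2) be a real number such that 12·10^{2δ} < ln(1/(2δ)). Then there exist a constant c > 0 and N₀ such that for every integer N ≥ N₀ there exist positive integers n₁ and n₂ with N = n₁ + n₂ and f(nᵢ) ≥ c·ln N·(ln ln N)^δ for i = 1, 2. -/

import Mathlib

/-- `f(n) = min_p |n - p|`, the distance from `n` to the nearest prime. -/
noncomputable def primeDist (n : ℤ) : ℕ :=
  sInf {d : ℕ | ∃ p : ℕ, p.Prime ∧ d = (n - (p : ℤ)).natAbs}

open Finset Filter

theorem abs_prod_one_sub_sub_exp_le {ι : Type*} (s : Finset ι) (p : ι → ℝ)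
    (h0 : ∀ i ∈ s, 0 ≤ p i) (h1 : ∀ i ∈ s, p i ≤ 1) :
    |∏ i ∈ s, (1 - p i) - Real.exp (-∑ i ∈ s, p i)| ≤ ∑ i ∈ s, p i ^ 2 := by
  classical
  induction s using Finset.induction_on with
  | empty => simp
  | insert a s ha ih =>
    have ih' := ih (fun i hi => h0 i (mem_insert_of_mem hi)) (fun i hi => h1 i (mem_insert_of_mem hi))
    rw [prod_insert ha, sum_insert ha, sum_insert ha, neg_add, Real.exp_add]
    have ha0 := h0 a (mem_insert_self a s)
    have ha1 := h1 a (mem_insert_self a s)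
    have hexp : |Real.exp (-p a) - 1 - (-p a)| ≤ (-p a) ^ 2 :=
      Real.abs_exp_sub_one_sub_id_le (by rw [abs_neg, abs_of_nonneg ha0]; exact ha1)
    set P := ∏ i ∈ s, (1 - p i)
    set E := Real.exp (-∑ i ∈ s, p i)
    have hE0 : 0 ≤ E := (Real.exp_pos _).le
    have hE1 : E ≤ 1 := Real.exp_le_one_iff.mpr (by
      have := sum_nonneg (fun i hi => h0 i (mem_insert_of_mem hi)); linarith)
    have key : (1 - p a) * P - Real.exp (-p a) * E
        = (1 - p a) * (P - E) - (Real.exp (-p a) - 1 - (-p a)) * E := by ring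
    rw [key]
    calc _ ≤ |(1 - p a) * (P - E)| + |(Real.exp (-p a) - 1 - (-p a)) * E| := abs_sub _ _
      _ ≤ 1 * |P - E| + (-p a) ^ 2 * 1 := by
          rw [abs_mul, abs_mul, abs_of_nonneg hE0, abs_of_nonneg (by linarith : 0 ≤ 1 - p a)]
          gcongr
          linarith
      _ ≤ _ := by nlinarith

section SecondMoment

variable {V κ : Type*} [DecidableEq V] [Fintype V] [Fintype κ]

/-- The probability that a random subset with law `μ` contains `A`. -/
def containProb (μ : Finset V → ℝ) (A : Finset V) : ℝ :=
  ∑ R, if A ⊆ R then μ R else 0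

/-- The law of `R \ ⋃ q, e q` where `R` has law `μ` and, given `R`, the sets `e q` are independent
with laws `g R q`. -/
def removeLaw [DecidableEq κ] (μ : Finset V → ℝ) (g : Finset V → κ → Finset V → ℝ) (R' : Finset V) : ℝ :=
  ∑ R, μ R * ∑ f : κ → Finset V, (∏ q, g R q (f q)) * if R' = R \ univ.biUnion f then 1 else 0

theorem containProb_removeLaw [DecidableEq κ] (μ : Finset V → ℝ) (g : Finset V → κ → Finset V → ℝ)
    (A : Finset V) :
    containProb (removeLaw μ g) A =
      ∑ R, if A ⊆ R then μ R * ∏ q, ∑ e, (if Disjoint e A then g R q e else 0) else 0 := by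
  unfold containProb removeLaw
  have h1 : ∀ R' : Finset V, (if A ⊆ R' then ∑ R, μ R * ∑ f : κ → Finset V,
      (∏ q, g R q (f q)) * (if R' = R \ univ.biUnion f then 1 else 0) else 0)
      = ∑ R, ∑ f : κ → Finset V, μ R * (∏ q, g R q (f q)) *
        (if R' = R \ univ.biUnion f then (if A ⊆ R' then 1 else 0) else 0) := by
    intro R'
    split_ifs with h
    · refine sum_congr rfl fun R _ => ?_
      rw [mul_sum]
      exact sum_congr rfl fun f _ => by ring
    · simp
  simp_rw [h1]
  rw [sum_comm]
  refine sum_congr rfl fun R _ => ?_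
  rw [sum_comm]
  have h2 : ∀ f : κ → Finset V, ∑ R', μ R * (∏ q, g R q (f q)) *
        (if R' = R \ univ.biUnion f then (if A ⊆ R' then 1 else 0) else 0)
      = if A ⊆ R then μ R * ∏ q, (if Disjoint (f q) A then g R q (f q) else 0) else 0 := by
    intro f
    rw [← mul_sum, sum_ite_eq' univ (R \ univ.biUnion f)]
    simp only [mem_univ, if_true]
    by_cases hA : A ⊆ R
    · rw [if_pos hA]
      by_cases hd : ∀ q, Disjoint (f q) A
      · rw [if_pos]
        · simp [hd]
        · rw [subset_sdiff]
          refine ⟨hA, ?_⟩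
          rw [disjoint_biUnion_right]
          exact fun q _ => (hd q).symm
      · push Not at hd
        obtain ⟨q, hq⟩ := hd
        have hz : ∏ q, (if Disjoint (f q) A then g R q (f q) else 0) = 0 :=
          prod_eq_zero (mem_univ q) (if_neg hq)
        rw [if_neg, hz]
        · simp
        · rw [subset_sdiff, disjoint_biUnion_right]
          exact fun h => hq (h.2 q (mem_univ q)).symm
    · rw [if_neg hA, if_neg]
      · simp
      · exact fun h => hA (h.trans sdiff_subset)
  simp_rw [h2]
  split_ifs with hA
  · rw [← mul_sum]
    congr 1
    have := Finset.prod_univ_sum (fun _ : κ => (univ : Finset (Finset V)))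
      (fun q e => if Disjoint e A then g R q e else 0)
    rw [Fintype.piFinset_univ] at this
    rw [this]
  · simp

theorem removeLaw_nonneg [DecidableEq κ] {μ : Finset V → ℝ} {g : Finset V → κ → Finset V → ℝ}
    (hμ : ∀ R, 0 ≤ μ R) (hg : ∀ R q e, 0 ≤ g R q e) (R' : Finset V) : 0 ≤ removeLaw μ g R' := by
  unfold removeLaw
  refine sum_nonneg fun R _ => mul_nonneg (hμ R) (sum_nonneg fun f _ => mul_nonneg
    (prod_nonneg fun q _ => hg R q _) ?_)
  split_ifs <;> norm_num

theorem sum_removeLaw [DecidableEq κ] {μ : Finset V → ℝ} {g : Finset V → κ → Finset V → ℝ}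
    (hg : ∀ R q, ∑ e, g R q e = 1) : ∑ R', removeLaw μ g R' = ∑ R, μ R := by
  have := containProb_removeLaw μ g ∅
  simpa [containProb, hg] using this

theorem exists_of_removeLaw_ne_zero [DecidableEq κ] {μ : Finset V → ℝ} {g : Finset V → κ → Finset V → ℝ}
    {R' : Finset V} (h : removeLaw μ g R' ≠ 0) :
    ∃ R, μ R ≠ 0 ∧ ∃ f : κ → Finset V, (∀ q, g R q (f q) ≠ 0) ∧ R' = R \ univ.biUnion f := by
  unfold removeLaw at h
  obtain ⟨R, -, hR⟩ := exists_ne_zero_of_sum_ne_zero h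
  obtain ⟨f, -, hf⟩ := exists_ne_zero_of_sum_ne_zero (right_ne_zero_of_mul hR)
  refine ⟨R, left_ne_zero_of_mul hR, f, fun q hq => ?_, ?_⟩
  · exact left_ne_zero_of_mul hf (prod_eq_zero (mem_univ q) hq)
  · by_contra hne
    exact right_ne_zero_of_mul hf (if_neg hne)

end SecondMoment

section Conflicts

variable {V : Type*} [DecidableEq V]

/-- The indicator of `A ⊆ R`. -/
def subInd (A R : Finset V) : ℝ := if A ⊆ R then 1 else 0

theorem subInd_nonneg (A R : Finset V) : 0 ≤ subInd A R := by
  unfold subInd; split_ifs <;> norm_num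

theorem subInd_le_one (A R : Finset V) : subInd A R ≤ 1 := by
  unfold subInd; split_ifs <;> norm_num

theorem subInd_mul (A B R : Finset V) : subInd A R * subInd B R = subInd (A ∪ B) R := by
  unfold subInd
  by_cases h1 : A ⊆ R <;> by_cases h2 : B ⊆ R <;> simp [h1, h2, union_subset_iff]

theorem subInd_mul_of_subset {A B : Finset V} (h : A ⊆ B) (R : Finset V) :
    subInd A R * subInd B R = subInd B R := by
  rw [subInd_mul, union_eq_right.mpr h]

theorem pow_card_mul_pow_card_union {ρ : ℝ} (hρ : 0 < ρ) (e f : Finset V) :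
    ρ⁻¹ ^ #e * ρ⁻¹ ^ #f * ρ ^ #(e ∪ f) = ρ⁻¹ ^ #(e ∩ f) := by
  rw [← pow_add, ← card_union_add_card_inter, pow_add, mul_right_comm, ← mul_pow,
    inv_mul_cancel₀ hρ.ne', one_pow, one_mul]

variable [Fintype V]

theorem containProb_eq (μ : Finset V → ℝ) (A : Finset V) :
    containProb μ A = ∑ R, μ R * subInd A R := by
  unfold containProb subInd
  exact sum_congr rfl fun R _ => by split_ifs <;> simp

/-- Second moment bound for a weighted count of the sets `e i ⊆ R`, all containing `F`. -/
theorem second_moment_bound {ι : Type*} [Fintype ι] {μ : Finset V → ℝ} {r : ℕ} {ρ ε γ : ℝ}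
    (hρ0 : 0 < ρ) (hρ1 : ρ ≤ 1) (hε : 0 ≤ ε)
    (hμ : ∀ A : Finset V, #A ≤ 2 * r → |containProb μ A - ρ ^ #A| ≤ ε)
    (F : Finset V) (hF : #F ≤ r) (a : ι → ℝ) (e : ι → Finset V) (ha : ∀ i, 0 ≤ a i)
    (hFe : ∀ i, a i ≠ 0 → F ⊆ e i) (her : ∀ i, a i ≠ 0 → #(e i) ≤ r)
    (hγ : ∑ i, ∑ j, (if e i ∩ e j = F then 0 else a i * a j) ≤ γ) :
    ∑ R, μ R * (subInd F R *
        (∑ i, a i * ρ⁻¹ ^ #(e i) * subInd (e i) R - (∑ i, a i) * ρ⁻¹ ^ #F) ^ 2)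
      ≤ γ * ρ⁻¹ ^ r + 4 * ε * (∑ i, a i) ^ 2 * ρ⁻¹ ^ (2 * r) := by
  set G := ρ⁻¹ with hG
  set s := ∑ i, a i with hs
  have hG1 : 1 ≤ G := (one_le_inv₀ hρ0).mpr hρ1
  have hG0 : 0 < G := by linarith
  have hs0 : 0 ≤ s := sum_nonneg fun i _ => ha i
  have hup : ∀ A : Finset V, #A ≤ 2 * r → containProb μ A ≤ ρ ^ #A + ε := fun A hA => by
    have := (abs_le.mp (hμ A hA)).2; linarith
  have hlo : ∀ A : Finset V, #A ≤ 2 * r → ρ ^ #A - ε ≤ containProb μ A := fun A hA => by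
    have := (abs_le.mp (hμ A hA)).1; linarith
  have hexp : ∑ R, μ R * (subInd F R * (∑ i, a i * G ^ #(e i) * subInd (e i) R - s * G ^ #F) ^ 2)
      = ∑ i, ∑ j, a i * a j * (G ^ #(e i) * G ^ #(e j) * containProb μ (e i ∪ e j))
        - 2 * s * G ^ #F * ∑ i, a i * (G ^ #(e i) * containProb μ (e i))
        + s ^ 2 * G ^ (2 * #F) * containProb μ F := by
    have h1 : ∀ i R, a i * subInd F R * subInd (e i) R = a i * subInd (e i) R := by
      intro i R
      by_cases hi : a i = 0
      · simp [hi]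
      · rw [mul_assoc, subInd_mul_of_subset (hFe i hi)]
    have h2 : ∀ R, subInd F R * (∑ i, a i * G ^ #(e i) * subInd (e i) R) ^ 2
        = ∑ i, ∑ j, a i * a j * (G ^ #(e i) * G ^ #(e j) * subInd (e i ∪ e j) R) := by
      intro R
      rw [sq, sum_mul_sum, mul_sum]
      refine sum_congr rfl fun i _ => ?_
      rw [mul_sum]
      refine sum_congr rfl fun j _ => ?_
      rw [← subInd_mul]
      linear_combination (G ^ #(e i) * G ^ #(e j) * a j * subInd (e j) R) * h1 i R
    have h3 : ∀ R, subInd F R * (∑ i, a i * G ^ #(e i) * subInd (e i) R)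
        = ∑ i, a i * (G ^ #(e i) * subInd (e i) R) := by
      intro R
      rw [mul_sum]
      exact sum_congr rfl fun i _ => by linear_combination (G ^ #(e i)) * h1 i R
    have h4 : ∀ R, μ R * (subInd F R * (∑ i, a i * G ^ #(e i) * subInd (e i) R - s * G ^ #F) ^ 2)
        = ∑ i, ∑ j, a i * a j * (G ^ #(e i) * G ^ #(e j) * (μ R * subInd (e i ∪ e j) R))
          - 2 * s * G ^ #F * ∑ i, a i * (G ^ #(e i) * (μ R * subInd (e i) R))
          + s ^ 2 * G ^ (2 * #F) * (μ R * subInd F R) := by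
      intro R
      have e1 : ∑ i, ∑ j, a i * a j * (G ^ #(e i) * G ^ #(e j) * (μ R * subInd (e i ∪ e j) R))
          = μ R * (subInd F R * (∑ i, a i * G ^ #(e i) * subInd (e i) R) ^ 2) := by
        rw [h2, mul_sum]
        refine sum_congr rfl fun i _ => ?_
        rw [mul_sum]
        exact sum_congr rfl fun j _ => by ring
      have e2 : ∑ i, a i * (G ^ #(e i) * (μ R * subInd (e i) R))
          = μ R * (subInd F R * (∑ i, a i * G ^ #(e i) * subInd (e i) R)) := by
        rw [h3, mul_sum]
        exact sum_congr rfl fun j _ => by ring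
      rw [e1, e2]; ring
    simp_rw [h4]
    rw [sum_add_distrib, sum_sub_distrib, ← mul_sum, ← mul_sum, ← containProb_eq]
    congr 2
    · rw [sum_comm]
      refine sum_congr rfl fun i _ => ?_
      rw [sum_comm]
      refine sum_congr rfl fun j _ => ?_
      rw [← mul_sum, ← mul_sum, ← containProb_eq]
    · rw [sum_comm]
      congr 1
      refine sum_congr rfl fun i _ => ?_
      rw [← mul_sum, ← mul_sum, ← containProb_eq]
  rw [hexp]
  have hGF : G ^ #F ≤ G ^ r := pow_le_pow_right₀ hG1 hF
  have hGr0 : 0 < G ^ r := by positivity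
  have hGF0 : 0 < G ^ #F := by positivity
  have b1 : ∑ i, ∑ j, a i * a j * (G ^ #(e i) * G ^ #(e j) * containProb μ (e i ∪ e j))
      ≤ s ^ 2 * G ^ #F + γ * G ^ r + s ^ 2 * (ε * (G ^ r * G ^ r)) := by
    have hterm : ∀ i j, a i * a j * (G ^ #(e i) * G ^ #(e j) * containProb μ (e i ∪ e j))
        ≤ a i * a j * G ^ #F + (if e i ∩ e j = F then 0 else a i * a j) * G ^ r
          + a i * a j * (ε * (G ^ r * G ^ r)) := by
      intro i j
      by_cases hi : a i = 0
      · simp [hi]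
      by_cases hj : a j = 0
      · simp [hj]
      have hcard : #(e i ∪ e j) ≤ 2 * r := by
        have := card_union_le (e i) (e j); have := her i hi; have := her j hj; omega
      have haa : 0 ≤ a i * a j := mul_nonneg (ha i) (ha j)
      have hGi : G ^ #(e i) ≤ G ^ r := pow_le_pow_right₀ hG1 (her i hi)
      have hGj : G ^ #(e j) ≤ G ^ r := pow_le_pow_right₀ hG1 (her j hj)
      have hGij : G ^ #(e i) * G ^ #(e j) ≤ G ^ r * G ^ r := by gcongr
      have hGint : G ^ #(e i ∩ e j) ≤ G ^ r :=
        pow_le_pow_right₀ hG1 ((card_le_card inter_subset_left).trans (her i hi))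
      have h1 : G ^ #(e i) * G ^ #(e j) * containProb μ (e i ∪ e j)
          ≤ G ^ #(e i ∩ e j) + ε * (G ^ r * G ^ r) := by
        calc _ ≤ G ^ #(e i) * G ^ #(e j) * (ρ ^ #(e i ∪ e j) + ε) := by
              gcongr; exact hup _ hcard
          _ = G ^ #(e i ∩ e j) + ε * (G ^ #(e i) * G ^ #(e j)) := by
              rw [mul_add, pow_card_mul_pow_card_union hρ0]; ring
          _ ≤ _ := by gcongr
      have h2 : a i * a j * G ^ #(e i ∩ e j)
          ≤ a i * a j * G ^ #F + (if e i ∩ e j = F then 0 else a i * a j) * G ^ r := by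
        split_ifs with h
        · rw [h]; simp
        · have : 0 ≤ a i * a j * G ^ #F := by positivity
          nlinarith [mul_le_mul_of_nonneg_left hGint haa]
      nlinarith [mul_le_mul_of_nonneg_left h1 haa]
    have hss : ∀ c : ℝ, ∑ i, ∑ j, a i * a j * c = s ^ 2 * c := by
      intro c
      rw [sq, hs, sum_mul_sum, sum_mul]
      exact sum_congr rfl fun i _ => by rw [sum_mul]
    calc _ ≤ _ := sum_le_sum fun i _ => sum_le_sum fun j _ => hterm i j
      _ = s ^ 2 * G ^ #F + (∑ i, ∑ j, (if e i ∩ e j = F then 0 else a i * a j)) * G ^ r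
          + s ^ 2 * (ε * (G ^ r * G ^ r)) := by
        simp_rw [sum_add_distrib]
        rw [hss, hss, sum_mul]
        congr 2
        exact sum_congr rfl fun i _ => by rw [sum_mul]
      _ ≤ _ := by gcongr
  have b2 : s - s * (ε * G ^ r) ≤ ∑ i, a i * (G ^ #(e i) * containProb μ (e i)) := by
    rw [hs, sum_mul, ← sum_sub_distrib]
    refine sum_le_sum fun i _ => ?_
    by_cases hi : a i = 0
    · simp [hi]
    have hl := hlo (e i) (by have := her i hi; omega)
    have hGi : G ^ #(e i) ≤ G ^ r := pow_le_pow_right₀ hG1 (her i hi)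
    have hone : G ^ #(e i) * ρ ^ #(e i) = 1 := by
      rw [← mul_pow, hG, inv_mul_cancel₀ hρ0.ne', one_pow]
    have h5 : 1 - ε * G ^ r ≤ G ^ #(e i) * containProb μ (e i) := by
      calc 1 - ε * G ^ r ≤ 1 - ε * G ^ #(e i) := by gcongr
        _ = G ^ #(e i) * (ρ ^ #(e i) - ε) := by rw [mul_sub, hone]; ring
        _ ≤ _ := by gcongr
    nlinarith [mul_le_mul_of_nonneg_left h5 (ha i)]
  have b3 : G ^ (2 * #F) * containProb μ F ≤ G ^ #F + ε * (G ^ #F * G ^ #F) := by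
    have h6 := hup F (by omega)
    have hone : G ^ #F * ρ ^ #F = 1 := by
      rw [← mul_pow, hG, inv_mul_cancel₀ hρ0.ne', one_pow]
    calc _ ≤ G ^ (2 * #F) * (ρ ^ #F + ε) := by gcongr
      _ = G ^ #F * (G ^ #F * ρ ^ #F) + ε * (G ^ #F * G ^ #F) := by rw [two_mul, pow_add]; ring
      _ = _ := by rw [hone, mul_one]
  have b3' := mul_le_mul_of_nonneg_left b3 (sq_nonneg s)
  have b2' := mul_le_mul_of_nonneg_left b2 (by positivity : 0 ≤ 2 * s * G ^ #F)
  have c1 : G ^ #F * G ^ r ≤ G ^ r * G ^ r := by gcongr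
  have c2 : G ^ #F * G ^ #F ≤ G ^ r * G ^ r := by gcongr
  have hse : 0 ≤ s ^ 2 * ε := by positivity
  have c1' := mul_le_mul_of_nonneg_left c1 hse
  have c2' := mul_le_mul_of_nonneg_left c2 hse
  have : G ^ (2 * r) = G ^ r * G ^ r := by rw [two_mul, pow_add]
  rw [this]
  nlinarith

end Conflicts

section NibbleStep

variable {V κ : Type*} [DecidableEq V] [Fintype V]

/-- The renormalised weight of the edges of `w q` that survive in `R`. -/
noncomputable def liveWeight (w : κ → Finset V → ℝ) (ρ : ℝ) (R : Finset V) (q : κ) : ℝ :=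
  ∑ e, w q e * ρ⁻¹ ^ #e * subInd e R

/-- The probability of selecting the edge `e` for the index `q` given the set `R`. -/
noncomputable def edgeProb (w : κ → Finset V → ℝ) (ρ T : ℝ) (R : Finset V) (q : κ)
    (e : Finset V) : ℝ :=
  if liveWeight w ρ R q ≤ T then w q e * ρ⁻¹ ^ #e * subInd e R / T else 0

/-- The law of the selected edge: `edgeProb`, with the missing mass put on the empty set. -/
noncomputable def edgeLaw (w : κ → Finset V → ℝ) (ρ T : ℝ) (R : Finset V) (q : κ)
    (e : Finset V) : ℝ :=
  edgeProb w ρ T R q e + if e = ∅ then 1 - ∑ e', edgeProb w ρ T R q e' else 0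

variable {w : κ → Finset V → ℝ} {ρ T : ℝ}

theorem edgeProb_nonneg (hw : ∀ q e, 0 ≤ w q e) (hρ : 0 < ρ) (hT : 0 < T) (R : Finset V) (q : κ)
    (e : Finset V) : 0 ≤ edgeProb w ρ T R q e := by
  unfold edgeProb
  split_ifs
  · have := hw q e
    have := subInd_nonneg e R
    positivity
  · exact le_rfl

theorem sum_edgeProb_le_one (hT : 0 < T) (R : Finset V) (q : κ) :
    ∑ e, edgeProb w ρ T R q e ≤ 1 := by
  unfold edgeProb
  split_ifs with h
  · rw [← sum_div, div_le_one hT]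
    exact h
  · simp

theorem edgeLaw_nonneg (hw : ∀ q e, 0 ≤ w q e) (hρ : 0 < ρ) (hT : 0 < T) (R : Finset V) (q : κ)
    (e : Finset V) : 0 ≤ edgeLaw w ρ T R q e := by
  unfold edgeLaw
  refine add_nonneg (edgeProb_nonneg hw hρ hT R q e) ?_
  have := sum_edgeProb_le_one (w := w) (ρ := ρ) hT R q
  split_ifs <;> linarith

theorem sum_edgeLaw (R : Finset V) (q : κ) : ∑ e, edgeLaw w ρ T R q e = 1 := by
  unfold edgeLaw
  rw [sum_add_distrib, sum_ite_eq' univ (∅ : Finset V)]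
  simp

theorem sum_edgeLaw_disjoint (R : Finset V) (q : κ) (A : Finset V) :
    ∑ e, (if Disjoint e A then edgeLaw w ρ T R q e else 0)
      = 1 - ∑ e, (if Disjoint e A then 0 else edgeProb w ρ T R q e) := by
  have h1 : ∀ e, (if Disjoint e A then edgeLaw w ρ T R q e else 0)
      = edgeLaw w ρ T R q e - (if Disjoint e A then 0 else edgeProb w ρ T R q e) := by
    intro e
    split_ifs with h
    · simp
    · have : e ≠ ∅ := by rintro rfl; exact h (disjoint_empty_left A)
      simp [edgeLaw, this]
  simp_rw [h1]
  rw [sum_sub_distrib, sum_edgeLaw]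

theorem not_disjoint_le_sum {V : Type*} [DecidableEq V] (e A : Finset V) :
    (if Disjoint e A then (0 : ℝ) else 1) ≤ ∑ v ∈ A, if v ∈ e then 1 else 0 := by
  split_ifs with h
  · exact sum_nonneg fun v _ => by split_ifs <;> norm_num
  · obtain ⟨v, hve, hvA⟩ := not_disjoint_iff.mp h
    calc (1 : ℝ) = if v ∈ e then 1 else 0 := by simp [hve]
      _ ≤ _ := single_le_sum (f := fun v => if v ∈ e then (1 : ℝ) else 0)
        (fun v _ => by split_ifs <;> norm_num) hvA

theorem sum_le_not_disjoint_add {V : Type*} [DecidableEq V] (e A : Finset V) :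
    (∑ v ∈ A, if v ∈ e then (1 : ℝ) else 0)
      ≤ (if Disjoint e A then (0 : ℝ) else 1) +
        ∑ v ∈ A, ∑ v' ∈ A.erase v, if v ∈ e ∧ v' ∈ e then 1 else 0 := by
  have hnn : 0 ≤ ∑ v ∈ A, ∑ v' ∈ A.erase v, if v ∈ e ∧ v' ∈ e then (1 : ℝ) else 0 :=
    sum_nonneg fun v _ => sum_nonneg fun v' _ => by split_ifs <;> norm_num
  split_ifs with h
  · rw [sum_eq_zero]
    · simpa using hnn
    · exact fun v hv => if_neg fun hve => (disjoint_left.mp h hve) hv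
  · obtain ⟨v₀, hve, hvA⟩ := not_disjoint_iff.mp h
    rw [← add_sum_erase A _ hvA]
    gcongr
    · simp [hve]
    · refine sum_le_sum_of_subset_of_nonneg (erase_subset v₀ A) ?_ |>.trans' ?_
      · exact fun v _ _ => sum_nonneg fun v' _ => by split_ifs <;> norm_num
      · refine sum_le_sum fun v hv => ?_
        have hv0 : v₀ ∈ A.erase v := mem_erase.mpr ⟨(ne_of_mem_erase hv).symm, hvA⟩
        calc (if v ∈ e then (1 : ℝ) else 0) = if v ∈ e ∧ v₀ ∈ e then 1 else 0 := by simp [hve]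
          _ ≤ _ := single_le_sum (f := fun v' => if v ∈ e ∧ v' ∈ e then (1 : ℝ) else 0)
            (fun v _ => by split_ifs <;> norm_num) hv0

/-- Cauchy–Schwarz for a finite probability. -/
theorem sum_mul_abs_le_sqrt {ι : Type*} [Fintype ι] {μ p f : ι → ℝ} (hμ : ∀ i, 0 ≤ μ i)
    (hμ1 : ∑ i, μ i = 1) (hp0 : ∀ i, 0 ≤ p i) (hp1 : ∀ i, p i ≤ 1) {M : ℝ}
    (hM : ∑ i, μ i * (p i * f i ^ 2) ≤ M) :
    ∑ i, μ i * (p i * |f i|) ≤ √M := by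
  refine Real.le_sqrt_of_sq_le (le_trans ?_ hM)
  have := Finset.sum_sq_le_sum_mul_sum_of_sq_le_mul univ (r := fun i => μ i * (p i * |f i|))
    (f := fun i => μ i) (g := fun i => μ i * (p i * |f i|) ^ 2)
    (fun i _ => hμ i) (fun i _ => mul_nonneg (hμ i) (sq_nonneg _)) (fun i _ => le_of_eq (by ring))
  rw [hμ1, one_mul] at this
  refine this.trans (sum_le_sum fun i _ => mul_le_mul_of_nonneg_left ?_ (hμ i))
  rw [mul_pow, sq_abs]
  have : p i ^ 2 ≤ p i := by nlinarith [hp0 i, hp1 i]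
  gcongr

variable {μ : Finset V → ℝ} {r : ℕ} {d β ε : ℝ}

theorem liveWeight_second_moment (hw0 : ∀ q e, 0 ≤ w q e) (hw1 : ∀ q, ∑ e, w q e ≤ 1)
    (hwr : ∀ q e, w q e ≠ 0 → #e ≤ r)
    (hβ : ∀ q v, ∑ e, (if v ∈ e then w q e else 0) ≤ β)
    (hρ0 : 0 < ρ) (hρ1 : ρ ≤ 1) (hε : 0 ≤ ε) (hβ0 : 0 ≤ β)
    (hμ : ∀ A : Finset V, #A ≤ 2 * r → |containProb μ A - ρ ^ #A| ≤ ε) (q : κ) :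
    ∑ R, μ R * (liveWeight w ρ R q - ∑ e, w q e) ^ 2 ≤ (4 * ε + r * β) * ρ⁻¹ ^ (2 * r) := by
  have hx0 : 0 ≤ ∑ e, w q e := sum_nonneg fun e _ => hw0 q e
  have hG1 : 1 ≤ ρ⁻¹ := (one_le_inv₀ hρ0).mpr hρ1
  have hγ : ∑ e, ∑ f, (if e ∩ f = ∅ then 0 else w q e * w q f) ≤ r * β := by
    have h1 : ∀ e, ∑ f, (if e ∩ f = ∅ then 0 else w q e * w q f) ≤ w q e * (r * β) := by
      intro e
      by_cases he : w q e = 0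
      · simp [he]
      calc _ = w q e * ∑ f, (if Disjoint f e then 0 else 1) * w q f := by
            rw [mul_sum]
            refine sum_congr rfl fun f _ => ?_
            have hiff : e ∩ f = ∅ ↔ Disjoint f e := by
              rw [← disjoint_iff_inter_eq_empty, disjoint_comm]
            simp only [hiff]
            split_ifs <;> ring
        _ ≤ w q e * ∑ f, (∑ v ∈ e, if v ∈ f then 1 else 0) * w q f := by
            gcongr with f
            · exact hw0 q e
            · exact hw0 q f
            · exact not_disjoint_le_sum f e
        _ = w q e * ∑ v ∈ e, ∑ f, if v ∈ f then w q f else 0 := by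
            rw [sum_comm]
            congr 1
            refine sum_congr rfl fun f _ => ?_
            rw [sum_mul]
            exact sum_congr rfl fun v _ => by split_ifs <;> ring
        _ ≤ w q e * ∑ v ∈ e, β := by
            gcongr with v
            · exact hw0 q e
            · exact hβ q v
        _ ≤ w q e * (r * β) := by
            rw [sum_const, nsmul_eq_mul]
            gcongr
            · exact hw0 q e
            · exact hwr q e he
    calc _ ≤ ∑ e, w q e * (r * β) := sum_le_sum fun e _ => h1 e
      _ = (∑ e, w q e) * (r * β) := by rw [sum_mul]
      _ ≤ 1 * (r * β) := by gcongr; exact hw1 q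
      _ = _ := one_mul _
  have h := second_moment_bound hρ0 hρ1 hε hμ ∅ (by simp) (w q) id (hw0 q)
    (fun _ _ => empty_subset _) (hwr q) hγ
  have hind : ∀ R : Finset V, subInd ∅ R = 1 := fun R => by simp [subInd]
  simp only [hind, id, card_empty, pow_zero, mul_one, one_mul] at h
  refine h.trans ?_
  have h2 : ρ⁻¹ ^ r ≤ ρ⁻¹ ^ (2 * r) := pow_le_pow_right₀ hG1 (by omega)
  have h3 : (∑ e, w q e) ^ 2 ≤ 1 := pow_le_one₀ hx0 (hw1 q)
  calc _ ≤ r * β * ρ⁻¹ ^ (2 * r) + 4 * ε * 1 * ρ⁻¹ ^ (2 * r) := by gcongr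
    _ = _ := by ring

/-- The renormalised degree of `v` in the surviving edges. -/
noncomputable def liveDegree [Fintype κ] (w : κ → Finset V → ℝ) (ρ : ℝ) (R : Finset V) (v : V) : ℝ :=
  ∑ q, ∑ e, (if v ∈ e then w q e else 0) * ρ⁻¹ ^ #e * subInd e R

theorem liveDegree_second_moment [Fintype κ] (hw0 : ∀ q e, 0 ≤ w q e)
    (hwr : ∀ q e, w q e ≠ 0 → #e ≤ r) (hr : 1 ≤ r)
    (hdeg : ∀ v, ∑ q, ∑ e, (if v ∈ e then w q e else 0) = d) (hd0 : 0 ≤ d) (hd1 : d ≤ 1)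
    (hcod : ∀ v v', v ≠ v' → ∑ q, ∑ e, (if v ∈ e ∧ v' ∈ e then w q e else 0) ≤ β)
    (hρ0 : 0 < ρ) (hρ1 : ρ ≤ 1) (hε : 0 ≤ ε) (hβ0 : 0 ≤ β)
    (hμ : ∀ A : Finset V, #A ≤ 2 * r → |containProb μ A - ρ ^ #A| ≤ ε) (v : V) :
    ∑ R, μ R * (subInd {v} R * (liveDegree w ρ R v - d * ρ⁻¹) ^ 2)
      ≤ (4 * ε + r * β) * ρ⁻¹ ^ (2 * r) := by
  have hG1 : 1 ≤ ρ⁻¹ := (one_le_inv₀ hρ0).mpr hρ1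
  set a : κ × Finset V → ℝ := fun i => if v ∈ i.2 then w i.1 i.2 else 0 with ha
  have ha0 : ∀ i, 0 ≤ a i := fun i => by
    simp only [ha]; split_ifs
    · exact hw0 _ _
    · exact le_rfl
  have hav : ∀ i, a i ≠ 0 → v ∈ i.2 := fun i hi => by
    by_contra h; exact hi (by simp [ha, h])
  have haw : ∀ i, a i ≠ 0 → w i.1 i.2 ≠ 0 := fun i hi h => hi (by simp [ha, h])
  have hsum : ∑ i, a i = d := by rw [← hdeg v, Fintype.sum_prod_type]
  have hγ : ∑ i, ∑ j, (if i.2 ∩ j.2 = {v} then 0 else a i * a j) ≤ r * β := by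
    have h1 : ∀ i, ∑ j, (if i.2 ∩ j.2 = {v} then 0 else a i * a j) ≤ a i * (r * β) := by
      intro i
      by_cases hi : a i = 0
      · simp [hi]
      have hvi := hav i hi
      calc _ ≤ ∑ j, a i * ((∑ v' ∈ i.2.erase v, if v' ∈ j.2 then 1 else 0) * a j) := by
            refine sum_le_sum fun j _ => ?_
            by_cases hj : a j = 0
            · simp [hj]
            have hvj := hav j hj
            split_ifs with h
            · refine mul_nonneg (ha0 i) (mul_nonneg (sum_nonneg fun v' _ => ?_) (ha0 j))
              split_ifs <;> norm_num
            · refine mul_le_mul_of_nonneg_left ?_ (ha0 i)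
              have hnd : ¬ Disjoint j.2 (i.2.erase v) := by
                intro hdis
                apply h
                ext u
                simp only [mem_inter, mem_singleton]
                constructor
                · rintro ⟨h1, h2⟩
                  by_contra hne
                  exact disjoint_left.mp hdis h2 (mem_erase.mpr ⟨hne, h1⟩)
                · rintro rfl; exact ⟨hvi, hvj⟩
              have := not_disjoint_le_sum j.2 (i.2.erase v)
              rw [if_neg hnd] at this
              nlinarith [ha0 j]
        _ = a i * ∑ v' ∈ i.2.erase v, ∑ j : κ × Finset V, if v ∈ j.2 ∧ v' ∈ j.2 then w j.1 j.2 else 0 := by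
            rw [← mul_sum, sum_comm]
            congr 1
            refine sum_congr rfl fun j _ => ?_
            rw [sum_mul]
            refine sum_congr rfl fun v' _ => ?_
            by_cases h1 : v ∈ j.2 <;> by_cases h2 : v' ∈ j.2 <;> simp [ha, h1, h2]
        _ ≤ a i * ∑ v' ∈ i.2.erase v, β := by
            refine mul_le_mul_of_nonneg_left (sum_le_sum fun v' hv' => ?_) (ha0 i)
            rw [Fintype.sum_prod_type]
            exact hcod v v' (ne_of_mem_erase hv').symm
        _ ≤ a i * (r * β) := by
            rw [sum_const, nsmul_eq_mul]
            refine mul_le_mul_of_nonneg_left (mul_le_mul_of_nonneg_right ?_ hβ0) (ha0 i)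
            exact_mod_cast (card_le_card (erase_subset v i.2)).trans (hwr _ _ (haw i hi))
    calc _ ≤ ∑ i, a i * (r * β) := sum_le_sum fun e _ => h1 e
      _ = d * (r * β) := by rw [← sum_mul, hsum]
      _ ≤ 1 * (r * β) := by gcongr
      _ = _ := one_mul _
  have h := second_moment_bound hρ0 hρ1 hε hμ {v} (by simpa using hr) a Prod.snd ha0
    (fun i hi => by simpa using hav i hi) (fun i hi => hwr _ _ (haw i hi)) hγ
  rw [hsum] at h
  simp only [card_singleton, pow_one] at h
  have hl : ∀ R, ∑ i, a i * ρ⁻¹ ^ #i.2 * subInd i.2 R = liveDegree w ρ R v := fun R => by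
    rw [Fintype.sum_prod_type]; rfl
  simp only [hl] at h
  refine h.trans ?_
  have h2 : ρ⁻¹ ^ r ≤ ρ⁻¹ ^ (2 * r) := pow_le_pow_right₀ hG1 (by omega)
  have h3 : d ^ 2 ≤ 1 := pow_le_one₀ hd0 hd1
  calc _ ≤ r * β * ρ⁻¹ ^ (2 * r) + 4 * ε * 1 * ρ⁻¹ ^ (2 * r) := by gcongr
    _ = _ := by ring

end NibbleStep

theorem nibble_error_le {a r : ℕ} {ε β n G T B : ℝ} (hr : 1 ≤ r) (hA : a ≤ 2 * r) (hε : 0 ≤ ε)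
    (hβ0 : 0 ≤ β) (hn0 : 0 ≤ n) (hG1 : 1 ≤ G) (hT : 1 < T) (hT2 : T ≤ 2) (hsum : ε + β ≤ 1)
    (hB1 : 1 ≤ B) (hB : n * β ≤ B) :
    ε + n * (a * (β * G ^ r)) ^ 2
        + a * (β * G ^ r) * (n * (((4 * ε + r * β) * G ^ (2 * r)) / (T - 1) ^ 2))
        + a ^ 2 * (β * G ^ r) + a * √((4 * ε + r * β) * G ^ (2 * r))
      ≤ 21 * r ^ 2 * B * G ^ (3 * r) / (T - 1) ^ 2 * √(ε + β) := by
  set M := (4 * ε + r * β) * G ^ (2 * r) with hM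
  set s := ε + β with hs
  have hs0 : 0 ≤ s := by positivity
  have hsq : s ≤ √s := by
    rw [Real.le_sqrt hs0 hs0]; nlinarith
  set q := √s with hq
  have hq0 : 0 ≤ q := Real.sqrt_nonneg _
  have hr' : (1 : ℝ) ≤ r := by exact_mod_cast hr
  have hA' : (a : ℝ) ≤ 2 * r := by exact_mod_cast hA
  have hGr : 1 ≤ G ^ r := one_le_pow₀ hG1
  have hX : 1 ≤ 1 / (T - 1) ^ 2 := by
    have h1 : 0 < T - 1 := by linarith
    rw [le_div_iff₀ (by positivity)]; nlinarith
  set X := 1 / (T - 1) ^ 2 with hXd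
  have hX0 : 0 < X := by linarith
  set g := G ^ r with hg
  have hg0 : 0 < g := by linarith
  have hg2 : G ^ (2 * r) = g ^ 2 := by rw [hg, ← pow_mul, mul_comm]
  have hg3 : G ^ (3 * r) = g ^ 3 := by rw [hg, ← pow_mul, mul_comm]
  have hβs : β ≤ s := by linarith
  have hεs : ε ≤ s := by linarith
  have h4s : 4 * ε + r * β ≤ 4 * r * s := by nlinarith
  set Y := (r : ℝ) ^ 2 * B * g ^ 3 * X with hY
  have hr2 : (1 : ℝ) ≤ (r : ℝ) ^ 2 := one_le_pow₀ hr'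
  have hg3' : 1 ≤ g ^ 3 := one_le_pow₀ hGr
  have hg23 : g ^ 2 ≤ g ^ 3 := pow_le_pow_right₀ hGr (by norm_num)
  have hg13 : g ≤ g ^ 3 := le_self_pow₀ hGr (by norm_num)
  have hY1 : 1 ≤ Y := by
    have : (1 : ℝ) * 1 * 1 * 1 ≤ (r : ℝ) ^ 2 * B * g ^ 3 * X := by gcongr
    linarith
  have hY2 : (r : ℝ) ^ 2 * B * g ^ 2 * 1 ≤ Y := by rw [hY]; gcongr
  have hY3 : (r : ℝ) ^ 2 * 1 * g * 1 ≤ Y := by rw [hY]; gcongr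
  have hY0 : 0 ≤ Y := by linarith
  have u1 : ε ≤ Y * q := by nlinarith
  have u2 : n * (a * (β * g)) ^ 2 ≤ 4 * (Y * q) := by
    calc n * (a * (β * g)) ^ 2 = (a : ℝ) ^ 2 * (n * β) * g ^ 2 * β := by ring
      _ ≤ (2 * r) ^ 2 * B * g ^ 2 * q := by gcongr; linarith
      _ = 4 * ((r : ℝ) ^ 2 * B * g ^ 2 * 1 * q) := by ring
      _ ≤ _ := by gcongr
  have u3 : a * (β * g) * (n * (M / (T - 1) ^ 2)) ≤ 8 * (Y * q) := by
    calc a * (β * g) * (n * (M / (T - 1) ^ 2))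
        = a * (n * β) * g * ((4 * ε + r * β) * g ^ 2) * X := by rw [hM, hXd, hg2]; ring
      _ ≤ (2 * r) * B * g * ((4 * r * q) * g ^ 2) * X := by
          gcongr
          exact h4s.trans (by gcongr)
      _ = 8 * (Y * q) := by rw [hY]; ring
  have u4 : (a : ℝ) ^ 2 * (β * g) ≤ 4 * (Y * q) := by
    calc (a : ℝ) ^ 2 * (β * g) ≤ (2 * r) ^ 2 * (q * g) := by gcongr; linarith
      _ = 4 * ((r : ℝ) ^ 2 * 1 * g * 1 * q) := by ring
      _ ≤ _ := by gcongr
  have u5 : a * √M ≤ 4 * (Y * q) := by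
    have hMle : √M ≤ 2 * r * g * q := by
      rw [Real.sqrt_le_left (by positivity), hM, hg2]
      have : q ^ 2 = s := Real.sq_sqrt hs0
      calc _ ≤ 4 * r * s * g ^ 2 := by gcongr
        _ ≤ 4 * (r : ℝ) ^ 2 * s * g ^ 2 := by gcongr; nlinarith
        _ = _ := by rw [← this]; ring
    calc a * √M ≤ (2 * r) * (2 * r * g * q) := by gcongr
      _ = 4 * ((r : ℝ) ^ 2 * 1 * g * 1 * q) := by ring
      _ ≤ _ := by gcongr
  have : 21 * (r : ℝ) ^ 2 * B * G ^ (3 * r) / (T - 1) ^ 2 * q = 21 * (Y * q) := by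
    rw [hY, hXd, hg3]; ring
  rw [this]
  linarith

section NibbleStep

variable {V κ : Type*} [DecidableEq V] [Fintype V] [Fintype κ] {w : κ → Finset V → ℝ}
  {μ : Finset V → ℝ} {r : ℕ} {ρ T d β ε : ℝ}

/-- The expected number of indices whose surviving weight is too large. -/
theorem sum_bad_le (hw0 : ∀ q e, 0 ≤ w q e) (hw1 : ∀ q, ∑ e, w q e ≤ 1)
    (hwr : ∀ q e, w q e ≠ 0 → #e ≤ r)
    (hβ : ∀ q v, ∑ e, (if v ∈ e then w q e else 0) ≤ β)
    (hρ0 : 0 < ρ) (hρ1 : ρ ≤ 1) (hε : 0 ≤ ε) (hβ0 : 0 ≤ β) (hT : 1 < T)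
    (hμ0 : ∀ R, 0 ≤ μ R)
    (hμ : ∀ A : Finset V, #A ≤ 2 * r → |containProb μ A - ρ ^ #A| ≤ ε) :
    ∑ R, μ R * ∑ q, (if liveWeight w ρ R q ≤ T then 0 else 1)
      ≤ Fintype.card κ * ((4 * ε + r * β) * ρ⁻¹ ^ (2 * r) / (T - 1) ^ 2) := by
  have hT1 : 0 < (T - 1) ^ 2 := by have : 0 < T - 1 := by linarith
                                   positivity
  simp_rw [mul_sum]
  rw [sum_comm]
  have : ∀ q, ∑ R, μ R * (if liveWeight w ρ R q ≤ T then 0 else 1)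
      ≤ (4 * ε + r * β) * ρ⁻¹ ^ (2 * r) / (T - 1) ^ 2 := by
    intro q
    refine le_trans ?_ (div_le_div_of_nonneg_right
      (liveWeight_second_moment hw0 hw1 hwr hβ hρ0 hρ1 hε hβ0 hμ q) hT1.le)
    rw [sum_div]
    refine sum_le_sum fun R _ => ?_
    rw [mul_div_assoc]
    refine mul_le_mul_of_nonneg_left ?_ (hμ0 R)
    split_ifs with h
    · positivity
    · rw [le_div_iff₀ hT1, one_mul]
      push Not at h
      have := hw1 q
      exact pow_le_pow_left₀ (by linarith) (by linarith) 2
  calc _ ≤ ∑ _q : κ, (4 * ε + r * β) * ρ⁻¹ ^ (2 * r) / (T - 1) ^ 2 := sum_le_sum fun q _ => this q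
    _ = _ := by simp

/-- Pointwise estimate for the conditional probability that `A` survives. -/
theorem abs_prod_sub_exp_le (hw0 : ∀ q e, 0 ≤ w q e)
    (hwr : ∀ q e, w q e ≠ 0 → #e ≤ r)
    (hβ : ∀ q v, ∑ e, (if v ∈ e then w q e else 0) ≤ β)
    (hcod : ∀ v v', v ≠ v' → ∑ q, ∑ e, (if v ∈ e ∧ v' ∈ e then w q e else 0) ≤ β)
    (hρ0 : 0 < ρ) (hρ1 : ρ ≤ 1) (hβ0 : 0 ≤ β) (hT : 1 < T) (hd0 : 0 ≤ d) (R A : Finset V) :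
    |∏ q, ∑ e, (if Disjoint e A then edgeLaw w ρ T R q e else 0)
        - Real.exp (-(#A * (d * ρ⁻¹ / T)))|
      ≤ Fintype.card κ * (#A * (β * ρ⁻¹ ^ r)) ^ 2
        + #A * (β * ρ⁻¹ ^ r) * ∑ q, (if liveWeight w ρ R q ≤ T then 0 else 1)
        + #A ^ 2 * (β * ρ⁻¹ ^ r) + ∑ v ∈ A, |liveDegree w ρ R v - d * ρ⁻¹| := by
  have hT0 : 0 < T := by linarith
  have hG1 : 1 ≤ ρ⁻¹ := (one_le_inv₀ hρ0).mpr hρ1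
  set G := ρ⁻¹ with hG
  have hG0 : 0 < G := by linarith
  set p : κ → ℝ := fun q => ∑ e, (if Disjoint e A then 0 else edgeProb w ρ T R q e) with hp
  -- the same sums without discarding the bad indices
  set p' : κ → ℝ := fun q => ∑ e, (if Disjoint e A then 0 else 1) * (w q e * G ^ #e * subInd e R) / T
    with hp'
  have hterm0 : ∀ q e, 0 ≤ w q e * G ^ #e * subInd e R := fun q e => by
    have := hw0 q e; have := subInd_nonneg e R; positivity
  have htermle : ∀ q e, w q e * G ^ #e * subInd e R ≤ w q e * G ^ r := fun q e => by
    by_cases h : w q e = 0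
    · simp [h]
    have h1 := pow_le_pow_right₀ hG1 (hwr q e h)
    calc _ ≤ w q e * G ^ r * 1 := by
          gcongr
          · exact subInd_nonneg e R
          · exact mul_nonneg (hw0 q e) (by positivity)
          · exact hw0 q e
          · exact subInd_le_one e R
      _ = _ := mul_one _
  have hp'0 : ∀ q, 0 ≤ p' q := fun q => sum_nonneg fun e _ => by
    refine div_nonneg (mul_nonneg ?_ (hterm0 q e)) hT0.le
    split_ifs <;> norm_num
  have hp'le : ∀ q, p' q ≤ #A * (β * G ^ r) := fun q => by
    calc p' q ≤ ∑ e, (∑ v ∈ A, if v ∈ e then 1 else 0) * (w q e * G ^ r) := by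
          refine sum_le_sum fun e _ => (div_le_self (mul_nonneg ?_ (hterm0 q e)) hT.le).trans ?_
          · split_ifs <;> norm_num
          · refine mul_le_mul (not_disjoint_le_sum e A) (htermle q e) (hterm0 q e) ?_
            exact sum_nonneg fun v _ => by split_ifs <;> norm_num
      _ = ∑ v ∈ A, (∑ e, if v ∈ e then w q e else 0) * G ^ r := by
          simp_rw [sum_mul]
          rw [sum_comm]
          exact sum_congr rfl fun v _ => sum_congr rfl fun e _ => by split_ifs <;> ring
      _ ≤ ∑ v ∈ A, β * G ^ r := by
          gcongr with v
          exact hβ q v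
      _ = _ := by simp
  have hpp' : ∀ q, p q = if liveWeight w ρ R q ≤ T then p' q else 0 := fun q => by
    simp only [hp, hp', edgeProb]
    split_ifs with h
    · refine sum_congr rfl fun e _ => ?_
      split_ifs
      · simp
      · rw [one_mul]
    · simp
  have hp0 : ∀ q, 0 ≤ p q := fun q => by
    rw [hpp']; split_ifs
    · exact hp'0 q
    · exact le_rfl
  have hple : ∀ q, p q ≤ p' q := fun q => by
    rw [hpp']; split_ifs
    · exact le_rfl
    · exact hp'0 q
  have hp1 : ∀ q, p q ≤ 1 := fun q => by
    refine le_trans (sum_le_sum fun e _ => ?_) (sum_edgeProb_le_one (w := w) (ρ := ρ) hT0 R q)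
    split_ifs
    · exact edgeProb_nonneg hw0 hρ0 hT0 R q e
    · exact le_rfl
  have s1 : |∏ q, ∑ e, (if Disjoint e A then edgeLaw w ρ T R q e else 0) - Real.exp (-∑ q, p q)|
      ≤ Fintype.card κ * (#A * (β * G ^ r)) ^ 2 := by
    simp_rw [sum_edgeLaw_disjoint]
    refine (abs_prod_one_sub_sub_exp_le univ p (fun q _ => hp0 q) (fun q _ => hp1 q)).trans ?_
    calc ∑ q, p q ^ 2 ≤ ∑ _q : κ, (#A * (β * G ^ r)) ^ 2 :=
          sum_le_sum fun q _ => pow_le_pow_left₀ (hp0 q) ((hple q).trans (hp'le q)) 2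
      _ = _ := by simp
  have s2 : |∑ q, p' q - ∑ q, p q|
      ≤ #A * (β * G ^ r) * ∑ q, (if liveWeight w ρ R q ≤ T then 0 else 1) := by
    rw [← sum_sub_distrib, mul_sum]
    refine (abs_sum_le_sum_abs _ _).trans (sum_le_sum fun q _ => ?_)
    rw [hpp']
    split_ifs
    · simp
    · rw [sub_zero, mul_one, abs_of_nonneg (hp'0 q)]; exact hp'le q
  have hU : ∑ v ∈ A, liveDegree w ρ R v / T
      = ∑ q, ∑ e, (∑ v ∈ A, if v ∈ e then 1 else 0) * (w q e * G ^ #e * subInd e R) / T := by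
    unfold liveDegree
    simp_rw [sum_div, sum_mul, sum_div]
    rw [sum_comm]
    refine sum_congr rfl fun q _ => ?_
    rw [sum_comm]
    refine sum_congr rfl fun e _ => sum_congr rfl fun v _ => ?_
    split_ifs <;> ring
  have s3 : |∑ q, p' q - ∑ v ∈ A, liveDegree w ρ R v / T| ≤ #A ^ 2 * (β * G ^ r) := by
    rw [hU, abs_sub_comm, ← sum_sub_distrib]
    have hle : ∀ q e, ((∑ v ∈ A, if v ∈ e then (1 : ℝ) else 0) * (w q e * G ^ #e * subInd e R) / T
        - (if Disjoint e A then 0 else 1) * (w q e * G ^ #e * subInd e R) / T)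
        ≤ (∑ v ∈ A, ∑ v' ∈ A.erase v, if v ∈ e ∧ v' ∈ e then 1 else 0) * (w q e * G ^ r) := by
      intro q e
      rw [← sub_div, ← sub_mul]
      have h0 : 0 ≤ (∑ v ∈ A, if v ∈ e then (1 : ℝ) else 0) - (if Disjoint e A then 0 else 1) := by
        linarith [not_disjoint_le_sum e A]
      refine (div_le_self (mul_nonneg h0 (hterm0 q e)) hT.le).trans ?_
      refine mul_le_mul ?_ (htermle q e) (hterm0 q e) ?_
      · linarith [sum_le_not_disjoint_add e A]
      · exact sum_nonneg fun v _ => sum_nonneg fun v' _ => by split_ifs <;> norm_num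
    rw [abs_of_nonneg]
    · calc _ ≤ ∑ q, ∑ e, (∑ v ∈ A, ∑ v' ∈ A.erase v, if v ∈ e ∧ v' ∈ e then 1 else 0)
            * (w q e * G ^ r) := by
            refine sum_le_sum fun q _ => ?_
            rw [hp', ← sum_sub_distrib]
            exact sum_le_sum fun e _ => hle q e
        _ = ∑ v ∈ A, ∑ v' ∈ A.erase v,
            (∑ q, ∑ e, if v ∈ e ∧ v' ∈ e then w q e else 0) * G ^ r := by
            simp_rw [sum_mul]
            have hc : ∀ q, ∑ e, ∑ v ∈ A, ∑ v' ∈ A.erase v,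
                (if v ∈ e ∧ v' ∈ e then (1:ℝ) else 0) * (w q e * G ^ r)
                = ∑ v ∈ A, ∑ v' ∈ A.erase v, ∑ e,
                  (if v ∈ e ∧ v' ∈ e then w q e else 0) * G ^ r := by
              intro q
              rw [sum_comm]
              refine sum_congr rfl fun v _ => ?_
              rw [sum_comm]
              exact sum_congr rfl fun v' _ => sum_congr rfl fun e _ => by split_ifs <;> ring
            simp_rw [hc]
            rw [sum_comm]
            refine sum_congr rfl fun v _ => ?_
            rw [sum_comm]
        _ ≤ ∑ v ∈ A, ∑ v' ∈ A.erase v, β * G ^ r := by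
            refine sum_le_sum fun v _ => sum_le_sum fun v' hv' => ?_
            gcongr
            exact hcod v v' (ne_of_mem_erase hv').symm
        _ ≤ ∑ v ∈ A, ∑ v' ∈ A, β * G ^ r := by
            refine sum_le_sum fun v _ => sum_le_sum_of_subset_of_nonneg (erase_subset v A) ?_
            intros; positivity
        _ = _ := by simp; ring
    · refine sum_nonneg fun q _ => ?_
      rw [hp', ← sum_sub_distrib]
      refine sum_nonneg fun e _ => ?_
      rw [← sub_div, ← sub_mul]
      refine div_nonneg (mul_nonneg ?_ (hterm0 q e)) hT0.le
      linarith [not_disjoint_le_sum e A]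
  have s4 : |∑ v ∈ A, liveDegree w ρ R v / T - #A * (d * G / T)|
      ≤ ∑ v ∈ A, |liveDegree w ρ R v - d * G| := by
    have : (#A : ℝ) * (d * G / T) = ∑ v ∈ A, d * G / T := by simp
    rw [this, ← sum_sub_distrib]
    refine (abs_sum_le_sum_abs _ _).trans (sum_le_sum fun v _ => ?_)
    rw [← sub_div, abs_div, abs_of_pos hT0]
    exact div_le_self (abs_nonneg _) hT.le
  have s5 : |Real.exp (-∑ q, p q) - Real.exp (-(#A * (d * G / T)))|
      ≤ |∑ q, p q - #A * (d * G / T)| := by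
    have hmono : ∀ a b : ℝ, 0 ≤ a → a ≤ b → |Real.exp (-a) - Real.exp (-b)| ≤ |a - b| := by
      intro a b ha hab
      have h1 : Real.exp (-b) ≤ Real.exp (-a) := Real.exp_le_exp.mpr (by linarith)
      rw [abs_of_nonneg (by linarith), abs_of_nonpos (by linarith)]
      have h2 : Real.exp (-b) = Real.exp (-a) * Real.exp (-(b - a)) := by
        rw [← Real.exp_add]; congr 1; ring
      have h3 := Real.add_one_le_exp (-(b - a))
      have h4 : Real.exp (-a) ≤ 1 := Real.exp_le_one_iff.mpr (by linarith)
      have h5 := Real.exp_pos (-a)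
      rw [h2]
      nlinarith
    have hS : 0 ≤ ∑ q, p q := sum_nonneg fun q _ => hp0 q
    have hY : 0 ≤ #A * (d * G / T) := by positivity
    rcases le_total (∑ q, p q) (#A * (d * G / T)) with h | h
    · exact hmono _ _ hS h
    · rw [abs_sub_comm, abs_sub_comm (∑ q, p q)]
      exact hmono _ _ hY h
  have t1 := abs_le.mp s1
  have t2 := abs_le.mp s2
  have t3 := abs_le.mp s3
  have t4 := abs_le.mp s4
  have t6 : |∑ q, p q - #A * (d * G / T)|
      ≤ #A * (β * G ^ r) * ∑ q, (if liveWeight w ρ R q ≤ T then 0 else 1)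
        + #A ^ 2 * (β * G ^ r) + ∑ v ∈ A, |liveDegree w ρ R v - d * G| := by
    rw [abs_le]; constructor <;> linarith
  have t5 := abs_le.mp (s5.trans t6)
  rw [abs_le]; constructor <;> linarith

/-- One step of the nibble. -/
theorem nibble_step [DecidableEq κ] {B : ℝ} (hw0 : ∀ q e, 0 ≤ w q e) (hw1 : ∀ q, ∑ e, w q e ≤ 1)
    (hwr : ∀ q e, w q e ≠ 0 → #e ≤ r) (hr : 1 ≤ r)
    (hdeg : ∀ v, ∑ q, ∑ e, (if v ∈ e then w q e else 0) = d) (hd0 : 0 ≤ d) (hd1 : d ≤ 1)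
    (hβ : ∀ q v, ∑ e, (if v ∈ e then w q e else 0) ≤ β)
    (hcod : ∀ v v', v ≠ v' → ∑ q, ∑ e, (if v ∈ e ∧ v' ∈ e then w q e else 0) ≤ β)
    (hρ0 : 0 < ρ) (hρ1 : ρ ≤ 1) (hε : 0 ≤ ε) (hβ0 : 0 ≤ β) (hT : 1 < T) (hT2 : T ≤ 2)
    (hμ0 : ∀ R, 0 ≤ μ R) (hμ1 : ∑ R, μ R = 1) (hsum : ε + β ≤ 1)
    (hB1 : 1 ≤ B) (hB : Fintype.card κ * β ≤ B)
    (hμ : ∀ A : Finset V, #A ≤ 2 * r → |containProb μ A - ρ ^ #A| ≤ ε)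
    (A : Finset V) (hA : #A ≤ 2 * r) :
    |containProb (removeLaw μ (edgeLaw w ρ T)) A - (ρ * Real.exp (-(d / (T * ρ)))) ^ #A|
      ≤ 21 * r ^ 2 * B * ρ⁻¹ ^ (3 * r) / (T - 1) ^ 2 * √(ε + β) := by
  have hT0 : 0 < T := by linarith
  have hG1 : 1 ≤ ρ⁻¹ := (one_le_inv₀ hρ0).mpr hρ1
  set G := ρ⁻¹ with hG
  have hG0 : 0 < G := by linarith
  set E := Real.exp (-(#A * (d * G / T))) with hE
  have hE0 : 0 < E := Real.exp_pos _
  have hE1 : E ≤ 1 := Real.exp_le_one_iff.mpr (by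
    have : 0 ≤ #A * (d * G / T) := by positivity
    linarith)
  have hpow : (ρ * Real.exp (-(d / (T * ρ)))) ^ #A = ρ ^ #A * E := by
    rw [mul_pow, ← Real.exp_nat_mul, hE]
    congr 2
    rw [hG]; field_simp
  set n : ℝ := (Fintype.card κ : ℝ) with hn
  have hn0 : 0 ≤ n := Nat.cast_nonneg _
  set P : Finset V → ℝ := fun R => ∏ q, ∑ e, (if Disjoint e A then edgeLaw w ρ T R q e else 0)
  have hcp : containProb (removeLaw μ (edgeLaw w ρ T)) A = ∑ R, μ R * (subInd A R * P R) := by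
    rw [containProb_removeLaw]
    refine sum_congr rfl fun R _ => ?_
    unfold subInd
    split_ifs <;> simp [P]
  set M := (4 * ε + r * β) * G ^ (2 * r) with hM
  have hpt := fun R => abs_prod_sub_exp_le (R := R) (A := A) hw0 hwr hβ hcod hρ0 hρ1 hβ0 hT hd0
  have main : |containProb (removeLaw μ (edgeLaw w ρ T)) A - ρ ^ #A * E|
      ≤ ε + n * (#A * (β * G ^ r)) ^ 2 + #A * (β * G ^ r) * (n * (M / (T - 1) ^ 2))
        + #A ^ 2 * (β * G ^ r) + #A * √M := by
    have e1 : |containProb μ A * E - ρ ^ #A * E| ≤ ε := by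
      rw [← sub_mul, abs_mul, abs_of_pos hE0]
      calc _ ≤ ε * 1 := mul_le_mul (hμ A hA) hE1 hE0.le hε
        _ = ε := mul_one _
    have e2 : |containProb (removeLaw μ (edgeLaw w ρ T)) A - containProb μ A * E|
        ≤ n * (#A * (β * G ^ r)) ^ 2 + #A * (β * G ^ r) * (n * (M / (T - 1) ^ 2))
        + #A ^ 2 * (β * G ^ r) + #A * √M := by
      rw [hcp, containProb_eq, sum_mul, ← sum_sub_distrib]
      calc _ ≤ ∑ R, |μ R * (subInd A R * P R) - μ R * subInd A R * E| := abs_sum_le_sum_abs _ _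
        _ ≤ ∑ R, (μ R * (n * (#A * (β * G ^ r)) ^ 2 + #A ^ 2 * (β * G ^ r))
            + #A * (β * G ^ r) * (μ R * ∑ q, (if liveWeight w ρ R q ≤ T then 0 else 1))
            + ∑ v ∈ A, μ R * (subInd {v} R * |liveDegree w ρ R v - d * G|)) := by
            refine sum_le_sum fun R _ => ?_
            have h1 : μ R * (subInd A R * P R) - μ R * subInd A R * E
                = μ R * (subInd A R * (P R - E)) := by ring
            rw [h1, abs_mul, abs_mul, abs_of_nonneg (hμ0 R), abs_of_nonneg (subInd_nonneg A R)]
            have h2 : subInd A R * |P R - E| ≤ n * (#A * (β * G ^ r)) ^ 2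
                + #A * (β * G ^ r) * ∑ q, (if liveWeight w ρ R q ≤ T then 0 else 1)
                + #A ^ 2 * (β * G ^ r)
                + ∑ v ∈ A, subInd {v} R * |liveDegree w ρ R v - d * G| := by
              unfold subInd
              by_cases hAR : A ⊆ R
              · have h3 : ∀ v ∈ A, (if {v} ⊆ R then (1 : ℝ) else 0) * |liveDegree w ρ R v - d * G|
                    = |liveDegree w ρ R v - d * G| := fun v hv => by
                  rw [if_pos (by simpa using hAR hv), one_mul]
                rw [if_pos hAR, one_mul, sum_congr rfl h3]
                exact hpt R
              · rw [if_neg hAR, zero_mul]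
                have : 0 ≤ ∑ q, (if liveWeight w ρ R q ≤ T then (0 : ℝ) else 1) :=
                  sum_nonneg fun q _ => by split_ifs <;> norm_num
                have : 0 ≤ ∑ v ∈ A, (if {v} ⊆ R then (1 : ℝ) else 0) * |liveDegree w ρ R v - d * G| :=
                  sum_nonneg fun v _ => mul_nonneg (by split_ifs <;> norm_num) (abs_nonneg _)
                positivity
            calc _ ≤ _ := mul_le_mul_of_nonneg_left h2 (hμ0 R)
              _ = _ := by rw [← mul_sum]; ring
        _ = (n * (#A * (β * G ^ r)) ^ 2 + #A ^ 2 * (β * G ^ r))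
            + #A * (β * G ^ r) * (∑ R, μ R * ∑ q, (if liveWeight w ρ R q ≤ T then 0 else 1))
            + ∑ v ∈ A, ∑ R, μ R * (subInd {v} R * |liveDegree w ρ R v - d * G|) := by
            rw [sum_add_distrib, sum_add_distrib, ← sum_mul, hμ1, one_mul, ← mul_sum, sum_comm]
        _ ≤ (n * (#A * (β * G ^ r)) ^ 2 + #A ^ 2 * (β * G ^ r))
            + #A * (β * G ^ r) * (n * (M / (T - 1) ^ 2)) + ∑ v ∈ A, √M := by
            gcongr with v
            · exact sum_bad_le hw0 hw1 hwr hβ hρ0 hρ1 hε hβ0 hT hμ0 hμ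
            · exact sum_mul_abs_le_sqrt hμ0 hμ1 (subInd_nonneg {v}) (subInd_le_one {v})
                (liveDegree_second_moment hw0 hwr hr hdeg hd0 hd1 hcod hρ0 hρ1 hε hβ0 hμ v)
        _ = _ := by rw [sum_const, nsmul_eq_mul]; ring
    have t1 := abs_le.mp e1
    have t2 := abs_le.mp e2
    rw [abs_le]; constructor <;> linarith
  rw [hpow]
  refine main.trans ?_
  exact nibble_error_le hr hA hε hβ0 hn0 hG1 hT hT2 hsum hB1 hB

end NibbleStep

section Thinning

variable {V : Type*} [DecidableEq V]

/-- The probability that the random subset of `e` keeping each `v` with probability `θ v` is `t`. -/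
def thinProb (θ : V → ℝ) (e t : Finset V) : ℝ :=
  (∏ v ∈ t, θ v) * ∏ v ∈ e \ t, (1 - θ v)

theorem thinProb_nonneg {θ : V → ℝ} (h0 : ∀ v, 0 ≤ θ v) (h1 : ∀ v, θ v ≤ 1) (e t : Finset V) :
    0 ≤ thinProb θ e t :=
  mul_nonneg (prod_nonneg fun v _ => h0 v) (prod_nonneg fun v _ => sub_nonneg.mpr (h1 v))

theorem sum_thinProb (θ : V → ℝ) (e : Finset V) : ∑ t ∈ e.powerset, thinProb θ e t = 1 := by
  unfold thinProb
  rw [← prod_add]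
  simp

theorem sum_thinProb_mem (θ : V → ℝ) {e : Finset V} {v : V} (hv : v ∈ e) :
    ∑ t ∈ e.powerset, (if v ∈ t then thinProb θ e t else 0) = θ v := by
  have h := prod_add θ (fun u => if u = v then 0 else 1 - θ u) e
  have h1 : ∏ u ∈ e, (θ u + if u = v then 0 else 1 - θ u) = θ v := by
    rw [prod_eq_single_of_mem v hv]
    · simp
    · intro u _ hu; simp [hu]
  rw [h1] at h
  rw [h]
  refine sum_congr rfl fun t ht => ?_
  unfold thinProb
  split_ifs with hvt
  · congr 1
    refine prod_congr rfl fun u hu => ?_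
    rw [if_neg]
    rintro rfl
    exact (mem_sdiff.mp hu).2 hvt
  · rw [prod_eq_zero (i := v) (mem_sdiff.mpr ⟨hv, hvt⟩) (by simp), mul_zero]

variable [Fintype V]

/-- The weights of the randomly thinned edges. -/
def thin (θ : V → ℝ) (w : Finset V → ℝ) (t : Finset V) : ℝ :=
  ∑ e, if t ⊆ e then w e * thinProb θ e t else 0

theorem sum_thin (θ : V → ℝ) (w : Finset V → ℝ) (P : Finset V → Prop) [DecidablePred P] :
    ∑ t, (if P t then thin θ w t else 0)
      = ∑ e, w e * ∑ t ∈ e.powerset, if P t then thinProb θ e t else 0 := by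
  unfold thin
  have h1 : ∀ t, (if P t then ∑ e, (if t ⊆ e then w e * thinProb θ e t else 0) else 0)
      = ∑ e, if t ⊆ e then w e * (if P t then thinProb θ e t else 0) else 0 := by
    intro t
    split_ifs <;> simp
  simp_rw [h1]
  rw [sum_comm]
  refine sum_congr rfl fun e _ => ?_
  rw [mul_sum, ← sum_filter]
  refine sum_congr ?_ fun _ _ => rfl
  ext t; simp

theorem thin_nonneg {θ : V → ℝ} (h0 : ∀ v, 0 ≤ θ v) (h1 : ∀ v, θ v ≤ 1) {w : Finset V → ℝ}
    (hw : ∀ e, 0 ≤ w e) (t : Finset V) : 0 ≤ thin θ w t := by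
  refine sum_nonneg fun e _ => ?_
  split_ifs
  · exact mul_nonneg (hw e) (thinProb_nonneg h0 h1 e t)
  · exact le_rfl

theorem sum_thin_univ (θ : V → ℝ) (w : Finset V → ℝ) : ∑ t, thin θ w t = ∑ e, w e := by
  have := sum_thin θ w fun _ => True
  simpa [sum_thinProb] using this

theorem exists_of_thin_ne_zero {θ : V → ℝ} {w : Finset V → ℝ} {t : Finset V}
    (h : thin θ w t ≠ 0) : ∃ e, t ⊆ e ∧ w e ≠ 0 := by
  obtain ⟨e, -, he⟩ := exists_ne_zero_of_sum_ne_zero h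
  by_cases hte : t ⊆ e
  · rw [if_pos hte] at he
    exact ⟨e, hte, left_ne_zero_of_mul he⟩
  · exact absurd (if_neg hte) he

theorem sum_thin_mem (θ : V → ℝ) (w : Finset V → ℝ) (v : V) :
    ∑ t, (if v ∈ t then thin θ w t else 0) = θ v * ∑ e, if v ∈ e then w e else 0 := by
  rw [sum_thin, mul_sum]
  refine sum_congr rfl fun e _ => ?_
  split_ifs with hv
  · rw [sum_thinProb_mem θ hv, mul_comm]
  · rw [sum_eq_zero fun t ht => if_neg fun hvt => hv (mem_powerset.mp ht hvt)]
    simp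

theorem sum_thin_le {θ : V → ℝ} (h0 : ∀ v, 0 ≤ θ v) (h1 : ∀ v, θ v ≤ 1) {w : Finset V → ℝ}
    (hw : ∀ e, 0 ≤ w e) (P : Finset V → Prop) [DecidablePred P]
    (hP : ∀ t e, t ⊆ e → P t → P e) :
    ∑ t, (if P t then thin θ w t else 0) ≤ ∑ e, if P e then w e else 0 := by
  rw [sum_thin]
  refine sum_le_sum fun e _ => ?_
  by_cases hPe : P e
  · rw [if_pos hPe]
    calc _ ≤ w e * ∑ t ∈ e.powerset, thinProb θ e t := by
          refine mul_le_mul_of_nonneg_left (sum_le_sum fun t _ => ?_) (hw e)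
          split_ifs
          · exact le_rfl
          · exact thinProb_nonneg h0 h1 e t
      _ = w e := by rw [sum_thinProb, mul_one]
  · rw [if_neg hPe, sum_eq_zero fun t ht => if_neg fun h => hPe (hP t e (mem_powerset.mp ht) h),
      mul_zero]

end Thinning

/-- Iterated nibble: `m` families of weighted edges with degrees at least `T * C * exp (-C * j)` leave
few vertices uncovered. -/
theorem nibble_cover {V κ : Type*} [DecidableEq V] [Fintype V] [Fintype κ] [DecidableEq κ]
    (m r : ℕ) (hr : 1 ≤ r) (C T β B η : ℝ) (hC : 0 < C) (hT : 1 < T) (hT2 : T ≤ 2) (hTC : T * C ≤ 1)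
    (hβ0 : 0 < β) (hβ1 : β ≤ 1) (hB1 : 1 ≤ B) (hB : Fintype.card κ * β ≤ B) (hη : η ≤ 1)
    (hsmall : 4 * (21 * r ^ 2 * B * Real.exp (C * m) ^ (3 * r) / (T - 1) ^ 2) ^ 2
      * β ^ ((1 / 2 : ℝ) ^ m) ≤ η)
    (w : ℕ → κ → Finset V → ℝ) (hw0 : ∀ j q e, 0 ≤ w j q e) (hw1 : ∀ j q, ∑ e, w j q e ≤ 1)
    (hwr : ∀ j q e, w j q e ≠ 0 → #e ≤ r)
    (hdeg : ∀ j < m, ∀ v, T * C * Real.exp (-(C * j)) ≤ ∑ q, ∑ e, (if v ∈ e then w j q e else 0))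
    (hβ : ∀ j q v, ∑ e, (if v ∈ e then w j q e else 0) ≤ β)
    (hcod : ∀ j, ∀ v v', v ≠ v' → ∑ q, ∑ e, (if v ∈ e ∧ v' ∈ e then w j q e else 0) ≤ β) :
    ∃ f : ℕ → κ → Finset V, (∀ j q, f j q = ∅ ∨ ∃ e, f j q ⊆ e ∧ w j q e ≠ 0) ∧
      (#(univ \ (range m).biUnion fun j => univ.biUnion (f j)) : ℝ)
        ≤ Fintype.card V * (Real.exp (-(C * m)) + η) := by
  classical
  set K : ℝ := 21 * r ^ 2 * B * Real.exp (C * m) ^ (3 * r) / (T - 1) ^ 2 with hK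
  have hT1 : 0 < T - 1 := by linarith
  have hr' : (1 : ℝ) ≤ r := by exact_mod_cast hr
  have hK0 : 1 ≤ K := by
    rw [hK, le_div_iff₀ (by positivity)]
    have h1 : (1 : ℝ) ≤ Real.exp (C * m) ^ (3 * r) :=
      one_le_pow₀ (Real.one_le_exp (by positivity))
    have h2 : (1 : ℝ) ≤ (r : ℝ) ^ 2 := one_le_pow₀ hr'
    have h3 : (21 : ℝ) * 1 * 1 * 1 ≤ 21 * r ^ 2 * B * Real.exp (C * m) ^ (3 * r) := by gcongr
    nlinarith
  set bp : ℕ → ℝ := fun j => β ^ ((1 / 2 : ℝ) ^ j) with hbp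
  have hbp0 : ∀ j, 0 < bp j := fun j => Real.rpow_pos_of_pos hβ0 _
  have hbpsqrt : ∀ j, √(bp j) = bp (j + 1) := fun j => by
    simp only [hbp]
    rw [Real.sqrt_eq_rpow, ← Real.rpow_mul hβ0.le, pow_succ]
  have hbpmono : ∀ j ≤ m, bp j ≤ bp m := fun j hj =>
    Real.rpow_le_rpow_of_exponent_ge hβ0 hβ1
      (pow_le_pow_of_le_one (by norm_num) (by norm_num) hj)
  have hβbp : ∀ j, β ≤ bp j := fun j => by
    calc β = β ^ (1 : ℝ) := (Real.rpow_one β).symm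
      _ ≤ _ := Real.rpow_le_rpow_of_exponent_ge hβ0 hβ1 (pow_le_one₀ (by norm_num) (by norm_num))
  have hKK : 4 * K ^ 2 * bp m ≤ η := hsmall
  have claim : ∀ j ≤ m, ∃ μ : Finset V → ℝ, (∀ R, 0 ≤ μ R) ∧ ∑ R, μ R = 1 ∧
      (∀ R, μ R ≠ 0 → ∃ f : ℕ → κ → Finset V, (∀ j q, f j q = ∅ ∨ ∃ e, f j q ⊆ e ∧ w j q e ≠ 0) ∧
        R = univ \ (range j).biUnion fun j => univ.biUnion (f j)) ∧
      (∀ A : Finset V, #A ≤ 2 * r →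
        |containProb μ A - Real.exp (-(C * j)) ^ #A| ≤ 2 * K ^ 2 * bp j) := by
    intro j
    induction j with
    | zero =>
      intro _
      refine ⟨fun R => if R = univ then 1 else 0, fun R => by beta_reduce; split_ifs <;> norm_num, by simp, ?_, ?_⟩
      · intro R hR
        have : R = univ := by by_contra h; exact hR (if_neg h)
        exact ⟨fun _ _ => ∅, fun _ _ => Or.inl rfl, by simp [this]⟩
      · intro A _
        have h1 : containProb (fun R : Finset V => if R = univ then (1 : ℝ) else 0) A = 1 := by
          rw [containProb_eq, sum_eq_single univ]
          · simp [subInd]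
          · intro R _ hR; simp [hR]
          · simp
        rw [h1]
        have := hbp0 0
        simp only [Nat.cast_zero, mul_zero, neg_zero, Real.exp_zero, one_pow, sub_self, abs_zero]
        positivity
    | succ j ih =>
      intro hj
      obtain ⟨μ, hμ0, hμ1, hsupp, hμ⟩ := ih (by omega)
      set ρ := Real.exp (-(C * j)) with hρ
      have hρ0 : 0 < ρ := Real.exp_pos _
      have hρ1 : ρ ≤ 1 := Real.exp_le_one_iff.mpr (by have : 0 ≤ C * j := by positivity
                                                      linarith)
      set d := T * C * ρ with hd
      have hd0 : 0 < d := by positivity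
      have hd1 : d ≤ 1 := by
        calc d ≤ 1 * 1 := by rw [hd]; gcongr
          _ = 1 := one_mul 1
      set D : V → ℝ := fun v => ∑ q, ∑ e, (if v ∈ e then w j q e else 0) with hD
      have hDd : ∀ v, d ≤ D v := fun v => hdeg j (by omega) v
      set θ : V → ℝ := fun v => d / D v with hθ
      have hθ0 : ∀ v, 0 ≤ θ v := fun v => div_nonneg hd0.le (hd0.le.trans (hDd v))
      have hθ1 : ∀ v, θ v ≤ 1 := fun v => (div_le_one (hd0.trans_le (hDd v))).mpr (hDd v)
      set w' : κ → Finset V → ℝ := fun q => thin θ (w j q) with hw'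
      have hw'0 : ∀ q e, 0 ≤ w' q e := fun q e => thin_nonneg hθ0 hθ1 (hw0 j q) e
      have hdeg' : ∀ v, ∑ q, ∑ e, (if v ∈ e then w' q e else 0) = d := fun v => by
        simp_rw [hw', sum_thin_mem]
        rw [← mul_sum]
        exact div_mul_cancel₀ d (hd0.trans_le (hDd v)).ne'
      set ε := 2 * K ^ 2 * bp j with hε
      have hε0 : 0 ≤ ε := by have := hbp0 j; positivity
      have hsum : ε + β ≤ 1 := by
        have h1 := hbpmono j (by omega)
        have h2 := hβbp m
        have h3 : 1 ≤ K ^ 2 := one_le_pow₀ hK0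
        have h4 := hbp0 m
        calc ε + β ≤ 2 * K ^ 2 * bp m + bp m := by rw [hε]; gcongr
          _ ≤ 4 * K ^ 2 * bp m := by nlinarith
          _ ≤ 1 := hKK.trans hη
      have hstep := nibble_step (w := w') (μ := μ) (r := r) (ρ := ρ) (T := T) (d := d) (β := β)
        (ε := ε) (B := B) hw'0 (fun q => by rw [hw', sum_thin_univ]; exact hw1 j q)
        (fun q e he => by
          obtain ⟨e', hee', he'⟩ := exists_of_thin_ne_zero he
          exact (card_le_card hee').trans (hwr j q e' he')) hr hdeg' hd0.le hd1
        (fun q v => (sum_thin_le hθ0 hθ1 (hw0 j q) (fun t => v ∈ t)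
          fun t e hte hv => hte hv).trans (hβ j q v))
        (fun v v' hvv' => (sum_le_sum fun q _ => sum_thin_le hθ0 hθ1 (hw0 j q)
          (fun t => v ∈ t ∧ v' ∈ t) fun t e hte hv => ⟨hte hv.1, hte hv.2⟩).trans (hcod j v v' hvv'))
        hρ0 hρ1 hε0 hβ0.le hT hT2 hμ0 hμ1 hsum hB1 hB hμ
      refine ⟨removeLaw μ (edgeLaw w' ρ T), removeLaw_nonneg hμ0
        (edgeLaw_nonneg hw'0 hρ0 (by linarith)), ?_, ?_, ?_⟩
      · rw [sum_removeLaw sum_edgeLaw, hμ1]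
      · intro R' hR'
        obtain ⟨R, hR, g, hg, rfl⟩ := exists_of_removeLaw_ne_zero hR'
        obtain ⟨f, hf, rfl⟩ := hsupp R hR
        refine ⟨Function.update f j g, fun j' q => ?_, ?_⟩
        · by_cases hjj : j' = j
          · subst hjj
            rw [Function.update_self]
            by_cases he : g q = ∅
            · exact Or.inl he
            · right
              apply exists_of_thin_ne_zero (θ := θ)
              have h1 := hg q
              rw [edgeLaw, if_neg he, add_zero, edgeProb] at h1
              intro h0
              apply h1
              have : w' q (g q) = 0 := h0
              rw [this]; simp
          · rw [Function.update_of_ne hjj]; exact hf j' q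
        · rw [range_add_one, biUnion_insert, Function.update_self, union_comm, sdiff_sdiff_left]
          congr 2
          refine biUnion_congr rfl fun i hi => ?_
          rw [Function.update_of_ne (by have := mem_range.mp hi; omega)]
      · intro A hA
        have h1 := hstep A hA
        have h2 : ρ * Real.exp (-(d / (T * ρ))) = Real.exp (-(C * (j + 1 : ℕ))) := by
          have : d / (T * ρ) = C := by rw [hd]; field_simp
          rw [this, hρ, ← Real.exp_add]
          congr 1; push_cast; ring
        rw [h2] at h1
        refine h1.trans ?_
        have hKj : 21 * r ^ 2 * B * ρ⁻¹ ^ (3 * r) / (T - 1) ^ 2 ≤ K := by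
          rw [hK]
          gcongr
          rw [hρ, Real.exp_neg, inv_inv]
          gcongr
          exact_mod_cast (by omega : j ≤ m)
        have hbj := hbp0 j
        have hbj1 := hbp0 (j + 1)
        have hsq : √(ε + β) ≤ 2 * K * bp (j + 1) := by
          rw [← hbpsqrt, Real.sqrt_le_left (by positivity), mul_pow, Real.sq_sqrt hbj.le]
          have := hβbp j
          have h3 : 1 ≤ K ^ 2 := one_le_pow₀ hK0
          rw [hε]; nlinarith
        calc _ ≤ K * (2 * K * bp (j + 1)) := by gcongr
          _ = _ := by ring
  obtain ⟨μ, hμ0, hμ1, hsupp, hμ⟩ := claim m le_rfl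
  set S := Fintype.card V * (Real.exp (-(C * m)) + η)
  have hbound : ∑ R, μ R * (#R : ℝ) ≤ S := by
    have h1 : ∀ R : Finset V, (#R : ℝ) = ∑ v, subInd {v} R := fun R => by
      simp [subInd]
    simp_rw [h1, mul_sum]
    rw [sum_comm]
    calc _ ≤ ∑ _v : V, (Real.exp (-(C * m)) + η) := by
          refine sum_le_sum fun v _ => ?_
          rw [← containProb_eq]
          have := (abs_le.mp (hμ {v} (by simp; omega))).2
          rw [card_singleton, pow_one] at this
          have h4 := hbp0 m
          nlinarith
      _ = S := by rw [sum_const, nsmul_eq_mul, card_univ]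
  obtain ⟨R, hR, hRS⟩ : ∃ R, μ R ≠ 0 ∧ (#R : ℝ) ≤ S := by
    by_contra! hcon
    have h1 : ∑ R, μ R * S < ∑ R, μ R * (#R : ℝ) := by
      obtain ⟨R₀, -, hR₀⟩ := exists_ne_zero_of_sum_ne_zero (s := univ) (f := μ) (by rw [hμ1]; norm_num)
      refine sum_lt_sum (fun R _ => ?_) ⟨R₀, mem_univ _, ?_⟩
      · by_cases h : μ R = 0
        · simp [h]
        · exact mul_le_mul_of_nonneg_left (hcon R h).le (hμ0 R)
      · exact mul_lt_mul_of_pos_left (hcon R₀ hR₀) (lt_of_le_of_ne (hμ0 R₀) (Ne.symm hR₀))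
    rw [← sum_mul, hμ1, one_mul] at h1
    linarith
  obtain ⟨f, hf, rfl⟩ := hsupp R hR
  exact ⟨f, hf, hRS⟩

theorem exists_sum_log_div_le : ∃ C : ℝ, 0 < C ∧ ∀ s : Finset ℕ, (∀ p ∈ s, 2 ≤ p) →
    ∑ p ∈ s, Real.log p / (p * (p - 1)) ≤ C := by
  have hsum : Summable fun n : ℕ => 4 * (1 / (n : ℝ) ^ (3 / 2 : ℝ)) :=
    (Real.summable_one_div_nat_rpow.2 (by norm_num)).mul_left 4
  refine ⟨∑' n : ℕ, 4 * (1 / (n : ℝ) ^ (3 / 2 : ℝ)) + 1, ?_, fun s hs => ?_⟩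
  · have : 0 ≤ ∑' n : ℕ, 4 * (1 / (n : ℝ) ^ (3 / 2 : ℝ)) := tsum_nonneg fun n => by positivity
    linarith
  · have h1 : ∑ p ∈ s, Real.log p / (p * (p - 1)) ≤ ∑ p ∈ s, 4 * (1 / (p : ℝ) ^ (3 / 2 : ℝ)) := by
      refine sum_le_sum fun p hp => ?_
      have hp2 : (2 : ℝ) ≤ p := by exact_mod_cast hs p hp
      have hlog : Real.log p ≤ (p : ℝ) ^ (1 / 2 : ℝ) / (1 / 2) :=
        Real.log_le_rpow_div (by linarith) (by norm_num)
      have hpow : (p : ℝ) ^ (3 / 2 : ℝ) * (p : ℝ) ^ (1 / 2 : ℝ) = p * p := by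
        rw [← Real.rpow_add (by linarith)]
        norm_num
        ring
      have hpos : 0 < (p : ℝ) ^ (3 / 2 : ℝ) := Real.rpow_pos_of_pos (by linarith) _
      rw [mul_one_div, div_le_div_iff₀ (by nlinarith) hpos]
      have h2 : Real.log p * (p : ℝ) ^ (3 / 2 : ℝ) ≤ 2 * (p * p) := by
        calc _ ≤ ((p : ℝ) ^ (1 / 2 : ℝ) / (1 / 2)) * (p : ℝ) ^ (3 / 2 : ℝ) := by gcongr
          _ = 2 * ((p : ℝ) ^ (3 / 2 : ℝ) * (p : ℝ) ^ (1 / 2 : ℝ)) := by ring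
          _ = _ := by rw [hpow]
      nlinarith
    have h2 := hsum.sum_le_tsum s (fun n _ => by positivity)
    linarith

theorem log_factorial_eq_sum (N : ℕ) :
    Real.log (N.factorial) = ∑ p ∈ Nat.primesLE N, (N.factorial.factorization p : ℝ) * Real.log p := by
  have h := Nat.prod_factorization_pow_eq_self N.factorial_ne_zero
  conv_lhs => rw [← h]
  rw [Finsupp.prod, Nat.cast_prod, Real.log_prod]
  · rw [Finset.sum_subset (s₂ := Nat.primesLE N)]
    · refine sum_congr rfl fun p _ => ?_
      rw [Nat.cast_pow, Real.log_pow]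
    · intro p hp
      rw [Nat.mem_primesLE]
      have := Nat.support_factorization N.factorial ▸ hp
      have hpp := Nat.prime_of_mem_primeFactors this
      exact ⟨(hpp.dvd_factorial).1 (Nat.dvd_of_mem_primeFactors this), hpp⟩
    · intro p _ hp
      rw [Finsupp.notMem_support_iff] at hp
      rw [hp]; simp
  · intro p hp
    have := Nat.support_factorization N.factorial ▸ hp
    have hpp := Nat.prime_of_mem_primeFactors this
    have := hpp.pos
    positivity

theorem factorization_factorial_bounds (N p : ℕ) (hp : p.Prime) :
    (N : ℝ) / p - 1 ≤ N.factorial.factorization p ∧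
      (N.factorial.factorization p : ℝ) ≤ N / (p - 1) := by
  have := Fact.mk hp
  have h2 : (2 : ℝ) ≤ p := by exact_mod_cast hp.two_le
  rw [Nat.factorization_def _ hp]
  constructor
  · have h1 : N / p ≤ padicValNat p N.factorial := by
      have hd : p ^ (N / p) ∣ N.factorial := by
        have h1 : p ^ (N / p) ∣ (p * (N / p)).factorial := by
          have := padicValNat_factorial_mul (p := p) (N / p)
          rw [padicValNat_dvd_iff_le (Nat.factorial_ne_zero _), this]
          omega
        exact h1.trans (Nat.factorial_dvd_factorial (Nat.mul_div_le N p))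
      rwa [padicValNat_dvd_iff_le (Nat.factorial_ne_zero _)] at hd
    have h3 : (N : ℝ) / p < (N / p : ℕ) + 1 := by
      rw [div_lt_iff₀ (by linarith)]
      have h5 : N < (N / p + 1) * p := by
        rw [mul_comm]; exact Nat.lt_mul_div_succ N hp.pos
      exact_mod_cast h5
    have : ((N / p : ℕ) : ℝ) ≤ padicValNat p N.factorial := by exact_mod_cast h1
    linarith
  · have h := sub_one_mul_padicValNat_factorial (p := p) N
    have h1 : (p - 1) * padicValNat p N.factorial ≤ N := by rw [h]; exact Nat.sub_le _ _
    rw [le_div_iff₀ (by linarith)]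
    have h4 : (((p - 1 : ℕ) : ℝ)) = p - 1 := by
      rw [Nat.cast_sub hp.one_le]; simp
    rw [← h4, mul_comm]
    exact_mod_cast h1

theorem mertens_one : ∃ C : ℝ, 0 < C ∧ ∀ N : ℕ, 1 ≤ N →
    |∑ p ∈ Nat.primesLE N, Real.log p / p - Real.log N| ≤ C := by
  obtain ⟨C, hC, hs⟩ := exists_sum_log_div_le
  refine ⟨C + 3, by linarith, fun N hN => ?_⟩
  have hN0 : (0 : ℝ) < N := by exact_mod_cast hN
  have hup : Real.log N.factorial ≤ N * Real.log N := by
    rw [← Real.log_pow]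
    refine Real.log_le_log (by positivity) ?_
    exact_mod_cast Nat.factorial_le_pow N
  have hlow : N * Real.log N - N ≤ Real.log N.factorial := by
    have h := Real.pow_div_factorial_le_exp (N : ℝ) hN0.le N
    have h2 := Real.log_le_log (by positivity) h
    rw [Real.log_exp, Real.log_div (by positivity) (by positivity), Real.log_pow] at h2
    linarith
  rw [log_factorial_eq_sum] at hup hlow
  have htheta : ∑ p ∈ Nat.primesLE N, Real.log p ≤ 2 * N := by
    rw [← Chebyshev.theta_eq_sum_primesLE_log]
    refine (Chebyshev.theta_le_log4_mul_x hN0.le).trans ?_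
    have : Real.log 4 ≤ 2 := by
      have h4 : Real.log 4 = 2 * Real.log 2 := by
        rw [show (4 : ℝ) = 2 ^ 2 by norm_num, Real.log_pow]; norm_num
      have := Real.log_two_lt_d9
      linarith
    gcongr
  set S := ∑ p ∈ Nat.primesLE N, Real.log p / p
  have h1 : N * S - 2 * N ≤ ∑ p ∈ Nat.primesLE N, (N.factorial.factorization p : ℝ) * Real.log p := by
    have : ∑ p ∈ Nat.primesLE N, (((N : ℝ) / p - 1) * Real.log p) = N * S -
        ∑ p ∈ Nat.primesLE N, Real.log p := by
      rw [mul_sum, ← sum_sub_distrib]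
      exact sum_congr rfl fun p _ => by ring
    have h2 : ∑ p ∈ Nat.primesLE N, (((N : ℝ) / p - 1) * Real.log p) ≤
        ∑ p ∈ Nat.primesLE N, (N.factorial.factorization p : ℝ) * Real.log p := by
      refine sum_le_sum fun p hp => ?_
      have hpp := (Nat.mem_primesLE.1 hp).2
      have := (factorization_factorial_bounds N p hpp).1
      have : 0 ≤ Real.log p := Real.log_natCast_nonneg p
      gcongr
    linarith
  have h2 : ∑ p ∈ Nat.primesLE N, (N.factorial.factorization p : ℝ) * Real.log p ≤ N * S + N * C := by
    have h3 := hs (Nat.primesLE N) fun p hp => (Nat.mem_primesLE.1 hp).2.two_le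
    have h4 : ∑ p ∈ Nat.primesLE N, (N.factorial.factorization p : ℝ) * Real.log p ≤
        ∑ p ∈ Nat.primesLE N, (N : ℝ) / (p - 1) * Real.log p := by
      refine sum_le_sum fun p hp => ?_
      have hpp := (Nat.mem_primesLE.1 hp).2
      have := (factorization_factorial_bounds N p hpp).2
      have : 0 ≤ Real.log p := Real.log_natCast_nonneg p
      gcongr
    have h5 : ∑ p ∈ Nat.primesLE N, (N : ℝ) / (p - 1) * Real.log p =
        N * S + N * ∑ p ∈ Nat.primesLE N, Real.log p / (p * (p - 1)) := by
      rw [mul_sum, mul_sum, ← sum_add_distrib]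
      refine sum_congr rfl fun p hp => ?_
      have h2 : (2 : ℝ) ≤ p := by exact_mod_cast (Nat.mem_primesLE.1 hp).2.two_le
      have : (p : ℝ) ≠ 0 := by linarith
      have : (p : ℝ) - 1 ≠ 0 := by linarith
      field_simp
      ring
    have : N * ∑ p ∈ Nat.primesLE N, Real.log p / (p * (p - 1)) ≤ N * C := by gcongr
    linarith
  rw [abs_le]
  constructor
  · have : N * (Real.log N - 1) ≤ N * (S + C) := by linarith
    have := le_of_mul_le_mul_left this hN0
    linarith
  · have : N * (S - 2) ≤ N * Real.log N := by linarith
    have := le_of_mul_le_mul_left this hN0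
    linarith

/-- Mertens' second theorem in difference form, with an error term of order `1 / log w`. -/
theorem mertens_two : ∃ C : ℝ, 0 < C ∧ ∀ w z : ℕ, 2 ≤ w → w ≤ z →
    |∑ p ∈ (Ioc w z).filter Nat.Prime, (1 : ℝ) / p
      - (Real.log (Real.log z) - Real.log (Real.log w))| ≤ C / Real.log w := by
  obtain ⟨C, hC, hm⟩ := mertens_one
  refine ⟨3 * C + 1, by linarith, fun w z hw hz => ?_⟩
  set E : ℕ → ℝ := fun n => ∑ p ∈ Nat.primesLE n, Real.log p / p - Real.log n with hE
  set f : ℕ → ℝ := fun n => 1 / Real.log n with hf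
  have hlog : ∀ n : ℕ, 2 ≤ n → 0 < Real.log n := fun n hn =>
    Real.log_pos (by exact_mod_cast hn)
  have key : |∑ p ∈ (Ioc w z).filter Nat.Prime, (1 : ℝ) / p
      - (Real.log (Real.log z) - Real.log (Real.log w)) - E z * f z| ≤
      C * (2 * f w - f z) + (f w - f z) := by
    induction z, hz using Nat.le_induction with
    | base =>
      have h1 := hm w (by omega)
      have h2 : 0 < f w := one_div_pos.2 (hlog w hw)
      simp only [Ioc_self, filter_empty, sum_empty, sub_self, zero_sub, abs_neg, abs_mul,
        abs_of_pos h2]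
      nlinarith
    | succ z hz ih =>
      have hz2 : 2 ≤ z := hw.trans hz
      have l1 := hlog z hz2
      have l2 := hlog (z + 1) (by omega)
      set a := Real.log z with ha
      set b := Real.log (z + 1 : ℕ) with hb
      have hab : a ≤ b := Real.log_le_log (by positivity) (by push_cast; linarith)
      have hd : b - a ≤ 1 := by
        rw [ha, hb, ← Real.log_div (by positivity) (by positivity)]
        have : ((z + 1 : ℕ) : ℝ) / z ≤ 2 := by
          rw [div_le_iff₀ (by positivity)]
          push_cast
          have : (2 : ℝ) ≤ z := by exact_mod_cast hz2
          linarith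
        have h3 := Real.log_le_log (by positivity) this
        have := Real.log_two_lt_d9
        linarith
      have hfz : f z = 1 / a := rfl
      have hfz1 : f (z + 1) = 1 / b := rfl
      have hEd : E (z + 1) = E z + (if (z + 1).Prime then b / (z + 1 : ℕ) else 0) - (b - a) := by
        simp only [hE]
        have : ∑ p ∈ Nat.primesLE (z + 1), Real.log p / p = ∑ p ∈ Nat.primesLE z, Real.log p / p
            + (if (z + 1).Prime then b / (z + 1 : ℕ) else 0) := by
          rw [Nat.primesLE_eq_filter_Icc_zero, Nat.primesLE_eq_filter_Icc_zero, sum_filter,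
            sum_filter, sum_Icc_succ_top (by omega)]
        rw [this]
        ring
      have hS : ∑ p ∈ (Ioc w (z + 1)).filter Nat.Prime, (1 : ℝ) / p =
          ∑ p ∈ (Ioc w z).filter Nat.Prime, (1 : ℝ) / p +
            (if (z + 1).Prime then (1 : ℝ) / (z + 1 : ℕ) else 0) := by
        rw [sum_filter, sum_filter, sum_Ioc_succ_top (by omega)]
      have hll1 : (b - a) / b ≤ Real.log b - Real.log a := by
        have := Real.one_sub_inv_le_log_of_pos (show 0 < b / a by positivity)
        rw [Real.log_div l2.ne' l1.ne'] at this
        refine le_trans (le_of_eq ?_) this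
        field_simp
      have hll2 : Real.log b - Real.log a ≤ (b - a) / a := by
        have := Real.log_le_sub_one_of_pos (show 0 < b / a by positivity)
        rw [Real.log_div l2.ne' l1.ne'] at this
        refine this.trans (le_of_eq ?_)
        field_simp
      have hff : 0 ≤ 1 / a - 1 / b := sub_nonneg.2 (one_div_le_one_div_of_le l1 hab)
      have hll3 : (b - a) / a - (b - a) / b ≤ 1 / a - 1 / b := by
        have : (b - a) / a - (b - a) / b = (b - a) * (1 / a - 1 / b) := by ring
        rw [this]
        nlinarith
      have hEz := hm z (by omega)
      change |E z| ≤ C at hEz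
      have e1 : |E z * (1 / a - 1 / b)| ≤ C * (1 / a - 1 / b) := by
        rw [abs_mul, abs_of_nonneg hff]
        gcongr
      have hid : ∑ p ∈ (Ioc w (z + 1)).filter Nat.Prime, (1 : ℝ) / p
          - (Real.log b - Real.log (Real.log w)) - E (z + 1) * f (z + 1) =
          (∑ p ∈ (Ioc w z).filter Nat.Prime, (1 : ℝ) / p
          - (Real.log a - Real.log (Real.log w)) - E z * f z) + E z * (1 / a - 1 / b)
          + ((b - a) / b - (Real.log b - Real.log a)) := by
        rw [hS, hEd, hfz, hfz1]
        split_ifs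
        · have : ((z + 1 : ℕ) : ℝ) ≠ 0 := by positivity
          field_simp
          ring
        · field_simp
          ring
      rw [hid, hfz1]
      rw [hfz] at ih
      have e2 := abs_le.1 ih
      have e3 := abs_le.1 e1
      rw [abs_le]
      rw [hfz]
      constructor <;> nlinarith
  have h1 := hm z (by omega)
  change |E z| ≤ C at h1
  have hfz : 0 < f z := one_div_pos.2 (hlog z (hw.trans hz))
  have hfw : f z ≤ f w := by
    refine one_div_le_one_div_of_le (hlog w hw) (Real.log_le_log (by positivity) ?_)
    exact_mod_cast hz
  have h2 : |E z * f z| ≤ C * f z := by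
    rw [abs_mul, abs_of_pos hfz]; gcongr
  have h3 : (3 * C + 1) / Real.log w = (3 * C + 1) * f w := by simp only [hf]; ring
  rw [h3]
  have e1 := abs_le.1 key
  have e2 := abs_le.1 h2
  rw [abs_le]
  constructor <;> nlinarith

theorem factorial_dvd_pow_mul_prod (n a D : ℕ) :
    n.factorial ∣ D ^ n * ∏ j ∈ range n, (a + (j + 1) * D) := by
  rw [Nat.dvd_iff_prime_pow_dvd_dvd]
  intro p k hp hk
  have := Fact.mk hp
  by_cases hD : p ∣ D
  · have hkn : k ≤ n := by
      rw [padicValNat_dvd_iff_le n.factorial_ne_zero] at hk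
      have h := sub_one_mul_padicValNat_factorial (p := p) n
      have h1 : 1 ≤ p - 1 := by have := hp.two_le; omega
      have h2 : (p - 1) * padicValNat p n.factorial ≤ n := by rw [h]; exact Nat.sub_le _ _
      nlinarith
    exact Dvd.dvd.mul_right ((pow_dvd_pow p hkn).trans (pow_dvd_pow_of_dvd hD n)) _
  · refine Dvd.dvd.mul_left ?_ _
    have hcop : Nat.Coprime D (p ^ k) :=
      (Nat.Coprime.pow_left k ((Nat.Prime.coprime_iff_not_dvd hp).2 hD)).symm
    obtain ⟨s, -, hs⟩ := Nat.exists_mul_mod_eq_of_coprime a hcop (pow_pos hp.pos k).ne'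
    have hs' : D * s ≡ a [MOD p ^ k] := hs
    have h1 : ∏ j ∈ range n, (a + (j + 1) * D) ≡ ∏ j ∈ range n, (D * (s + 1 + j)) [MOD p ^ k] := by
      refine Nat.ModEq.prod fun j _ => ?_
      have : D * (s + 1 + j) = D * s + (j + 1) * D := by ring
      rw [this]
      exact (hs'.symm).add_right _
    have h2 : p ^ k ∣ ∏ j ∈ range n, (D * (s + 1 + j)) := by
      rw [prod_mul_distrib, ← Nat.ascFactorial_eq_prod_range]
      exact Dvd.dvd.mul_left (hk.trans (Nat.factorial_dvd_ascFactorial _ _)) _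
    exact (h1.dvd_iff dvd_rfl).2 h2

theorem card_primes_ap_mul_log_le (X D : ℕ) (hD : 1 ≤ D) (hDX : D * D ≤ X) (T : Finset ℕ)
    (hT : ∀ q ∈ T, q.Prime ∧ X < q ∧ q ≤ 2 * X) (hmod : ∀ q ∈ T, ∀ q' ∈ T, q ≡ q' [MOD D]) :
    (#T : ℝ) * Real.log X ≤ 6 * (X / D) * (1 + Real.log D) := by
  have hlogD : 0 ≤ Real.log D := Real.log_natCast_nonneg D
  rcases T.eq_empty_or_nonempty with rfl | ⟨q0, hq0⟩
  · simp only [card_empty, Nat.cast_zero, zero_mul]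
    positivity
  rcases hD.eq_or_lt with rfl | hD2
  · have h1 : ∑ q ∈ T, Real.log q ≤ Real.log 4 * (2 * X : ℕ) := by
      refine le_trans ?_ (Chebyshev.theta_le_log4_mul_x (by positivity))
      rw [Chebyshev.theta_eq_sum_primesLE_log]
      refine sum_le_sum_of_subset_of_nonneg (fun q hq => ?_) fun q _ _ => Real.log_natCast_nonneg q
      exact Nat.mem_primesLE.2 ⟨(hT q hq).2.2, (hT q hq).1⟩
    have h2 : (#T : ℝ) * Real.log X ≤ ∑ q ∈ T, Real.log q := by
      rw [← nsmul_eq_mul]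
      refine card_nsmul_le_sum _ _ _ fun q hq => ?_
      refine Real.log_le_log ?_ (by exact_mod_cast (hT q hq).2.1.le)
      exact_mod_cast hDX
    have h4 : Real.log 4 = 2 * Real.log 2 := by
      rw [show (4 : ℝ) = 2 ^ 2 by norm_num, Real.log_pow]; norm_num
    have h5 := Real.log_two_lt_d9
    have h6 : (0 : ℝ) ≤ X := by positivity
    push_cast at h1 ⊢
    rw [Real.log_one]
    nlinarith
  set a := q0 % D with ha
  set n := 2 * X / D with hn
  have hX : 1 ≤ X := by nlinarith
  have hnX : n * D ≤ 2 * X := Nat.div_mul_le_self _ _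
  have hform : ∀ q ∈ T, q ∣ ∏ j ∈ range n, (a + (j + 1) * D) := by
    intro q hq
    have h1 : q % D = a := hmod q hq q0 hq0
    have h2 := Nat.div_add_mod q D
    have hqX := hT q hq
    have h3 : 1 ≤ q / D := by
      rw [Nat.one_le_div_iff (by omega)]
      nlinarith
    have h4 : q / D ≤ n := Nat.div_le_div_right hqX.2.2
    have h5 : q = a + ((q / D - 1) + 1) * D := by
      rw [Nat.sub_add_cancel h3, ← h1, mul_comm]; omega
    have h6 := dvd_prod_of_mem (fun j => a + (j + 1) * D)
      (show q / D - 1 ∈ range n from mem_range.2 (by omega))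
    rwa [← h5] at h6
  set Q := ∏ q ∈ T, q with hQ
  have hQdvd : Q ∣ D ^ n * ∏ j ∈ range n, (a + (j + 1) * D) :=
    Dvd.dvd.mul_left (prod_primes_dvd _ (fun q hq => (hT q hq).1.prime) hform) _
  have hnlt : n ≤ X := by nlinarith
  have hprod : ∏ j ∈ range n, (a + (j + 1) * D) ≤ ((n + 1) * D) ^ n := by
    have ha' : a ≤ D := (Nat.mod_lt _ (by omega)).le
    refine (prod_le_pow_card _ _ _ fun j hj => ?_).trans_eq (by rw [card_range])
    have := mem_range.1 hj
    nlinarith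
  have hppos : 0 < D ^ n * ∏ j ∈ range n, (a + (j + 1) * D) := by
    refine Nat.mul_pos (pow_pos (by omega) _) (prod_pos fun j _ => ?_)
    have : 0 < (j + 1) * D := Nat.mul_pos (by omega) (by omega)
    omega
  have hcop : Nat.Coprime n.factorial Q := by
    refine Nat.Coprime.prod_right fun q hq => ?_
    have hqq := hT q hq
    rw [Nat.coprime_comm, hqq.1.coprime_iff_not_dvd, hqq.1.dvd_factorial]
    omega
  have hle := Nat.le_of_dvd hppos
    (hcop.mul_dvd_of_dvd_of_dvd (factorial_dvd_pow_mul_prod n a D) hQdvd)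
  have hle2 : n.factorial * Q ≤ D ^ n * ((n + 1) * D) ^ n := hle.trans (by gcongr)
  have hle3 : (n.factorial : ℝ) * Q ≤ D ^ n * ((n + 1) * D) ^ n := by exact_mod_cast hle2
  have hD0 : (0 : ℝ) < D := by exact_mod_cast (by omega : 0 < D)
  have hexp := Real.pow_div_factorial_le_exp ((n : ℝ) + 1) (by positivity) n
  rw [div_le_iff₀ (by positivity)] at hexp
  have hQ2 : (Q : ℝ) ≤ D ^ (2 * n) * Real.exp (n + 1) := by
    have hf : (0 : ℝ) < n.factorial := by positivity
    refine le_of_mul_le_mul_left ?_ hf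
    calc (n.factorial : ℝ) * Q ≤ D ^ n * ((n + 1) * D) ^ n := hle3
      _ = D ^ (2 * n) * (n + 1) ^ n := by rw [mul_pow, two_mul, pow_add]; ring
      _ ≤ D ^ (2 * n) * (Real.exp (n + 1) * n.factorial) := by gcongr
      _ = _ := by ring
  have hXpos : (0 : ℝ) < X := by exact_mod_cast hX
  have hQlow : (X : ℝ) ^ #T ≤ Q := by
    rw [hQ, Nat.cast_prod, ← prod_const]
    exact prod_le_prod (fun _ _ => hXpos.le) fun q hq => by exact_mod_cast (hT q hq).2.1.le
  have hlog := Real.log_le_log (by positivity) (hQlow.trans hQ2)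
  rw [Real.log_pow, Real.log_mul (by positivity) (by positivity), Real.log_exp, Real.log_pow] at hlog
  have hn1 : (n : ℝ) ≤ 2 * (X / D) := by
    rw [← mul_div_assoc, le_div_iff₀ hD0]
    exact_mod_cast hnX
  have hXD : 1 ≤ (X : ℝ) / D := by
    rw [le_div_iff₀ hD0]
    have : D ≤ X := by nlinarith
    rw [one_mul]
    exact_mod_cast this
  push_cast at hlog
  have : (n : ℝ) * Real.log D ≤ 2 * (X / D) * Real.log D := by gcongr
  have : 0 ≤ (X : ℝ) / D * Real.log D := by positivity
  nlinarith

theorem card_le_of_modEq (X D : ℕ) (T : Finset ℕ)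
    (hT : ∀ q ∈ T, X < q ∧ q ≤ 2 * X) (hmod : ∀ q ∈ T, ∀ q' ∈ T, q ≡ q' [MOD D]) :
    (#T : ℝ) ≤ X / D + 1 := by
  have hinj : #T ≤ X / D + 1 := by
    rcases T.eq_empty_or_nonempty with rfl | hne
    · simp
    set q0 := T.min' hne
    have hq0 : q0 ∈ T := T.min'_mem hne
    have hle : ∀ q ∈ T, q0 ≤ q := fun q hq => T.min'_le q hq
    have hd : ∀ q ∈ T, D ∣ q - q0 := fun q hq =>
      (Nat.modEq_iff_dvd' (hle q hq)).1 (hmod q0 hq0 q hq)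
    have : #T ≤ #(range (X / D + 1)) := by
      refine card_le_card_of_injOn (fun q => (q - q0) / D) (fun q hq => ?_) ?_
      · simp only [coe_range, Set.mem_Iio]
        have h1 := hT q hq
        have h2 := hT q0 hq0
        have h3 : (q - q0) / D ≤ X / D := Nat.div_le_div_right (by omega)
        omega
      · intro q hq q' hq' h
        simp only at h
        have h1 := Nat.div_mul_cancel (hd q hq)
        have h2 := Nat.div_mul_cancel (hd q' hq')
        rw [h, h2] at h1
        have := hle q hq
        have := hle q' hq'
        omega
    rwa [card_range] at this
  have h2 : ((X / D : ℕ) : ℝ) ≤ X / D := Nat.cast_div_le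
  have h3 : (#T : ℝ) ≤ (X / D : ℕ) + 1 := by exact_mod_cast hinj
  linarith

theorem card_primes_ap_le (X D : ℕ) (hX : 10 ≤ X) (hD : 1 ≤ D) (hDX : (D : ℝ) ≤ X * Real.log X ^ 2)
    (T : Finset ℕ)
    (hT : ∀ q ∈ T, q.Prime ∧ X < q ∧ q ≤ 2 * X) (hmod : ∀ q ∈ T, ∀ q' ∈ T, q ≡ q' [MOD D]) :
    (#T : ℝ) ≤ 32 * (X / D) * (1 + Real.log D) ^ 4 / Real.log X := by
  have hX' : (10 : ℝ) ≤ X := by exact_mod_cast hX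
  have hlogX : 1 ≤ Real.log X := by
    rw [Real.le_log_iff_exp_le (by linarith)]
    have := Real.exp_one_lt_d9
    linarith
  have hlogD : 0 ≤ Real.log D := Real.log_natCast_nonneg D
  have hD0 : (0 : ℝ) < D := by exact_mod_cast (by omega : 0 < D)
  rw [le_div_iff₀ (by linarith)]
  rcases le_or_gt (D * D) X with h | h
  · refine (card_primes_ap_mul_log_le X D hD h T hT hmod).trans ?_
    have h1 : 1 + Real.log D ≤ (1 + Real.log D) ^ 4 := le_self_pow₀ (by linarith) (by norm_num)
    gcongr
    norm_num
  · have h1 := card_le_of_modEq X D T (fun q hq => (hT q hq).2) hmod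
    have h2 : Real.log X / 2 ≤ Real.log D := by
      have : Real.log X ≤ Real.log ((D : ℝ) * D) :=
        Real.log_le_log (by linarith) (by exact_mod_cast h.le)
      rw [Real.log_mul hD0.ne' hD0.ne'] at this
      linarith
    have h3 : Real.log X ^ 4 / 16 ≤ (1 + Real.log D) ^ 4 := by
      have : (Real.log X / 2) ^ 4 ≤ (1 + Real.log D) ^ 4 := by gcongr; linarith
      linarith [show (Real.log X / 2) ^ 4 = Real.log X ^ 4 / 16 by ring]
    have h4 : 1 ≤ (X : ℝ) / D * Real.log X ^ 2 := by
      rw [div_mul_eq_mul_div, le_div_iff₀ hD0]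
      linarith
    have hXD : 0 ≤ (X : ℝ) / D := by positivity
    have hl2 : 1 ≤ Real.log X ^ 2 := one_le_pow₀ hlogX
    calc (#T : ℝ) * Real.log X ≤ (X / D + 1) * Real.log X := by gcongr
      _ ≤ (X / D * Real.log X ^ 2 + X / D * Real.log X ^ 2) * Real.log X := by
          gcongr; nlinarith
      _ = 2 * (X / D) * Real.log X ^ 3 * 1 := by ring
      _ ≤ 2 * (X / D) * Real.log X ^ 3 * Real.log X := by gcongr
      _ = 32 * (X / D) * (Real.log X ^ 4 / 16) := by ring
      _ ≤ _ := by gcongr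

theorem sum_inv_primes_ap_le (X D k : ℕ) (hX : 10 ≤ X) (hD : 1 ≤ D)
    (hDX : (D : ℝ) ≤ X * Real.log X ^ 2) (T : Finset ℕ)
    (hT : ∀ q ∈ T, q.Prime ∧ X < q ∧ q ≤ 2 ^ k * X)
    (hmod : ∀ q ∈ T, ∀ q' ∈ T, q ≡ q' [MOD D]) :
    ∑ q ∈ T, (1 : ℝ) / q ≤ k * (32 * (1 + Real.log D) ^ 4 / (D * Real.log X)) := by
  have hX' : (10 : ℝ) ≤ X := by exact_mod_cast hX
  have hlogX : 0 < Real.log X := Real.log_pos (by linarith)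
  have hlogD : 0 ≤ Real.log D := Real.log_natCast_nonneg D
  have hD0 : (0 : ℝ) < D := by exact_mod_cast (by omega : 0 < D)
  induction k generalizing T with
  | zero =>
    have : T = ∅ := by
      refine eq_empty_of_forall_notMem fun q hq => ?_
      have := hT q hq
      omega
    simp [this]
  | succ k ih =>
    have h1 := ih (T.filter (· ≤ 2 ^ k * X))
      (fun q hq => by rw [mem_filter] at hq; exact ⟨(hT q hq.1).1, (hT q hq.1).2.1, hq.2⟩)
      (fun q hq q' hq' => hmod q (mem_filter.1 hq).1 q' (mem_filter.1 hq').1)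
    have hk1 : 1 ≤ 2 ^ k := Nat.one_le_two_pow
    have hXk : X ≤ 2 ^ k * X := by nlinarith
    have hXk' : (X : ℝ) ≤ (2 ^ k * X : ℕ) := by exact_mod_cast hXk
    have hll : Real.log X ≤ Real.log (2 ^ k * X : ℕ) := Real.log_le_log (by linarith) hXk'
    have h2 := card_primes_ap_le (2 ^ k * X) D (hX.trans hXk) hD
      (hDX.trans (by gcongr))
      (T.filter (¬ · ≤ 2 ^ k * X))
      (fun q hq => by
        rw [mem_filter] at hq
        refine ⟨(hT q hq.1).1, by omega, ?_⟩
        have := (hT q hq.1).2.2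
        rw [pow_succ] at this
        linarith)
      (fun q hq q' hq' => hmod q (mem_filter.1 hq).1 q' (mem_filter.1 hq').1)
    set Y : ℝ := ((2 ^ k * X : ℕ) : ℝ) with hY
    have hY0 : 0 < Y := by linarith
    have h3 : ∑ q ∈ T.filter (¬ · ≤ 2 ^ k * X), (1 : ℝ) / q ≤
        32 * (1 + Real.log D) ^ 4 / (D * Real.log X) := by
      calc _ ≤ #(T.filter (¬ · ≤ 2 ^ k * X)) • (1 / Y) := by
            refine sum_le_card_nsmul _ _ _ fun q hq => ?_
            rw [mem_filter] at hq
            refine one_div_le_one_div_of_le hY0 ?_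
            rw [hY]
            exact_mod_cast (by omega : 2 ^ k * X ≤ q)
        _ ≤ (32 * (Y / D) * (1 + Real.log D) ^ 4 / Real.log Y) * (1 / Y) := by
            rw [nsmul_eq_mul]; gcongr
        _ = 32 * (1 + Real.log D) ^ 4 / (D * Real.log Y) := by field_simp
        _ ≤ _ := by gcongr
    rw [← sum_filter_add_sum_filter_not T (· ≤ 2 ^ k * X)]
    push_cast
    linarith

theorem sum_rpow_tail_le (s : ℝ) (hs : 0 < s) (w z : ℕ) (hw : 1 ≤ w) (hz : w ≤ z) :
    ∑ k ∈ Ioc w z, (k : ℝ) ^ (-1 - s) ≤ (1 / s) * ((w : ℝ) ^ (-s) - (z : ℝ) ^ (-s)) := by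
  induction z, hz using Nat.le_induction with
  | base => simp
  | succ z hz ih =>
    rw [sum_Ioc_succ_top (by omega)]
    have hz0 : (0 : ℝ) < z := by exact_mod_cast (by omega : 0 < z)
    set k : ℝ := ((z + 1 : ℕ) : ℝ) with hk
    have hk0 : 0 < k := by positivity
    have hkz : (z : ℝ) = k * (1 - 1 / k) := by
      rw [mul_sub, mul_one_div_cancel hk0.ne', hk]; push_cast; ring
    have h1 : 0 < 1 - 1 / k := by
      by_contra h
      nlinarith
    have h2 : 1 + s / k ≤ (1 - 1 / k) ^ (-s) := by
      calc 1 + s / k ≤ Real.exp (s / k) := by linarith [Real.add_one_le_exp (s / k)]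
        _ = (Real.exp (-(1 / k))) ^ (-s) := by rw [← Real.exp_mul]; congr 1; ring
        _ ≤ _ := by
          refine Real.rpow_le_rpow_of_nonpos h1 ?_ (by linarith)
          linarith [Real.add_one_le_exp (-(1 / k))]
    have h3 : k ^ (-s) * (1 + s / k) ≤ (z : ℝ) ^ (-s) := by
      rw [hkz, Real.mul_rpow hk0.le h1.le]
      gcongr
    have h4 : k ^ (-1 - s) = k ^ (-s) / k := by
      rw [show -1 - s = -s - 1 by ring, Real.rpow_sub_one hk0.ne']
    have h5 : k ^ (-1 - s) ≤ (1 / s) * ((z : ℝ) ^ (-s) - k ^ (-s)) := by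
      rw [h4, one_div_mul_eq_div, le_div_iff₀ hs]
      have : k ^ (-s) * (1 + s / k) = k ^ (-s) + k ^ (-s) / k * s := by ring
      linarith
    nlinarith

theorem one_add_log_pow_four_le (p : ℕ) (hp : 1 ≤ p) :
    (1 + Real.log p) ^ 4 ≤ 145 ^ 4 * (p : ℝ) ^ (1 / 36 : ℝ) := by
  have hp' : (1 : ℝ) ≤ p := by exact_mod_cast hp
  have h1 : Real.log p ≤ (p : ℝ) ^ (1 / 144 : ℝ) / (1 / 144) :=
    Real.log_le_rpow_div (by linarith) (by norm_num)
  have h2 : 1 ≤ (p : ℝ) ^ (1 / 144 : ℝ) := Real.one_le_rpow hp' (by norm_num)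
  have h3 : 0 ≤ Real.log p := Real.log_natCast_nonneg p
  calc (1 + Real.log p) ^ 4 ≤ (145 * (p : ℝ) ^ (1 / 144 : ℝ)) ^ 4 := by
        gcongr
        linarith
    _ = 145 ^ 4 * (p : ℝ) ^ (1 / 36 : ℝ) := by
        rw [mul_pow, ← Real.rpow_natCast ((p : ℝ) ^ (1 / 144 : ℝ)), ← Real.rpow_mul (by linarith)]
        norm_num

theorem one_add_log_prod_le (T : Finset ℕ) (hT : ∀ p ∈ T, 1 ≤ p) :
    1 + Real.log (∏ p ∈ T, p : ℕ) ≤ ∏ p ∈ T, (1 + Real.log p) := by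
  induction T using Finset.induction_on with
  | empty => simp
  | insert p T hp ih =>
    rw [prod_insert hp, prod_insert hp]
    have h1 := ih fun q hq => hT q (mem_insert_of_mem hq)
    have hp1 : 1 ≤ p := hT p (mem_insert_self _ _)
    have hT0 : 0 < ∏ q ∈ T, q := prod_pos fun q hq => hT q (mem_insert_of_mem hq)
    have hp0 : (0 : ℝ) < p := by exact_mod_cast hp1
    have hT1 : (0 : ℝ) < (∏ q ∈ T, q : ℕ) := by exact_mod_cast hT0
    rw [Nat.cast_mul, Real.log_mul hp0.ne' hT1.ne']
    have h2 : 0 ≤ Real.log p := Real.log_natCast_nonneg p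
    have h3 : 0 ≤ Real.log (∏ q ∈ T, q : ℕ) := Real.log_natCast_nonneg _
    nlinarith

theorem sum_primes_log_div_sq_le (w z : ℕ) (hw : 1 ≤ w) :
    ∑ p ∈ (Ioc w z).filter Nat.Prime, (1 + Real.log p) ^ 4 / (p : ℝ) ^ 2 ≤
      2 * 145 ^ 4 * (w : ℝ) ^ (-(35 / 36) : ℝ) := by
  have hw0 : (0 : ℝ) < w := by exact_mod_cast hw
  rcases lt_or_ge z w with h | h
  · rw [Ioc_eq_empty (by omega)]
    simp only [filter_empty, sum_empty]
    positivity
  calc _ ≤ ∑ p ∈ Ioc w z, (1 + Real.log p) ^ 4 / (p : ℝ) ^ 2 :=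
        sum_le_sum_of_subset_of_nonneg (filter_subset _ _) fun p _ _ => by positivity
    _ ≤ ∑ p ∈ Ioc w z, 145 ^ 4 * (p : ℝ) ^ (-1 - (35 / 36) : ℝ) := by
        refine sum_le_sum fun p hp => ?_
        have hp1 : 1 ≤ p := by have := mem_Ioc.1 hp; omega
        have hp0 : (0 : ℝ) < p := by exact_mod_cast hp1
        have : (p : ℝ) ^ (-1 - (35 / 36) : ℝ) = (p : ℝ) ^ (1 / 36 : ℝ) / (p : ℝ) ^ 2 := by
          rw [← Real.rpow_natCast, ← Real.rpow_sub hp0]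
          norm_num
        rw [this, ← mul_div_assoc]
        gcongr
        exact one_add_log_pow_four_le p hp1
    _ ≤ 145 ^ 4 * ((1 / (35 / 36)) * ((w : ℝ) ^ (-(35 / 36) : ℝ) - (z : ℝ) ^ (-(35 / 36) : ℝ))) := by
        rw [← mul_sum]
        gcongr
        exact sum_rpow_tail_le _ (by norm_num) w z hw h
    _ ≤ _ := by
        have h1 : 0 ≤ (z : ℝ) ^ (-(35 / 36) : ℝ) := by positivity
        have h2 : 0 ≤ (w : ℝ) ^ (-(35 / 36) : ℝ) := by positivity
        nlinarith

/-- Sum over squarefree moduli, indexed by nonempty sets of primes in `(w, z]`. -/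
theorem sum_powerset_weight_le (w z : ℕ) (hw : 1 ≤ w) (a : ℝ) (ha : 0 ≤ a) :
    ∑ T ∈ ((Ioc w z).filter Nat.Prime).powerset.erase ∅, (∏ p ∈ T, a / p) *
      ((1 + Real.log (∏ p ∈ T, p : ℕ)) ^ 4 / (∏ p ∈ T, p : ℕ)) ≤
      Real.exp (a * (2 * 145 ^ 4 * (w : ℝ) ^ (-(35 / 36) : ℝ))) - 1 := by
  set P := (Ioc w z).filter Nat.Prime
  have h1 : ∏ p ∈ P, (1 + a * ((1 + Real.log p) ^ 4 / (p : ℝ) ^ 2)) ≤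
      Real.exp (a * (2 * 145 ^ 4 * (w : ℝ) ^ (-(35 / 36) : ℝ))) := by
    calc _ ≤ ∏ p ∈ P, Real.exp (a * ((1 + Real.log p) ^ 4 / (p : ℝ) ^ 2)) := by
          refine prod_le_prod (fun p _ => by positivity) fun p _ => ?_
          linarith [Real.add_one_le_exp (a * ((1 + Real.log p) ^ 4 / (p : ℝ) ^ 2))]
      _ = Real.exp (a * ∑ p ∈ P, (1 + Real.log p) ^ 4 / (p : ℝ) ^ 2) := by
          rw [← Real.exp_sum, mul_sum]
      _ ≤ _ := by
          gcongr
          exact sum_primes_log_div_sq_le w z hw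
  rw [prod_one_add, ← add_sum_erase _ _ (empty_mem_powerset P), prod_empty] at h1
  refine le_sub_iff_add_le'.2 (le_trans ?_ h1)
  gcongr with T hT
  have hTP : T ⊆ P := mem_powerset.1 (mem_of_mem_erase hT)
  have hT1 : ∀ p ∈ T, 1 ≤ p := fun p hp => (mem_filter.1 (hTP hp)).2.one_le
  have h2 := one_add_log_prod_le T hT1
  have h3 : 0 ≤ Real.log (∏ q ∈ T, q : ℕ) := Real.log_natCast_nonneg _
  calc _ ≤ (∏ p ∈ T, a / p) * ((∏ p ∈ T, (1 + Real.log p)) ^ 4 / (∏ p ∈ T, p : ℕ)) := by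
        have : 0 ≤ ∏ p ∈ T, a / (p : ℝ) := prod_nonneg fun p _ => by positivity
        gcongr
    _ = _ := by
        rw [Nat.cast_prod, ← prod_pow, ← prod_div_distrib, ← prod_mul_distrib]
        exact prod_congr rfl fun p _ => by ring

/-- Average of `F` over the residues `b p`, `p ∈ l`, chosen uniformly and independently. -/
noncomputable def avg (l : List ℕ) (F : (ℕ → ℕ) → ℝ) (b : ℕ → ℕ) : ℝ :=
  match l with
  | [] => F b
  | p :: l => (∑ a ∈ range p, avg l F (Function.update b p a)) / p

/-- `v` avoids the residue class `b p` modulo every `p ∈ l`. -/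
def Surv (l : List ℕ) (b : ℕ → ℕ) (v : ℤ) : Prop := ∀ p ∈ l, v % (p : ℤ) ≠ (b p : ℤ)

open Classical in
/-- Indicator that all elements of `A` survive. -/
noncomputable def survInd (l : List ℕ) (b : ℕ → ℕ) (A : Finset ℤ) : ℝ :=
  if ∀ v ∈ A, Surv l b v then 1 else 0

theorem survInd_nonneg (l : List ℕ) (b : ℕ → ℕ) (A : Finset ℤ) : 0 ≤ survInd l b A := by
  unfold survInd; split_ifs <;> simp

theorem survInd_le_one (l : List ℕ) (b : ℕ → ℕ) (A : Finset ℤ) : survInd l b A ≤ 1 := by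
  unfold survInd; split_ifs <;> simp

theorem survInd_mul (l : List ℕ) (b : ℕ → ℕ) (A B : Finset ℤ) :
    survInd l b A * survInd l b B = survInd l b (A ∪ B) := by
  unfold survInd
  by_cases h1 : ∀ v ∈ A, Surv l b v <;> by_cases h2 : ∀ v ∈ B, Surv l b v
  · have : ∀ v ∈ A ∪ B, Surv l b v := fun v hv => (mem_union.1 hv).elim (h1 v) (h2 v)
    rw [if_pos h1, if_pos h2, if_pos this, mul_one]
  · have : ¬ ∀ v ∈ A ∪ B, Surv l b v := fun h => h2 fun v hv => h v (mem_union_right _ hv)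
    rw [if_neg h2, if_neg this, mul_zero]
  · have : ¬ ∀ v ∈ A ∪ B, Surv l b v := fun h => h1 fun v hv => h v (mem_union_left _ hv)
    rw [if_neg h1, if_neg this, zero_mul]
  · have : ¬ ∀ v ∈ A ∪ B, Surv l b v := fun h => h1 fun v hv => h v (mem_union_left _ hv)
    rw [if_neg h1, if_neg this, zero_mul]

theorem survInd_mul_of_subset (l : List ℕ) (b : ℕ → ℕ) {A B : Finset ℤ} (h : A ⊆ B) :
    survInd l b A * survInd l b B = survInd l b B := by
  rw [survInd_mul, union_eq_right.2 h]

theorem avg_append (l₁ l₂ : List ℕ) (F : (ℕ → ℕ) → ℝ) (b : ℕ → ℕ) :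
    avg (l₁ ++ l₂) F b = avg l₁ (avg l₂ F) b := by
  induction l₁ generalizing b with
  | nil => rfl
  | cons p l ih => simp only [List.cons_append, avg, ih]

theorem avg_mono_off {l : List ℕ} {F G : (ℕ → ℕ) → ℝ} {b : ℕ → ℕ}
    (h : ∀ b', (∀ p ∉ l, b' p = b p) → F b' ≤ G b') : avg l F b ≤ avg l G b := by
  induction l generalizing b with
  | nil => exact h b fun _ _ => rfl
  | cons p l ih =>
    simp only [avg]
    gcongr with a ha
    refine ih fun b' hb' => h b' fun q hq => ?_
    rw [List.mem_cons, not_or] at hq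
    rw [hb' q hq.2, Function.update_of_ne hq.1]

theorem avg_congr_off {l : List ℕ} {F G : (ℕ → ℕ) → ℝ} {b : ℕ → ℕ}
    (h : ∀ b', (∀ p ∉ l, b' p = b p) → F b' = G b') : avg l F b = avg l G b :=
  le_antisymm (avg_mono_off fun b' hb' => (h b' hb').le) (avg_mono_off fun b' hb' => (h b' hb').ge)

theorem avg_mono {l : List ℕ} {F G : (ℕ → ℕ) → ℝ} (h : ∀ b', F b' ≤ G b') (b : ℕ → ℕ) :
    avg l F b ≤ avg l G b := avg_mono_off fun b' _ => h b'

theorem avg_add (l : List ℕ) (F G : (ℕ → ℕ) → ℝ) (b : ℕ → ℕ) :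
    avg l (fun b => F b + G b) b = avg l F b + avg l G b := by
  induction l generalizing b with
  | nil => rfl
  | cons p l ih => simp only [avg, ih, sum_add_distrib, add_div]

theorem avg_const_mul (l : List ℕ) (c : ℝ) (F : (ℕ → ℕ) → ℝ) (b : ℕ → ℕ) :
    avg l (fun b => c * F b) b = c * avg l F b := by
  induction l generalizing b with
  | nil => rfl
  | cons p l ih => simp only [avg, ih, ← mul_sum, mul_div_assoc]

theorem avg_zero (l : List ℕ) (b : ℕ → ℕ) : avg l (fun _ => (0 : ℝ)) b = 0 := by
  simpa using avg_const_mul l 0 (fun _ => 0) b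

theorem avg_sum {ι : Type*} (s : Finset ι) (l : List ℕ) (F : ι → (ℕ → ℕ) → ℝ) (b : ℕ → ℕ) :
    avg l (fun b => ∑ i ∈ s, F i b) b = ∑ i ∈ s, avg l (F i) b := by
  classical
  induction s using Finset.induction_on with
  | empty => simpa using avg_zero l b
  | insert i s hi ih =>
    simp only [sum_insert hi]
    rw [avg_add, ih]

theorem avg_const {l : List ℕ} (hl : ∀ p ∈ l, 0 < p) (c : ℝ) (b : ℕ → ℕ) :
    avg l (fun _ => c) b = c := by
  induction l generalizing b with
  | nil => rfl
  | cons p l ih =>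
    have hp : (p : ℝ) ≠ 0 := by have := hl p (by simp); positivity
    simp only [avg, ih fun q hq => hl q (List.mem_cons_of_mem _ hq), sum_const, card_range,
      nsmul_eq_mul]
    field_simp

theorem exists_le_avg {l : List ℕ} (hl : ∀ p ∈ l, 0 < p) (F : (ℕ → ℕ) → ℝ) (b : ℕ → ℕ) :
    ∃ b', F b' ≤ avg l F b := by
  by_contra! h
  induction l generalizing b with
  | nil => exact lt_irrefl _ (h b)
  | cons p l ih =>
    have hp0 := hl p (by simp)
    have hp : (0 : ℝ) < p := by positivity
    have : ∃ a ∈ range p, avg l F (Function.update b p a) ≤ avg (p :: l) F b := by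
      refine exists_le_of_sum_le (nonempty_range_iff.2 hp0.ne') ?_
      simp only [avg, sum_const, card_range, nsmul_eq_mul]
      rw [mul_div_cancel₀ _ hp.ne']
    obtain ⟨a, -, ha⟩ := this
    exact ih (fun q hq => hl q (List.mem_cons_of_mem _ hq)) (Function.update b p a)
      fun t => ha.trans_lt (h t)

/-- Number of residue classes modulo `p` met by `A`. -/
def resCard (A : Finset ℤ) (p : ℕ) : ℕ := #(A.image fun v : ℤ => v % (p : ℤ))

theorem card_avoid_eq (A : Finset ℤ) (p : ℕ) (hp : 0 < p) :
    (#((range p).filter fun a : ℕ => ∀ v ∈ A, v % (p : ℤ) ≠ (a : ℤ)) : ℝ) = p - resCard A p := by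
  have h1 := card_filter_add_card_filter_not (s := range p)
    (fun a : ℕ => ∀ v ∈ A, v % (p : ℤ) ≠ (a : ℤ))
  have h2 : #((range p).filter fun a : ℕ => ¬ ∀ v ∈ A, v % (p : ℤ) ≠ (a : ℤ)) = resCard A p := by
    refine card_bij (fun a _ => (a : ℤ)) (fun a ha => ?_) (fun a _ a' _ h => by exact_mod_cast h)
      fun r hr => ?_
    · rw [mem_filter] at ha
      obtain ⟨-, ha⟩ := ha
      push Not at ha
      obtain ⟨v, hv, h⟩ := ha
      exact mem_image.2 ⟨v, hv, h⟩
    · obtain ⟨v, hv, rfl⟩ := mem_image.1 hr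
      have h0 : (0 : ℤ) < p := by exact_mod_cast hp
      have h3 := Int.emod_nonneg v h0.ne'
      have h4 := Int.emod_lt_of_pos v h0
      refine ⟨(v % (p : ℤ)).toNat, ?_, Int.toNat_of_nonneg h3⟩
      rw [mem_filter, mem_range]
      refine ⟨by omega, ?_⟩
      push Not
      exact ⟨v, hv, (Int.toNat_of_nonneg h3).symm⟩
  rw [h2, card_range] at h1
  rw [eq_sub_iff_add_eq]
  exact_mod_cast h1

theorem avg_survInd {l : List ℕ} (hl : ∀ p ∈ l, 0 < p) (hnd : l.Nodup) (A : Finset ℤ) (b : ℕ → ℕ) :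
    avg l (fun b => survInd l b A) b = ∏ p ∈ l.toFinset, (1 - (resCard A p : ℝ) / p) := by
  classical
  induction l generalizing b with
  | nil => simp [avg, survInd, Surv]
  | cons p l ih =>
    have hp0 := hl p (by simp)
    have hp : (p : ℝ) ≠ 0 := by positivity
    obtain ⟨hpl, hnd'⟩ := List.nodup_cons.1 hnd
    rw [List.toFinset_cons, prod_insert (by simpa using hpl)]
    simp only [avg]
    have h1 : ∀ a ∈ range p, avg l (fun b => survInd (p :: l) b A) (Function.update b p a) =
        (if ∀ v ∈ A, v % (p : ℤ) ≠ (a : ℤ) then 1 else 0) *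
          ∏ p ∈ l.toFinset, (1 - (resCard A p : ℝ) / p) := by
      intro a _
      rw [← ih (fun q hq => hl q (List.mem_cons_of_mem _ hq)) hnd' (Function.update b p a),
        ← avg_const_mul]
      refine avg_congr_off fun b' hb' => ?_
      have hbp : b' p = a := by rw [hb' p hpl, Function.update_self]
      have : (∀ v ∈ A, Surv (p :: l) b' v) ↔
          (∀ v ∈ A, v % (p : ℤ) ≠ (a : ℤ)) ∧ ∀ v ∈ A, Surv l b' v := by
        simp only [Surv, List.mem_cons, forall_eq_or_imp, hbp]
        exact forall₂_and
      simp only [survInd, this]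
      split_ifs <;> simp_all
    rw [sum_congr rfl h1, ← sum_mul, sum_boole, card_avoid_eq A p hp0]
    field_simp

/-- The primes in `(w, z]`, in increasing order. -/
def primesIoc (w z : ℕ) : List ℕ := (List.range' (w + 1) (z - w)).filter fun p => p.Prime

theorem mem_primesIoc {w z p : ℕ} : p ∈ primesIoc w z ↔ w < p ∧ p ≤ z ∧ p.Prime := by
  simp only [primesIoc, List.mem_filter, List.mem_range'_1, decide_eq_true_eq]
  constructor
  · rintro ⟨⟨h1, h2⟩, h3⟩
    exact ⟨by omega, by omega, h3⟩
  · rintro ⟨h1, h2, h3⟩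
    exact ⟨⟨by omega, by omega⟩, h3⟩

theorem nodup_primesIoc (w z : ℕ) : (primesIoc w z).Nodup := (List.nodup_range').filter _

theorem toFinset_primesIoc (w z : ℕ) : (primesIoc w z).toFinset = (Ioc w z).filter Nat.Prime := by
  ext p
  simp [mem_primesIoc, and_assoc]

theorem pos_of_mem_primesIoc {w z : ℕ} : ∀ p ∈ primesIoc w z, 0 < p :=
  fun _ hp => (mem_primesIoc.1 hp).2.2.pos

theorem primesIoc_append {u w z : ℕ} (h1 : u ≤ w) (h2 : w ≤ z) :
    primesIoc u z = primesIoc u w ++ primesIoc w z := by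
  rw [primesIoc, primesIoc, primesIoc, ← List.filter_append]
  congr 1
  rw [show z - u = (w - u) + (z - w) by omega, ← List.range'_append_1]
  congr 2
  omega

theorem avg_survInd_primesIoc (w z : ℕ) (A : Finset ℤ) (b : ℕ → ℕ) :
    avg (primesIoc w z) (fun b => survInd (primesIoc w z) b A) b =
      ∏ p ∈ (Ioc w z).filter Nat.Prime, (1 - (resCard A p : ℝ) / p) := by
  rw [avg_survInd pos_of_mem_primesIoc (nodup_primesIoc w z), toFinset_primesIoc]

/-- `∏ (1 - k / p)` over the primes `p` in `(w, z]`. -/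
noncomputable def piK (w z k : ℕ) : ℝ := ∏ p ∈ (Ioc w z).filter Nat.Prime, (1 - (k : ℝ) / p)

/-- Normalised indicator that `A` survives the primes in `(w, z]`. -/
noncomputable def lam (w z : ℕ) (b : ℕ → ℕ) (A : Finset ℤ) : ℝ :=
  survInd (primesIoc w z) b A / piK w z #A

theorem mem_primes_lt {w z p : ℕ} (hp : p ∈ (Ioc w z).filter Nat.Prime) : w < p ∧ p.Prime := by
  rw [mem_filter, mem_Ioc] at hp
  exact ⟨hp.1.1, hp.2⟩

theorem div_le_quarter {w z p k : ℕ} (hp : p ∈ (Ioc w z).filter Nat.Prime) (hk : 4 * k ≤ w) :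
    (k : ℝ) / p ≤ 1 / 4 := by
  have h := mem_primes_lt hp
  have hp0 : (0 : ℝ) < p := by exact_mod_cast h.2.pos
  rw [div_le_iff₀ hp0]
  have : (4 * k : ℝ) ≤ p := by exact_mod_cast hk.trans h.1.le
  linarith

theorem piK_pos {w z k : ℕ} (hk : 4 * k ≤ w) : 0 < piK w z k :=
  prod_pos fun p hp => by have := div_le_quarter hp hk; linarith

theorem lam_nonneg {w z : ℕ} (b : ℕ → ℕ) {A : Finset ℤ} (hk : 4 * #A ≤ w) : 0 ≤ lam w z b A :=
  div_nonneg (survInd_nonneg _ _ _) (piK_pos hk).le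

theorem avg_lam {w z : ℕ} (b : ℕ → ℕ) {A : Finset ℤ} (hk : 4 * #A ≤ w)
    (hA : ∀ p ∈ (Ioc w z).filter Nat.Prime, resCard A p = #A) :
    avg (primesIoc w z) (fun b => lam w z b A) b = 1 := by
  simp only [lam, div_eq_inv_mul]
  rw [avg_const_mul, avg_survInd_primesIoc, prod_congr rfl fun p hp => by rw [hA p hp],
    ← piK, inv_mul_cancel₀ (piK_pos hk).ne']

theorem ratio_bound (p k k' R f c : ℝ) (hp : 1 < p) (hk : k / p ≤ 1 / 4) (hk' : k' / p ≤ 1 / 4)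
    (hk0 : 0 ≤ k) (hk0' : 0 ≤ k')
    (hf : f = 0 ∨ f = 1 ∧ 1 ≤ k ∧ 1 ≤ k') (hc : 0 ≤ c) (hR : k + k' ≤ R + f + c) :
    1 - R / p ≤ ((1 - k / p) * (1 - k' / p)) * ((1 - f / p)⁻¹ * (1 + 2 * c / p)) := by
  have hp0 : 0 < p := by linarith
  set s := k / p with hs
  set t := k' / p with ht
  have hs0 : 0 ≤ s := by positivity
  have ht0 : 0 ≤ t := by positivity
  set g := c / p with hg
  have hg0 : 0 ≤ g := by positivity
  have hR' : s + t ≤ R / p + f / p + g := by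
    rw [hs, ht, hg, ← add_div, ← add_div, ← add_div]
    gcongr
  have h2c : 2 * c / p = 2 * g := by rw [hg]; ring
  rw [h2c]
  have hst : 1 / 2 ≤ (1 - s) * (1 - t) := by nlinarith
  rcases hf with rfl | ⟨rfl, h1, h1'⟩
  · simp only [zero_div, sub_zero, inv_one, one_mul, add_zero] at hR' ⊢
    nlinarith
  · set e := 1 / p with he
    have he1 : e < 1 := by rw [he, div_lt_one hp0]; exact hp
    have he0 : 0 < e := by positivity
    have hse : e ≤ s := by rw [he, hs]; gcongr
    have hte : e ≤ t := by rw [he, ht]; gcongr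
    have h1e : 0 < 1 - e := by linarith
    have : 1 - R / p ≤ 1 - s - t + e + g := by linarith
    refine this.trans ?_
    rw [← mul_assoc, mul_comm _ (1 - e)⁻¹, mul_assoc, inv_mul_eq_div, le_div_iff₀ h1e]
    have h3 : (1 - s - t + e) * (1 - e) ≤ (1 - s) * (1 - t) := by nlinarith
    nlinarith

theorem exp_sum_le_avg_exp {ι : Type*} (I : Finset ι) (hI : I.Nonempty) (g : ι → ℝ) :
    Real.exp (∑ i ∈ I, g i) ≤ (1 / (#I : ℝ)) * ∑ i ∈ I, Real.exp (#I * g i) := by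
  have hn : (0 : ℝ) < #I := by exact_mod_cast hI.card_pos
  have h := convexOn_exp.map_sum_le (t := I) (w := fun _ => 1 / (#I : ℝ))
    (p := fun i => #I * g i) (fun _ _ => by positivity)
    (by rw [sum_const, nsmul_eq_mul]; field_simp) (fun _ _ => Set.mem_univ _)
  simp only [smul_eq_mul] at h
  rw [← mul_sum, ← mul_sum, ← mul_sum] at h
  refine le_trans (le_of_eq ?_) h
  congr 1
  field_simp

/-- The sum over squarefree moduli `∏ T` dividing `m`, weighted by `∏ a / p`. -/
noncomputable def modSum (w z : ℕ) (a : ℝ) (m : ℤ) : ℝ :=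
  ∑ T ∈ ((Ioc w z).filter Nat.Prime).powerset,
    if (∀ p ∈ T, (p : ℤ) ∣ m) then ∏ p ∈ T, a / p else 0

theorem exp_le_modSum {w z n : ℕ} (hn : 2 * n ≤ w) (m : ℤ) :
    Real.exp (n * ∑ p ∈ ((Ioc w z).filter Nat.Prime).filter (fun p : ℕ => (p : ℤ) ∣ m), 2 / (p : ℝ)) ≤
      modSum w z (4 * n) m := by
  set P := (Ioc w z).filter Nat.Prime
  rw [mul_sum, Real.exp_sum]
  calc _ ≤ ∏ p ∈ P.filter (fun p : ℕ => (p : ℤ) ∣ m), (1 + 4 * n / (p : ℝ)) := by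
        refine prod_le_prod (fun _ _ => (Real.exp_pos _).le) fun p hp => ?_
        have h := mem_primes_lt (mem_filter.1 hp).1
        have hp0 : (0 : ℝ) < p := by exact_mod_cast h.2.pos
        have h0 : 0 ≤ (n : ℝ) * (2 / p) := by positivity
        have h1 : (n : ℝ) * (2 / p) ≤ 1 := by
          rw [← mul_div_assoc, div_le_one hp0, mul_comm]
          exact_mod_cast hn.trans h.1.le
        have h2 := Real.abs_exp_sub_one_le (x := (n : ℝ) * (2 / p)) (by rwa [abs_of_nonneg h0])
        rw [abs_of_nonneg h0] at h2
        have h3 := (abs_le.1 h2).2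
        have : 2 * ((n : ℝ) * (2 / p)) = 4 * n / p := by ring
        linarith
    _ = ∑ T ∈ (P.filter (fun p : ℕ => (p : ℤ) ∣ m)).powerset, ∏ p ∈ T, 4 * n / (p : ℝ) := prod_one_add ..
    _ ≤ modSum w z (4 * n) m := by
        rw [modSum, ← sum_filter]
        refine sum_le_sum_of_subset_of_nonneg (fun T hT => ?_) fun T _ _ =>
          prod_nonneg fun p _ => by positivity
        rw [mem_powerset] at hT
        rw [mem_filter, mem_powerset]
        exact ⟨hT.trans (filter_subset _ _), fun p hp => (mem_filter.1 (hT hp)).2⟩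

theorem prod_one_add_le_modSum {ι : Type*} {w z : ℕ} (I : Finset ι) (hI : I.Nonempty) (m : ι → ℤ)
    (hn : 2 * #I ≤ w) :
    ∏ p ∈ (Ioc w z).filter Nat.Prime,
      (1 + 2 * (#(I.filter fun i => (p : ℤ) ∣ m i) : ℝ) / p) ≤
      (1 / (#I : ℝ)) * ∑ i ∈ I, modSum w z (4 * #I) (m i) := by
  set P := (Ioc w z).filter Nat.Prime
  calc _ ≤ ∏ p ∈ P, Real.exp (2 * (#(I.filter fun i => (p : ℤ) ∣ m i) : ℝ) / p) := by
        refine prod_le_prod (fun p _ => by positivity) fun p _ => ?_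
        rw [add_comm]
        exact Real.add_one_le_exp _
    _ = Real.exp (∑ i ∈ I, ∑ p ∈ P.filter (fun p : ℕ => (p : ℤ) ∣ m i), 2 / (p : ℝ)) := by
        rw [← Real.exp_sum]
        congr 1
        simp only [sum_filter]
        rw [sum_comm]
        refine sum_congr rfl fun p _ => ?_
        rw [← sum_filter, sum_const, nsmul_eq_mul]
        ring
    _ ≤ _ := by
        refine (exp_sum_le_avg_exp I hI _).trans ?_
        gcongr with i hi
        exact exp_le_modSum hn (m i)

theorem resCard_le_self (A : Finset ℤ) (p : ℕ) (hp : 0 < p) : resCard A p ≤ p := by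
  have h := card_avoid_eq A p hp
  have : (0 : ℝ) ≤ p - resCard A p := by rw [← h]; positivity
  exact_mod_cast sub_nonneg.1 this

theorem avg_lam_mul_le {ι : Type*} {w z : ℕ} (b : ℕ → ℕ) {A A' : Finset ℤ} (hk : 4 * #A ≤ w)
    (hk' : 4 * #A' ≤ w) (f : ℕ) (hf : f = 0 ∨ f = 1 ∧ A.Nonempty ∧ A'.Nonempty)
    (I : Finset ι) (hI : I.Nonempty) (m : ι → ℤ) (hn : 2 * #I ≤ w)
    (hc : ∀ p ∈ (Ioc w z).filter Nat.Prime,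
      #A + #A' ≤ resCard (A ∪ A') p + f + #(I.filter fun i => (p : ℤ) ∣ m i)) :
    avg (primesIoc w z) (fun b => lam w z b A * lam w z b A') b ≤
      (piK w z f)⁻¹ * ((1 / (#I : ℝ)) * ∑ i ∈ I, modSum w z (4 * #I) (m i)) := by
  have h1 : ∀ b, lam w z b A * lam w z b A' =
      (piK w z #A * piK w z #A')⁻¹ * survInd (primesIoc w z) b (A ∪ A') := fun b => by
    rw [← survInd_mul, lam, lam, div_mul_div_comm, div_eq_inv_mul]
  simp only [h1]
  rw [avg_const_mul, avg_survInd_primesIoc, inv_mul_le_iff₀ (mul_pos (piK_pos hk) (piK_pos hk'))]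
  have hpf : 0 ≤ (piK w z f)⁻¹ := by
    rw [inv_nonneg]
    refine prod_nonneg fun p hp => ?_
    have h := mem_primes_lt hp
    have hp0 : (1 : ℝ) ≤ p := by exact_mod_cast h.2.one_le
    have : (f : ℝ) ≤ 1 := by rcases hf with rfl | ⟨rfl, -⟩ <;> simp
    rw [sub_nonneg, div_le_one (by linarith)]
    linarith
  have hpp : 0 ≤ piK w z #A * piK w z #A' := (mul_pos (piK_pos hk) (piK_pos hk')).le
  refine le_trans ?_ (mul_le_mul_of_nonneg_left (mul_le_mul_of_nonneg_left
    (prod_one_add_le_modSum I hI m hn) hpf) hpp)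
  simp only [piK]
  rw [← prod_inv_distrib, ← prod_mul_distrib, ← prod_mul_distrib, ← prod_mul_distrib]
  refine prod_le_prod (fun p hp => ?_) fun p hp => ?_
  · have h := mem_primes_lt hp
    have hp0 : (0 : ℝ) < p := by exact_mod_cast h.2.pos
    rw [sub_nonneg, div_le_one hp0]
    exact_mod_cast resCard_le_self _ p h.2.pos
  · have h := mem_primes_lt hp
    refine ratio_bound p _ _ _ f _ (by exact_mod_cast h.2.one_lt) (div_le_quarter hp hk)
      (div_le_quarter hp hk') (by positivity) (by positivity) ?_ (by positivity)
      (by exact_mod_cast hc p hp)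
    rcases hf with rfl | ⟨rfl, hA, hA'⟩
    · exact Or.inl (by simp)
    · exact Or.inr ⟨by simp, by exact_mod_cast hA.card_pos, by exact_mod_cast hA'.card_pos⟩

theorem card_add_card_le_resCard {A A' : Finset ℤ} {p : ℕ} (hA : resCard A p = #A)
    (hA' : resCard A' p = #A') :
    #A + #A' ≤ resCard (A ∪ A') p + #(A ∩ A') +
      #((A ×ˢ A').filter fun u => u.1 ≠ u.2 ∧ (p : ℤ) ∣ u.1 - u.2) := by
  classical
  set φ : ℤ → ℤ := fun v => v % (p : ℤ)
  have h1 : resCard (A ∪ A') p + #(A.image φ ∩ A'.image φ) = #A + #A' := by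
    rw [← hA, ← hA']
    unfold resCard
    rw [image_union]
    exact card_union_add_card_inter _ _
  have h2 : #(A.image φ ∩ A'.image φ) ≤ #((A ×ˢ A').filter fun u => (p : ℤ) ∣ u.1 - u.2) := by
    refine card_le_card_of_surjOn (fun u => φ u.1) fun r hr => ?_
    simp only [coe_inter, coe_image, Set.mem_inter_iff, Set.mem_image] at hr
    obtain ⟨⟨a, ha, rfl⟩, a', ha', h⟩ := hr
    refine ⟨(a, a'), ?_, rfl⟩
    simp only [coe_filter, Set.mem_ofPred_eq, mem_product]
    exact ⟨⟨ha, ha'⟩, Int.ModEq.dvd (show a' ≡ a [ZMOD p] from h)⟩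
  have h3 : #((A ×ˢ A').filter fun u => (p : ℤ) ∣ u.1 - u.2) ≤ #(A ∩ A') +
      #((A ×ˢ A').filter fun u => u.1 ≠ u.2 ∧ (p : ℤ) ∣ u.1 - u.2) := by
    have : #(A ∩ A') = #((A ∩ A').image fun a => (a, a)) :=
      (card_image_of_injective _ fun a b h => (Prod.ext_iff.1 h).1).symm
    rw [this]
    refine (card_le_card fun u hu => ?_).trans (card_union_le _ _)
    rw [mem_filter, mem_product] at hu
    rw [mem_union, mem_image, mem_filter, mem_product]
    by_cases h : u.1 = u.2
    · exact Or.inl ⟨u.1, mem_inter.2 ⟨hu.1.1, h ▸ hu.1.2⟩, Prod.ext rfl h⟩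
    · exact Or.inr ⟨hu.1, h, hu.2⟩
  omega

/-- Elements of `U` in the residue class `r` modulo `q`. -/
def cls (U : Finset ℤ) (q : ℕ) (r : ℤ) : Finset ℤ := U.filter fun u => u % (q : ℤ) = r

theorem mem_cls {U : Finset ℤ} {q : ℕ} {r u : ℤ} : u ∈ cls U q r ↔ u ∈ U ∧ u % (q : ℤ) = r := by
  rw [cls, mem_filter]

/-- Standing size assumptions: `U` lies in an interval of length `Y ≤ κ X`, and `Q` consists of
primes in `(X, 2 ^ k X]`; the sieving primes lie in `(w, z]`. -/
structure SieveSetup (w z X Y κ k : ℕ) (Y0 : ℤ) (U : Finset ℤ) (Q : Finset ℕ) : Prop where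
  one_le : 1 ≤ κ
  le_w : 8 * (κ + 1) ^ 2 ≤ w
  z_le : z ≤ X
  w_le : w ≤ X
  ten_le : 10 ≤ X
  Y_le : Y ≤ κ * X
  log_le : (2 * κ * 2 ^ k : ℝ) ≤ Real.log X ^ 2
  mem_U : ∀ u ∈ U, Y0 ≤ u ∧ u ≤ Y0 + Y
  mem_Q : ∀ q ∈ Q, q.Prime ∧ X < q ∧ q ≤ 2 ^ k * X

/-- Constant in the sum over moduli. -/
noncomputable def modErr (w κ : ℕ) : ℝ :=
  Real.exp (16 * (κ + 1) ^ 2 * (2 * 145 ^ 4 * (w : ℝ) ^ (-(35 / 36) : ℝ))) - 1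

theorem modErr_nonneg (w κ : ℕ) : 0 ≤ modErr w κ := by
  unfold modErr
  rw [sub_nonneg, Real.one_le_exp_iff]
  positivity

theorem sum_mul_modSum_le {ι : Type*} {w z κ : ℕ} (hw : 1 ≤ w) (s : Finset ι) (ω : ι → ℝ)
    (m : ι → ℤ) (a B : ℝ) (ha : 0 ≤ a) (haκ : a ≤ 16 * (κ + 1) ^ 2) (hB : 0 ≤ B)
    (h : ∀ T ⊆ (Ioc w z).filter Nat.Prime, T.Nonempty →
      ∑ i ∈ s with (∀ p ∈ T, (p : ℤ) ∣ m i), ω i ≤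
        B * ((1 + Real.log (∏ p ∈ T, p : ℕ)) ^ 4 / (∏ p ∈ T, p : ℕ))) :
    ∑ i ∈ s, ω i * modSum w z a (m i) ≤ ∑ i ∈ s, ω i + B * modErr w κ := by
  set P := (Ioc w z).filter Nat.Prime with hP
  have h1 : ∑ i ∈ s, ω i * modSum w z a (m i) =
      ∑ T ∈ P.powerset, (∏ p ∈ T, a / p) * ∑ i ∈ s with (∀ p ∈ T, (p : ℤ) ∣ m i), ω i := by
    simp only [modSum, mul_sum]
    rw [sum_comm]
    refine sum_congr rfl fun T _ => ?_
    rw [sum_filter]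
    exact sum_congr rfl fun i _ => by split_ifs <;> ring
  rw [h1, ← add_sum_erase _ _ (empty_mem_powerset P)]
  have h2 : (∏ p ∈ (∅ : Finset ℕ), a / (p : ℝ)) *
      ∑ i ∈ s with (∀ p ∈ (∅ : Finset ℕ), (p : ℤ) ∣ m i), ω i = ∑ i ∈ s, ω i := by simp
  rw [h2]
  gcongr
  have h3 := sum_powerset_weight_le w z hw a ha
  have h4 : Real.exp (a * (2 * 145 ^ 4 * (w : ℝ) ^ (-(35 / 36) : ℝ))) - 1 ≤ modErr w κ := by
    unfold modErr; gcongr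
  calc _ ≤ ∑ T ∈ P.powerset.erase ∅, B * ((∏ p ∈ T, a / p) *
        ((1 + Real.log (∏ p ∈ T, p : ℕ)) ^ 4 / (∏ p ∈ T, p : ℕ))) := by
        refine sum_le_sum fun T hT => ?_
        rw [mem_erase, mem_powerset] at hT
        have h5 := h T hT.2 (nonempty_iff_ne_empty.2 hT.1)
        have h6 : 0 ≤ ∏ p ∈ T, a / (p : ℝ) := prod_nonneg fun p _ => by positivity
        calc _ ≤ (∏ p ∈ T, a / (p : ℝ)) *
              (B * ((1 + Real.log (∏ p ∈ T, p : ℕ)) ^ 4 / (∏ p ∈ T, p : ℕ))) := by gcongr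
          _ = _ := by ring
    _ ≤ B * modErr w κ := by
        rw [← mul_sum]
        gcongr
        exact h3.trans h4

theorem prod_dvd_of_forall_dvd {T : Finset ℕ} (hT : ∀ p ∈ T, p.Prime) {m : ℤ}
    (h : ∀ p ∈ T, (p : ℤ) ∣ m) : ((∏ p ∈ T, p : ℕ) : ℤ) ∣ m := by
  rw [Int.natCast_dvd]
  exact prod_primes_dvd _ (fun p hp => (hT p hp).prime) fun p hp => Int.natCast_dvd.1 (h p hp)

theorem le_abs_of_prod_dvd {D : ℕ} {m : ℤ} (h : (D : ℤ) ∣ m) (hm : m ≠ 0) : (D : ℤ) ≤ |m| :=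
  Int.le_of_dvd (abs_pos.2 hm) ((dvd_abs _ _).2 h)

namespace SieveSetup

variable {w z X Y κ k : ℕ} {Y0 : ℤ} {U : Finset ℤ} {Q : Finset ℕ}

theorem kappa_lt (S : SieveSetup w z X Y κ k Y0 U Q) : κ + 1 < w := by
  have := S.le_w; nlinarith

theorem abs_sub_le (S : SieveSetup w z X Y κ k Y0 U Q) {u u' : ℤ} (hu : u ∈ U) (hu' : u' ∈ U) :
    |u - u'| ≤ κ * X := by
  have h1 := S.mem_U u hu
  have h2 := S.mem_U u' hu'
  have h3 : (Y : ℤ) ≤ κ * X := by exact_mod_cast S.Y_le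
  rw [abs_le]
  constructor <;> linarith

theorem card_cls_le (S : SieveSetup w z X Y κ k Y0 U Q) {q : ℕ} (hq : q ∈ Q) (r : ℤ) :
    #(cls U q r) ≤ κ + 1 := by
  have hqQ := S.mem_Q q hq
  have hq0 : (0 : ℤ) < q := by exact_mod_cast hqQ.1.pos
  have h : #(cls U q r) ≤ #(Icc (Y0 / (q : ℤ)) (Y0 / (q : ℤ) + κ)) := by
    refine card_le_card_of_injOn (fun u => u / (q : ℤ)) (fun u hu => ?_) fun u hu u' hu' h => ?_
    · have h1 := S.mem_U u (mem_cls.1 hu).1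
      have h3 : (Y : ℤ) ≤ κ * X := by exact_mod_cast S.Y_le
      have h4 : (X : ℤ) < q := by exact_mod_cast hqQ.2.1
      rw [coe_Icc]
      refine ⟨Int.ediv_le_ediv hq0 h1.1, ?_⟩
      rw [← Int.add_mul_ediv_right _ _ hq0.ne']
      refine Int.ediv_le_ediv hq0 ?_
      nlinarith
    · have h1 := (mem_cls.1 hu).2
      have h2 := (mem_cls.1 hu').2
      simp only at h
      rw [← Int.mul_ediv_add_emod u q, ← Int.mul_ediv_add_emod u' q, h, h1, h2]
  refine h.trans (le_of_eq ?_)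
  rw [Int.card_Icc]
  omega

theorem four_mul_card_cls_le (S : SieveSetup w z X Y κ k Y0 U Q) {q : ℕ} (hq : q ∈ Q) (r : ℤ) :
    4 * #(cls U q r) ≤ w := by
  have h1 := S.card_cls_le hq r
  have h2 := S.le_w
  nlinarith

theorem prime_lt (S : SieveSetup w z X Y κ k Y0 U Q) {p q : ℕ}
    (hp : p ∈ (Ioc w z).filter Nat.Prime) (hq : q ∈ Q) : p < q := by
  rw [mem_filter, mem_Ioc] at hp
  have := (S.mem_Q q hq).2.1
  have := S.z_le
  omega

theorem resCard_cls (S : SieveSetup w z X Y κ k Y0 U Q) {q : ℕ} (hq : q ∈ Q) (r : ℤ) {p : ℕ}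
    (hp : p ∈ (Ioc w z).filter Nat.Prime) : resCard (cls U q r) p = #(cls U q r) := by
  refine card_image_of_injOn fun u hu u' hu' h => ?_
  have hpp := mem_primes_lt hp
  have hqQ := S.mem_Q q hq
  have h1 := mem_cls.1 hu
  have h2 := mem_cls.1 hu'
  have hdp : (p : ℤ) ∣ u - u' := Int.ModEq.dvd (show u' ≡ u [ZMOD p] from h.symm)
  have hdq : (q : ℤ) ∣ u - u' := Int.ModEq.dvd (show u' ≡ u [ZMOD q] from h2.2.trans h1.2.symm)
  have hcop : IsCoprime (p : ℤ) (q : ℤ) := by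
    rw [Nat.isCoprime_iff_coprime]
    exact (Nat.coprime_primes hpp.2 hqQ.1).2 (S.prime_lt hp hq).ne
  have hd := hcop.mul_dvd hdp hdq
  have habs := S.abs_sub_le h1.1 h2.1
  have hlt : |u - u'| < (p : ℤ) * q := by
    have h3 : (κ : ℤ) < p := by have := S.kappa_lt; exact_mod_cast (by omega : κ < p)
    have h4 : (X : ℤ) < q := by exact_mod_cast hqQ.2.1
    nlinarith
  exact sub_eq_zero.1 (Int.eq_zero_of_abs_lt_dvd hd hlt)

theorem card_cls_add_card_cls_le (S : SieveSetup w z X Y κ k Y0 U Q) {q q' : ℕ} (hq : q ∈ Q) (hq' : q' ∈ Q)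
    (hne : q ≠ q') {v : ℤ} (hv : v ∈ U) {p : ℕ} (hp : p ∈ (Ioc w z).filter Nat.Prime) :
    #(cls U q (v % q)) + #(cls U q' (v % q')) ≤ resCard (cls U q (v % q) ∪ cls U q' (v % q')) p + 1 +
      #((((Icc (-(κ : ℤ)) κ).erase 0) ×ˢ ((Icc (-(κ : ℤ)) κ).erase 0)).filter
        fun i => (p : ℤ) ∣ q * i.1 - q' * i.2) := by
  have hpp := mem_primes_lt hp
  have hqQ := S.mem_Q q hq
  have hqQ' := S.mem_Q q' hq'
  have hκ := S.kappa_lt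
  have hwX := S.w_le
  have hq0 : (0 : ℤ) < q := by exact_mod_cast hqQ.1.pos
  have hq0' : (0 : ℤ) < q' := by exact_mod_cast hqQ'.1.pos
  have hXq : (X : ℤ) < q := by exact_mod_cast hqQ.2.1
  have hXq' : (X : ℤ) < q' := by exact_mod_cast hqQ'.2.1
  have hκp : (κ : ℤ) < p := by exact_mod_cast (by omega : κ < p)
  have hκX : (κ : ℤ) < X := by exact_mod_cast (by omega : κ < X)
  have hκ0 : (0 : ℤ) ≤ κ := by positivity
  have hlt := S.prime_lt hp hq
  have hlt' := S.prime_lt hp hq'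
  have form : ∀ q : ℕ, (0 : ℤ) < q → (X : ℤ) < q → ∀ a ∈ cls U q (v % q),
      a = v + q * ((a - v) / q) ∧ |(a - v) / (q : ℤ)| ≤ κ := by
    intro q hq0 hXq a ha
    have h1 := mem_cls.1 ha
    have hd : (q : ℤ) ∣ a - v := Int.ModEq.dvd (show v ≡ a [ZMOD q] from h1.2.symm)
    have h2 := Int.mul_ediv_cancel' hd
    refine ⟨by rw [h2]; ring, ?_⟩
    have h3 := S.abs_sub_le h1.1 hv
    rw [← h2, abs_mul, abs_of_pos hq0] at h3
    by_contra hcon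
    push Not at hcon
    nlinarith
  have hinter : #(cls U q (v % q) ∩ cls U q' (v % q')) ≤ 1 := by
    rw [card_le_one]
    intro a ha a' ha'
    rw [mem_inter] at ha ha'
    have key : ∀ a, a ∈ cls U q (v % q) → a ∈ cls U q' (v % q') → a = v := by
      intro a h1 h2
      have hd : (q : ℤ) ∣ a - v := Int.ModEq.dvd (show v ≡ a [ZMOD q] from (mem_cls.1 h1).2.symm)
      have hd' : (q' : ℤ) ∣ a - v := Int.ModEq.dvd (show v ≡ a [ZMOD q'] from (mem_cls.1 h2).2.symm)
      have hcop : IsCoprime (q : ℤ) (q' : ℤ) := by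
        rw [Nat.isCoprime_iff_coprime]
        exact (Nat.coprime_primes hqQ.1 hqQ'.1).2 hne
      have h3 := S.abs_sub_le (mem_cls.1 h1).1 hv
      exact sub_eq_zero.1 (Int.eq_zero_of_abs_lt_dvd (hcop.mul_dvd hd hd') (by nlinarith))
    rw [key a ha.1 ha.2, key a' ha'.1 ha'.2]
  refine (card_add_card_le_resCard (S.resCard_cls hq _ hp) (S.resCard_cls hq' _ hp)).trans ?_
  refine Nat.add_le_add (Nat.add_le_add_left hinter _) ?_
  refine card_le_card_of_injOn (fun u : ℤ × ℤ => ((u.1 - v) / (q : ℤ), (u.2 - v) / (q' : ℤ)))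
    (fun u hu => ?_) fun u hu u' hu' h => ?_
  · simp only [coe_filter, Set.mem_ofPred_eq, mem_product] at hu
    obtain ⟨⟨hu1, hu2⟩, hune, hud⟩ := hu
    obtain ⟨e1, b1⟩ := form q hq0 hXq u.1 hu1
    obtain ⟨e2, b2⟩ := form q' hq0' hXq' u.2 hu2
    set h := (u.1 - v) / (q : ℤ)
    set h' := (u.2 - v) / (q' : ℤ)
    have hm : u.1 - u.2 = q * h - q' * h' := by rw [e1, e2]; ring
    rw [hm] at hud
    have hppZ : Prime (p : ℤ) := Nat.prime_iff_prime_int.1 hpp.2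
    have hnd : ∀ q : ℕ, q.Prime → p < q → ¬ (p : ℤ) ∣ q := by
      intro q hq hlt hd
      have := (Nat.prime_dvd_prime_iff_eq hpp.2 hq).1 (by exact_mod_cast hd)
      omega
    have hh : h ≠ 0 := by
      intro h0
      rw [h0, mul_zero, zero_sub, dvd_neg] at hud
      have h3 : h' = 0 := Int.eq_zero_of_abs_lt_dvd
        ((hppZ.dvd_or_dvd hud).resolve_left (hnd q' hqQ'.1 hlt')) (by linarith)
      apply hune
      rw [e1, e2, h0, h3]; ring
    have hh' : h' ≠ 0 := by
      intro h0
      rw [h0, mul_zero, sub_zero] at hud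
      have h3 : h = 0 := Int.eq_zero_of_abs_lt_dvd
        ((hppZ.dvd_or_dvd hud).resolve_left (hnd q hqQ.1 hlt)) (by linarith)
      exact hh h3
    simp only [coe_filter, Set.mem_ofPred_eq, mem_product, mem_erase, mem_Icc]
    exact ⟨⟨⟨hh, abs_le.1 b1⟩, hh', abs_le.1 b2⟩, hud⟩
  · simp only [coe_filter, Set.mem_ofPred_eq, mem_product] at hu hu'
    simp only [Prod.mk.injEq] at h
    refine Prod.ext ?_ ?_
    · rw [(form q hq0 hXq u.1 hu.1.1).1, (form q hq0 hXq u'.1 hu'.1.1).1, h.1]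
    · rw [(form q' hq0' hXq' u.2 hu.1.2).1, (form q' hq0' hXq' u'.2 hu'.1.2).1, h.2]

end SieveSetup

theorem survInd_sq (l : List ℕ) (b : ℕ → ℕ) (A : Finset ℤ) :
    survInd l b A * survInd l b A = survInd l b A := survInd_mul_of_subset l b Subset.rfl

theorem piK_anti {w z k k' : ℕ} (h : k ≤ k') (hk : 4 * k' ≤ w) : piK w z k' ≤ piK w z k := by
  refine prod_le_prod (fun p hp => ?_) fun p hp => ?_
  · have := div_le_quarter hp hk; linarith
  · gcongr

theorem piK_zero (w z : ℕ) : piK w z 0 = 1 := by simp [piK]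

theorem avg_lam_sq {w z : ℕ} (b : ℕ → ℕ) {A : Finset ℤ} (hk : 4 * #A ≤ w)
    (hA : ∀ p ∈ (Ioc w z).filter Nat.Prime, resCard A p = #A) :
    avg (primesIoc w z) (fun b => lam w z b A * lam w z b A) b = (piK w z #A)⁻¹ := by
  have : ∀ b, lam w z b A * lam w z b A = (piK w z #A)⁻¹ * lam w z b A := fun b => by
    rw [lam, div_mul_div_comm, survInd_sq, div_mul_eq_div_div, div_eq_inv_mul]
  simp only [this]
  rw [avg_const_mul, avg_lam b hk hA, mul_one]

namespace SieveSetup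

variable {w z X Y κ k : ℕ} {Y0 : ℤ} {U : Finset ℤ} {Q : Finset ℕ}

theorem log_pos (S : SieveSetup w z X Y κ k Y0 U Q) : 1 ≤ Real.log X := by
  have hX' : (10 : ℝ) ≤ X := by exact_mod_cast S.ten_le
  rw [Real.le_log_iff_exp_le (by linarith)]
  have := Real.exp_one_lt_d9
  linarith

theorem sum_inv_le_of_dvd (S : SieveSetup w z X Y κ k Y0 U Q) {q : ℕ} (hq : q ∈ Q) {h h' : ℤ}
    (hh : |h| ≤ κ) (hh' : |h'| ≤ κ) (h0 : h ≠ 0) (h0' : h' ≠ 0) {T : Finset ℕ}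
    (hT : T ⊆ (Ioc w z).filter Nat.Prime) :
    ∑ q' ∈ Q.erase q with (∀ p ∈ T, (p : ℤ) ∣ q * h - (q' : ℕ) * h'), (1 : ℝ) / q' ≤
      (32 * k / Real.log X) * ((1 + Real.log (∏ p ∈ T, p : ℕ)) ^ 4 / (∏ p ∈ T, p : ℕ)) := by
  set D := ∏ p ∈ T, p with hD
  set R := (Q.erase q).filter fun q' : ℕ => ∀ p ∈ T, (p : ℤ) ∣ q * h - (q' : ℕ) * h' with hR
  have hlog := S.log_pos
  have hTp : ∀ p ∈ T, w < p ∧ p.Prime := fun p hp => mem_primes_lt (hT hp)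
  have hD1 : 1 ≤ D := prod_pos fun p hp => (hTp p hp).2.pos
  have hκ := S.kappa_lt
  rcases R.eq_empty_or_nonempty with hemp | ⟨q1, hq1⟩
  · rw [hemp, sum_empty]
    have : 0 ≤ Real.log D := Real.log_natCast_nonneg D
    positivity
  have hRmem : ∀ q' ∈ R, q' ≠ q ∧ q' ∈ Q ∧ (∀ p ∈ T, (p : ℤ) ∣ q * h - (q' : ℕ) * h') := by
    intro q' hq'
    rw [hR, mem_filter, mem_erase] at hq'
    exact ⟨hq'.1.1, hq'.1.2, hq'.2⟩
  have hdvd : ∀ q' ∈ R, (D : ℤ) ∣ q * h - (q' : ℕ) * h' := fun q' hq' =>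
    prod_dvd_of_forall_dvd (fun p hp => (hTp p hp).2) (hRmem q' hq').2.2
  have hqQ := S.mem_Q q hq
  have hDX : (D : ℝ) ≤ X * Real.log X ^ 2 := by
    obtain ⟨hne, hqq1, -⟩ := hRmem q1 hq1
    have hqQ1 := S.mem_Q q1 hqq1
    have hm0 : (q : ℤ) * h - (q1 : ℕ) * h' ≠ 0 := by
      intro h3
      have h4 : (q1 : ℤ) ∣ q * h := ⟨h', by linarith⟩
      have hq1p : Prime (q1 : ℤ) := Nat.prime_iff_prime_int.1 hqQ1.1
      rcases hq1p.dvd_or_dvd h4 with h5 | h5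
      · exact hne ((Nat.prime_dvd_prime_iff_eq hqQ1.1 hqQ.1).1 (by exact_mod_cast h5))
      · refine h0 (Int.eq_zero_of_abs_lt_dvd h5 ?_)
        have := S.w_le
        have : (κ : ℤ) < q1 := by exact_mod_cast (by omega : κ < q1)
        linarith
    have h1 := le_abs_of_prod_dvd (hdvd q1 hq1) hm0
    have h2 : |(q : ℤ) * h - (q1 : ℕ) * h'| ≤ 2 * κ * (2 ^ k * X) := by
      have e1 : (q : ℤ) ≤ 2 ^ k * X := by exact_mod_cast hqQ.2.2
      have e2 : (q1 : ℤ) ≤ 2 ^ k * X := by exact_mod_cast hqQ1.2.2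
      calc |(q : ℤ) * h - (q1 : ℕ) * h'| ≤ |(q : ℤ) * h| + |(q1 : ℤ) * h'| := abs_sub _ _
        _ = q * |h| + q1 * |h'| := by rw [abs_mul, abs_mul, Nat.abs_cast, Nat.abs_cast]
        _ ≤ (2 ^ k * X) * κ + (2 ^ k * X) * κ := by gcongr
        _ = _ := by ring
    have h3 : (D : ℝ) ≤ 2 * κ * (2 ^ k * X) := by exact_mod_cast h1.trans h2
    have h4 := S.log_le
    have hX0 : (0 : ℝ) ≤ X := by positivity
    nlinarith
  have h1 := sum_inv_primes_ap_le X D k S.ten_le hD1 hDX R (fun q' hq' => S.mem_Q q' (hRmem q' hq').2.1)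
    (fun q' hq' q'' hq'' => by
      rw [Nat.modEq_iff_dvd]
      refine prod_dvd_of_forall_dvd (fun p hp => (hTp p hp).2) fun p hp => ?_
      have e1 := (hRmem q' hq').2.2 p hp
      have e2 := (hRmem q'' hq'').2.2 p hp
      have e3 : (p : ℤ) ∣ ((q'' : ℤ) - q') * h' := by
        have := dvd_sub e1 e2
        rwa [show (q : ℤ) * h - (q' : ℕ) * h' - (q * h - (q'' : ℕ) * h') = ((q'' : ℤ) - q') * h' by ring] at this
      refine ((Nat.prime_iff_prime_int.1 (hTp p hp).2).dvd_or_dvd e3).resolve_right fun e4 => ?_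
      refine h0' (Int.eq_zero_of_abs_lt_dvd e4 ?_)
      have := (hTp p hp).1
      have : (κ : ℤ) < p := by exact_mod_cast (by omega : κ < p)
      linarith)
  refine h1.trans (le_of_eq ?_)
  field_simp

theorem sum_avg_lam_mul_le (S : SieveSetup w z X Y κ k Y0 U Q) {q : ℕ} (hq : q ∈ Q) {v : ℤ}
    (hv : v ∈ U) (b : ℕ → ℕ) :
    ∑ q' ∈ Q.erase q, (1 / (q' : ℝ)) * avg (primesIoc w z)
      (fun b => lam w z b (cls U q (v % q)) * lam w z b (cls U q' (v % q'))) b ≤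
      (piK w z 1)⁻¹ * (∑ q ∈ Q, 1 / (q : ℝ) + (32 * k / Real.log X) * modErr w κ) := by
  have hκ := S.one_le
  have hw := S.le_w
  have hlog := S.log_pos
  have hw1 : 1 ≤ w := by have := S.kappa_lt; omega
  set H := (Icc (-(κ : ℤ)) κ).erase 0 with hH
  have hHc : #H = 2 * κ := by
    rw [hH, card_erase_of_mem (by simp), Int.card_Icc]; omega
  set I := H ×ˢ H with hI
  have hIc : #I = 4 * κ ^ 2 := by rw [hI, card_product, hHc]; ring
  have hIne : I.Nonempty := by rw [← card_pos, hIc]; positivity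
  have hIc0 : (0 : ℝ) < #I := by exact_mod_cast hIne.card_pos
  have hpi : 0 ≤ (piK w z 1)⁻¹ := inv_nonneg.2 (piK_pos (by nlinarith)).le
  have h1 : ∀ q' ∈ Q.erase q, avg (primesIoc w z)
      (fun b => lam w z b (cls U q (v % q)) * lam w z b (cls U q' (v % q'))) b ≤
      (piK w z 1)⁻¹ * ((1 / (#I : ℝ)) * ∑ i ∈ I, modSum w z (4 * #I) (q * i.1 - q' * i.2)) := by
    intro q' hq'
    rw [mem_erase] at hq'
    refine avg_lam_mul_le b (S.four_mul_card_cls_le hq _) (S.four_mul_card_cls_le hq'.2 _) 1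
      (Or.inr ⟨rfl, ⟨v, mem_cls.2 ⟨hv, rfl⟩⟩, ⟨v, mem_cls.2 ⟨hv, rfl⟩⟩⟩) I hIne _ ?_ fun p hp =>
        S.card_cls_add_card_cls_le hq hq'.2 (Ne.symm hq'.1) hv hp
    rw [hIc]; nlinarith
  have h2 : ∀ i ∈ I, ∑ q' ∈ Q.erase q, (1 / (q' : ℝ)) * modSum w z (4 * #I) (q * i.1 - q' * i.2) ≤
      ∑ q ∈ Q, 1 / (q : ℝ) + (32 * k / Real.log X) * modErr w κ := by
    intro i hi
    rw [hI, mem_product, hH, mem_erase, mem_erase, mem_Icc, mem_Icc] at hi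
    have h3 := sum_mul_modSum_le (κ := κ) (z := z) hw1 (Q.erase q) (fun q' : ℕ => 1 / (q' : ℝ))
      (fun q' : ℕ => q * i.1 - q' * i.2) (4 * #I) (32 * k / Real.log X) (by positivity)
      (by rw [hIc]; push_cast; nlinarith [(Nat.cast_nonneg κ : (0 : ℝ) ≤ κ)]) (by positivity)
      fun T hT _ => S.sum_inv_le_of_dvd hq (abs_le.2 hi.1.2) (abs_le.2 hi.2.2) hi.1.1 hi.2.1 hT
    refine h3.trans ?_
    gcongr
    exact erase_subset _ _
  calc _ ≤ ∑ q' ∈ Q.erase q, (1 / (q' : ℝ)) * ((piK w z 1)⁻¹ * ((1 / (#I : ℝ)) *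
        ∑ i ∈ I, modSum w z (4 * #I) (q * i.1 - q' * i.2))) := by
        refine sum_le_sum fun q' hq' => ?_
        have := h1 q' hq'
        gcongr
    _ = (piK w z 1)⁻¹ * ((1 / (#I : ℝ)) * ∑ i ∈ I, ∑ q' ∈ Q.erase q,
        (1 / (q' : ℝ)) * modSum w z (4 * #I) (q * i.1 - q' * i.2)) := by
        rw [sum_comm, mul_sum, mul_sum]
        refine sum_congr rfl fun q' _ => ?_
        rw [← mul_sum]; ring
    _ ≤ (piK w z 1)⁻¹ * ((1 / (#I : ℝ)) * ∑ i ∈ I,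
        (∑ q ∈ Q, 1 / (q : ℝ) + (32 * k / Real.log X) * modErr w κ)) := by
        gcongr with i hi
        exact h2 i hi
    _ = _ := by
        rw [sum_const, nsmul_eq_mul]
        field_simp

/-- Weighted number of classes through `v`. -/
noncomputable def _root_.degSum (w z : ℕ) (U : Finset ℤ) (Q : Finset ℕ) (b : ℕ → ℕ) (v : ℤ) : ℝ :=
  ∑ q ∈ Q, (1 / (q : ℝ)) * lam w z b (cls U q (v % q))

theorem avg_degSum_sq_le (S : SieveSetup w z X Y κ k Y0 U Q) {v : ℤ} (hv : v ∈ U) (b : ℕ → ℕ) :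
    avg (primesIoc w z) (fun b => degSum w z U Q b v ^ 2) b ≤
      (∑ q ∈ Q, 1 / (q : ℝ)) * ((piK w z 1)⁻¹ * (∑ q ∈ Q, 1 / (q : ℝ) +
        (32 * k / Real.log X) * modErr w κ) + (piK w z (κ + 1))⁻¹ / X) := by
  have hw := S.le_w
  have hX0 : (0 : ℝ) < X := by exact_mod_cast (by have := S.ten_le; omega : 0 < X)
  have h1 : ∀ b, degSum w z U Q b v ^ 2 = ∑ q ∈ Q, (1 / (q : ℝ)) * ((1 / (q : ℝ)) *
      (lam w z b (cls U q (v % q)) * lam w z b (cls U q (v % q))) +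
      ∑ q' ∈ Q.erase q, (1 / (q' : ℝ)) *
        (lam w z b (cls U q (v % q)) * lam w z b (cls U q' (v % q')))) := by
    intro b
    rw [sq, degSum, sum_mul]
    refine sum_congr rfl fun q hq => ?_
    rw [mul_sum, ← add_sum_erase _ _ hq, mul_add, mul_sum]
    congr 1
    · ring
    · exact sum_congr rfl fun q' _ => by ring
  simp only [h1]
  rw [avg_sum, sum_mul]
  refine sum_le_sum fun q hq => ?_
  rw [avg_const_mul]
  have hqX : (X : ℝ) ≤ q := by exact_mod_cast (S.mem_Q q hq).2.1.le
  gcongr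
  rw [avg_add, avg_const_mul, avg_sum, add_comm]
  refine add_le_add ?_ ?_
  · refine le_trans (le_of_eq ?_) (S.sum_avg_lam_mul_le hq hv b)
    exact sum_congr rfl fun q' _ => avg_const_mul ..
  · rw [avg_lam_sq b (S.four_mul_card_cls_le hq _) fun p hp => S.resCard_cls hq _ hp,
      div_eq_mul_one_div _ (X : ℝ), mul_comm (1 / (q : ℝ))]
    have h4 : 4 * (κ + 1) ≤ w := by nlinarith
    have h5 := piK_pos (z := z) h4
    have h6 := piK_anti (z := z) (S.card_cls_le hq (v % q)) h4
    exact mul_le_mul (inv_anti₀ h5 h6) (one_div_le_one_div_of_le hX0 hqX) (by positivity)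
      (by positivity)

theorem avg_deviation_le (S : SieveSetup w z X Y κ k Y0 U Q) {v : ℤ} (hv : v ∈ U) (b : ℕ → ℕ) :
    avg (primesIoc w z) (fun b => survInd (primesIoc w z) b {v} *
      (degSum w z U Q b v - (∑ q ∈ Q, 1 / (q : ℝ)) * (piK w z 1)⁻¹) ^ 2) b ≤
      (∑ q ∈ Q, 1 / (q : ℝ)) * ((piK w z 1)⁻¹ * ((32 * k / Real.log X) * modErr w κ) +
        (piK w z (κ + 1))⁻¹ / X) := by
  have hw := S.le_w
  have hκ := S.one_le
  set W := ∑ q ∈ Q, 1 / (q : ℝ)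
  set σ := piK w z 1 with hσ
  have hσ0 : 0 < σ := piK_pos (by nlinarith)
  have h1 : ∀ b, survInd (primesIoc w z) b {v} * degSum w z U Q b v = degSum w z U Q b v := by
    intro b
    rw [degSum, mul_sum]
    refine sum_congr rfl fun q hq => ?_
    rw [lam, ← mul_div_assoc, ← mul_div_assoc, mul_left_comm, survInd_mul_of_subset]
    rw [singleton_subset_iff]
    exact mem_cls.2 ⟨hv, rfl⟩
  have h2 : ∀ b, survInd (primesIoc w z) b {v} * (degSum w z U Q b v - W * σ⁻¹) ^ 2 =
      degSum w z U Q b v ^ 2 + ((-2 * (W * σ⁻¹)) * degSum w z U Q b v +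
        (W * σ⁻¹) ^ 2 * survInd (primesIoc w z) b {v}) := by
    intro b
    linear_combination (degSum w z U Q b v - 2 * (W * σ⁻¹)) * h1 b
  simp only [h2]
  rw [avg_add, avg_add, avg_const_mul, avg_const_mul, avg_survInd_primesIoc]
  have h3 : avg (primesIoc w z) (fun b => degSum w z U Q b v) b = W := by
    simp only [degSum]
    rw [avg_sum]
    refine sum_congr rfl fun q hq => ?_
    rw [avg_const_mul, avg_lam b (S.four_mul_card_cls_le hq _) fun p hp => S.resCard_cls hq _ hp, mul_one]
  have h4 : ∏ p ∈ (Ioc w z).filter Nat.Prime, (1 - (resCard {v} p : ℝ) / p) = σ := by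
    simp [hσ, piK, resCard]
  rw [h3, h4]
  have h5 := S.avg_degSum_sq_le hv b
  have h6 : (W * σ⁻¹) ^ 2 * σ = W * σ⁻¹ * W := by field_simp
  rw [h6]
  nlinarith

end SieveSetup

/-- Total normalised weight of the residue classes modulo `q`. -/
noncomputable def normSum (w z : ℕ) (U : Finset ℤ) (q : ℕ) (b : ℕ → ℕ) : ℝ :=
  ∑ r ∈ Ico (0 : ℤ) q, lam w z b (cls U q r)

namespace SieveSetup

variable {w z X Y κ k : ℕ} {Y0 : ℤ} {U : Finset ℤ} {Q : Finset ℕ}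

theorem ediv_mem (S : SieveSetup w z X Y κ k Y0 U Q) {q : ℕ} (hq : q ∈ Q) {u : ℤ} (hu : u ∈ U) :
    u / (q : ℤ) ∈ Icc (Y0 / (q : ℤ)) (Y0 / (q : ℤ) + κ) := by
  have hqQ := S.mem_Q q hq
  have hq0 : (0 : ℤ) < q := by exact_mod_cast hqQ.1.pos
  have h1 := S.mem_U u hu
  have h3 : (Y : ℤ) ≤ κ * X := by exact_mod_cast S.Y_le
  have h4 : (X : ℤ) < q := by exact_mod_cast hqQ.2.1
  rw [mem_Icc]
  refine ⟨Int.ediv_le_ediv hq0 h1.1, ?_⟩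
  rw [← Int.add_mul_ediv_right _ _ hq0.ne']
  refine Int.ediv_le_ediv hq0 ?_
  nlinarith

theorem card_cls_add_card_cls_le' (S : SieveSetup w z X Y κ k Y0 U Q) {q : ℕ} (hq : q ∈ Q)
    {r r' : ℤ} (hne : r ≠ r') {p : ℕ} (hp : p ∈ (Ioc w z).filter Nat.Prime) :
    #(cls U q r) + #(cls U q r') ≤ resCard (cls U q r ∪ cls U q r') p + 0 +
      #((Icc (Y0 / (q : ℤ)) (Y0 / (q : ℤ) + κ) ×ˢ Icc (Y0 / (q : ℤ)) (Y0 / (q : ℤ) + κ)).filter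
        fun i => (p : ℤ) ∣ r - r' + q * (i.1 - i.2)) := by
  have hinter : #(cls U q r ∩ cls U q r') ≤ 0 := by
    rw [Nat.le_zero, card_eq_zero, eq_empty_iff_forall_notMem]
    intro a ha
    rw [mem_inter, mem_cls, mem_cls] at ha
    exact hne (ha.1.2.symm.trans ha.2.2)
  have form : ∀ r, ∀ a ∈ cls U q r, a = q * (a / q) + r := by
    intro r a ha
    rw [← (mem_cls.1 ha).2, Int.mul_ediv_add_emod]
  refine (card_add_card_le_resCard (S.resCard_cls hq _ hp) (S.resCard_cls hq _ hp)).trans ?_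
  refine Nat.add_le_add (Nat.add_le_add_left hinter _) ?_
  refine card_le_card_of_injOn (fun u : ℤ × ℤ => (u.1 / (q : ℤ), u.2 / (q : ℤ)))
    (fun u hu => ?_) fun u hu u' hu' h => ?_
  · simp only [coe_filter, Set.mem_ofPred_eq, mem_product] at hu ⊢
    obtain ⟨⟨hu1, hu2⟩, -, hud⟩ := hu
    refine ⟨⟨S.ediv_mem hq (mem_cls.1 hu1).1, S.ediv_mem hq (mem_cls.1 hu2).1⟩, ?_⟩
    rw [form r u.1 hu1, form r' u.2 hu2] at hud
    convert hud using 1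
    ring
  · simp only [coe_filter, Set.mem_ofPred_eq, mem_product] at hu hu'
    simp only [Prod.mk.injEq] at h
    refine Prod.ext ?_ ?_
    · rw [form r u.1 hu.1.1, form r u'.1 hu'.1.1, h.1]
    · rw [form r' u.2 hu.1.2, form r' u'.2 hu'.1.2, h.2]

theorem card_le_of_dvd (S : SieveSetup w z X Y κ k Y0 U Q) {q : ℕ} (hq : q ∈ Q) {r h : ℤ}
    (hr : r ∈ Ico (0 : ℤ) q) (hh : |h| ≤ κ) {T : Finset ℕ}
    (hT : T ⊆ (Ioc w z).filter Nat.Prime) :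
    ∑ r' ∈ (Ico (0 : ℤ) q).erase r with (∀ p ∈ T, (p : ℤ) ∣ r - r' + q * h), (1 : ℝ) ≤
      2 * q * ((1 + Real.log (∏ p ∈ T, p : ℕ)) ^ 4 / (∏ p ∈ T, p : ℕ)) := by
  set D := ∏ p ∈ T, p with hD
  set R := ((Ico (0 : ℤ) q).erase r).filter fun r' : ℤ => ∀ p ∈ T, (p : ℤ) ∣ r - r' + q * h with hR
  have hlog := S.log_pos
  have hTp : ∀ p ∈ T, w < p ∧ p.Prime := fun p hp => mem_primes_lt (hT hp)
  have hD1 : 1 ≤ D := prod_pos fun p hp => (hTp p hp).2.pos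
  have hD1' : (1 : ℝ) ≤ D := by exact_mod_cast hD1
  have hlD : 0 ≤ Real.log D := Real.log_natCast_nonneg D
  have hqQ := S.mem_Q q hq
  have hq0 : (0 : ℤ) < q := by exact_mod_cast hqQ.1.pos
  have hqR : (0 : ℝ) < q := by exact_mod_cast hqQ.1.pos
  have hqX : (X : ℝ) ≤ q := by exact_mod_cast hqQ.2.1.le
  have hX0 : (0 : ℝ) < X := by exact_mod_cast (by have := S.ten_le; omega : 0 < X)
  rw [mem_Ico] at hr
  rw [sum_const, nsmul_eq_mul, mul_one]
  have hRmem : ∀ r' ∈ R, r' ≠ r ∧ (0 ≤ r' ∧ r' < q) ∧ (D : ℤ) ∣ r - r' + q * h := by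
    intro r' hr'
    rw [hR, mem_filter, mem_erase, mem_Ico] at hr'
    exact ⟨hr'.1.1, hr'.1.2, prod_dvd_of_forall_dvd (fun p hp => (hTp p hp).2) hr'.2⟩
  have hmod : ∀ r' ∈ R, ∀ r'' ∈ R, (D : ℤ) ∣ r' - r'' := by
    intro r' hr' r'' hr''
    have := dvd_sub (hRmem r'' hr'').2.2 (hRmem r' hr').2.2
    rwa [show r - r'' + q * h - (r - r' + q * h) = r' - r'' by ring] at this
  rcases R.eq_empty_or_nonempty with hemp | ⟨r1, hr1⟩
  · rw [hemp, card_empty, Nat.cast_zero]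
    positivity
  rcases le_or_gt D q with hDq | hDq
  · have h1 : (#(R.image fun r' : ℤ => (r' + q + 1).toNat) : ℝ) ≤ q / D + 1 := by
      refine card_le_of_modEq q D _ (fun a ha => ?_) fun a ha a' ha' => ?_
      · obtain ⟨r', hr', rfl⟩ := mem_image.1 ha
        have := (hRmem r' hr').2.1
        omega
      · obtain ⟨r', hr', rfl⟩ := mem_image.1 ha
        obtain ⟨r'', hr'', rfl⟩ := mem_image.1 ha'
        have := (hRmem r' hr').2.1
        have := (hRmem r'' hr'').2.1
        rw [Nat.modEq_iff_dvd, Int.toNat_of_nonneg (by omega), Int.toNat_of_nonneg (by omega)]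
        have := hmod r'' hr'' r' hr'
        rwa [show r'' + q + 1 - (r' + q + 1) = r'' - r' by ring]
    rw [card_image_of_injOn] at h1
    · refine h1.trans ?_
      have h2 : (1 : ℝ) ≤ q / D := by
        rw [one_le_div (by linarith)]; exact_mod_cast hDq
      have h3 : (1 : ℝ) ≤ (1 + Real.log D) ^ 4 := one_le_pow₀ (by linarith)
      calc (q : ℝ) / D + 1 ≤ 2 * (q / D) * 1 := by linarith
        _ ≤ 2 * (q / D) * (1 + Real.log D) ^ 4 := by gcongr
        _ = _ := by ring
    · intro r' hr' r'' hr'' h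
      have := (hRmem r' hr').2.1
      have := (hRmem r'' hr'').2.1
      simp only at h
      omega
  · have h1 : #R ≤ 1 := by
      rw [card_le_one]
      intro a ha a' ha'
      refine sub_eq_zero.1 (Int.eq_zero_of_abs_lt_dvd (hmod a ha a' ha') ?_)
      have := (hRmem a ha).2.1
      have := (hRmem a' ha').2.1
      rw [abs_lt]
      constructor <;> omega
    obtain ⟨hne, hb, hd⟩ := hRmem r1 hr1
    have hm0 : r - r1 + q * h ≠ 0 := by
      intro h0
      have h2 : (q : ℤ) ∣ r - r1 := ⟨-h, by linarith⟩
      have h3 := Int.eq_zero_of_abs_lt_dvd h2 (by rw [abs_lt]; constructor <;> linarith)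
      exact hne (by linarith)
    have h2 := le_abs_of_prod_dvd hd hm0
    have h3 : |r - r1 + q * h| ≤ q * (κ + 1) := by
      have e1 : |r - r1| ≤ q := by rw [abs_le]; constructor <;> linarith
      calc |r - r1 + q * h| ≤ |r - r1| + |q * h| := abs_add_le _ _
        _ = |r - r1| + q * |h| := by rw [abs_mul, Nat.abs_cast]
        _ ≤ q + q * κ := by gcongr
        _ = _ := by ring
    have h4 : (D : ℝ) ≤ q * (κ + 1) := by exact_mod_cast h2.trans h3
    have h5 : ((κ : ℝ) + 1) ≤ (1 + Real.log D) ^ 4 := by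
      have e1 := S.log_le
      have e2 : (1 : ℝ) ≤ κ := by exact_mod_cast S.one_le
      have e3 : (1 : ℝ) ≤ 2 ^ k := one_le_pow₀ (by norm_num)
      have e4 : Real.log X ≤ Real.log D := by
        apply Real.log_le_log hX0
        have : (q : ℝ) < D := by exact_mod_cast hDq
        linarith
      calc (κ : ℝ) + 1 ≤ 2 * κ * 2 ^ k := by nlinarith
        _ ≤ Real.log X ^ 2 := e1
        _ ≤ (1 + Real.log D) ^ 2 := by gcongr; linarith
        _ ≤ (1 + Real.log D) ^ 4 := pow_le_pow_right₀ (by linarith) (by norm_num)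
    calc (#R : ℝ) ≤ 1 := by exact_mod_cast h1
      _ ≤ q * (κ + 1) / D := by rw [one_le_div (by linarith)]; exact h4
      _ ≤ 2 * q * (1 + Real.log D) ^ 4 / D := by
          gcongr
          linarith
      _ = _ := by ring

theorem sum_avg_lam_mul_le' (S : SieveSetup w z X Y κ k Y0 U Q) {q : ℕ} (hq : q ∈ Q) {r : ℤ}
    (hr : r ∈ Ico (0 : ℤ) q) (b : ℕ → ℕ) :
    ∑ r' ∈ (Ico (0 : ℤ) q).erase r, avg (primesIoc w z)
      (fun b => lam w z b (cls U q r) * lam w z b (cls U q r')) b ≤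
      q + 2 * q * modErr w κ := by
  have hw := S.le_w
  have hw1 : 1 ≤ w := by have := S.kappa_lt; omega
  set H := Icc (Y0 / (q : ℤ)) (Y0 / (q : ℤ) + κ) with hH
  have hHc : #H = κ + 1 := by rw [hH, Int.card_Icc]; omega
  set I := H ×ˢ H with hI
  have hIc : #I = (κ + 1) ^ 2 := by rw [hI, card_product, hHc]; ring
  have hIne : I.Nonempty := by rw [← card_pos, hIc]; positivity
  have hIc0 : (0 : ℝ) < #I := by exact_mod_cast hIne.card_pos
  have h1 : ∀ r' ∈ (Ico (0 : ℤ) q).erase r, avg (primesIoc w z)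
      (fun b => lam w z b (cls U q r) * lam w z b (cls U q r')) b ≤
      (1 / (#I : ℝ)) * ∑ i ∈ I, modSum w z (4 * #I) (r - r' + q * (i.1 - i.2)) := by
    intro r' hr'
    rw [mem_erase] at hr'
    have := avg_lam_mul_le b (S.four_mul_card_cls_le hq r) (S.four_mul_card_cls_le hq r') 0
      (Or.inl rfl) I hIne (fun i => r - r' + q * (i.1 - i.2)) (by rw [hIc]; nlinarith) fun p hp =>
        S.card_cls_add_card_cls_le' hq (Ne.symm hr'.1) hp
    rwa [piK_zero, inv_one, one_mul] at this
  have h2 : ∀ i ∈ I, ∑ r' ∈ (Ico (0 : ℤ) q).erase r,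
      modSum w z (4 * #I) (r - r' + q * (i.1 - i.2)) ≤ q + 2 * q * modErr w κ := by
    intro i hi
    rw [hI, mem_product, hH, mem_Icc, mem_Icc] at hi
    have h3 := sum_mul_modSum_le (κ := κ) (z := z) hw1 ((Ico (0 : ℤ) q).erase r) (fun _ => 1)
      (fun r' => r - r' + q * (i.1 - i.2)) (4 * #I) (2 * q) (by positivity)
      (by rw [hIc]; push_cast; nlinarith [(Nat.cast_nonneg κ : (0 : ℝ) ≤ κ)]) (by positivity)
      fun T hT _ => S.card_le_of_dvd hq hr (by rw [abs_le]; constructor <;> linarith [hi.1.1, hi.1.2, hi.2.1, hi.2.2]) hT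
    simp only [one_mul] at h3
    refine h3.trans ?_
    gcongr
    calc ∑ r' ∈ (Ico (0 : ℤ) q).erase r, (1 : ℝ) ≤ ∑ r' ∈ Ico (0 : ℤ) q, (1 : ℝ) :=
          sum_le_sum_of_subset_of_nonneg (erase_subset _ _) fun _ _ _ => by norm_num
      _ = q := by simp
  calc _ ≤ ∑ r' ∈ (Ico (0 : ℤ) q).erase r, ((1 / (#I : ℝ)) *
        ∑ i ∈ I, modSum w z (4 * #I) (r - r' + q * (i.1 - i.2))) := sum_le_sum h1
    _ = (1 / (#I : ℝ)) * ∑ i ∈ I, ∑ r' ∈ (Ico (0 : ℤ) q).erase r,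
        modSum w z (4 * #I) (r - r' + q * (i.1 - i.2)) := by
        rw [sum_comm, mul_sum]
    _ ≤ (1 / (#I : ℝ)) * ∑ i ∈ I, (q + 2 * q * modErr w κ) := by
        gcongr with i hi
        exact h2 i hi
    _ = _ := by
        rw [sum_const, nsmul_eq_mul]
        field_simp

theorem avg_normSum_deviation_le (S : SieveSetup w z X Y κ k Y0 U Q) {q : ℕ} (hq : q ∈ Q)
    (b : ℕ → ℕ) :
    avg (primesIoc w z) (fun b => (normSum w z U q b - q) ^ 2) b ≤
      q * (piK w z (κ + 1))⁻¹ + 2 * (q : ℝ) ^ 2 * modErr w κ := by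
  have hw := S.le_w
  have h4 : 4 * (κ + 1) ≤ w := by nlinarith
  have h5 := piK_pos (z := z) h4
  have h0 : avg (primesIoc w z) (normSum w z U q) b = q := by
    unfold normSum
    rw [avg_sum, sum_congr rfl fun r _ => avg_lam b (S.four_mul_card_cls_le hq r) fun p hp => S.resCard_cls hq _ hp]
    simp
  have h1 : ∀ b, (normSum w z U q b - q) ^ 2 = ∑ r ∈ Ico (0 : ℤ) q,
      (lam w z b (cls U q r) * lam w z b (cls U q r) + ∑ r' ∈ (Ico (0 : ℤ) q).erase r,
        lam w z b (cls U q r) * lam w z b (cls U q r')) +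
      ((-2 * q) * normSum w z U q b + (q : ℝ) ^ 2) := by
    intro b
    have : normSum w z U q b * normSum w z U q b = ∑ r ∈ Ico (0 : ℤ) q,
      (lam w z b (cls U q r) * lam w z b (cls U q r) + ∑ r' ∈ (Ico (0 : ℤ) q).erase r,
        lam w z b (cls U q r) * lam w z b (cls U q r')) := by
      conv_lhs => rw [normSum]
      rw [sum_mul]
      refine sum_congr rfl fun r hr => ?_
      rw [mul_sum, ← add_sum_erase _ _ hr]
    rw [← this]
    ring
  simp only [h1]
  rw [avg_add, avg_add, avg_const_mul, avg_const pos_of_mem_primesIoc, h0, avg_sum]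
  have h2 : ∀ r ∈ Ico (0 : ℤ) q, avg (primesIoc w z) (fun b =>
      lam w z b (cls U q r) * lam w z b (cls U q r) + ∑ r' ∈ (Ico (0 : ℤ) q).erase r,
        lam w z b (cls U q r) * lam w z b (cls U q r')) b ≤
      (piK w z (κ + 1))⁻¹ + (q + 2 * q * modErr w κ) := by
    intro r hr
    rw [avg_add, avg_sum, avg_lam_sq b (S.four_mul_card_cls_le hq _) fun p hp => S.resCard_cls hq _ hp]
    exact add_le_add (inv_anti₀ h5 (piK_anti (S.card_cls_le hq r) h4)) (S.sum_avg_lam_mul_le' hq hr b)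
  have h3 := sum_le_sum h2
  rw [sum_const, nsmul_eq_mul, Int.card_Ico] at h3
  simp only [sub_zero, Int.toNat_natCast] at h3
  nlinarith

end SieveSetup

open Classical in
/-- Moduli whose total weight is at most `11 / 10` of its mean. -/
noncomputable def goodMod (w z : ℕ) (U : Finset ℤ) (Q : Finset ℕ) (b : ℕ → ℕ) : Finset ℕ :=
  Q.filter fun q => normSum w z U q b ≤ 11 / 10 * q

open Classical in
/-- Survivors covered with too little weight. -/
noncomputable def badSet (w z : ℕ) (U : Finset ℤ) (Q : Finset ℕ) (τ : ℝ) (b : ℕ → ℕ) : Finset ℤ :=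
  U.filter fun v => Surv (primesIoc w z) b v ∧ degSum w z U (goodMod w z U Q b) b v <
    (1 - 2 * τ) * ((∑ q ∈ Q, 1 / (q : ℝ)) * (piK w z 1)⁻¹)

theorem survInd_singleton {l : List ℕ} {b : ℕ → ℕ} {v : ℤ} (h : Surv l b v) :
    survInd l b {v} = 1 := by
  simp [survInd, h]

namespace SieveSetup

variable {w z X Y κ k : ℕ} {Y0 : ℤ} {U : Finset ℤ} {Q : Finset ℕ}

theorem card_cls_le_div (S : SieveSetup w z X Y κ k Y0 U Q) {q : ℕ} (hq : q ∈ Q) (hqY : q ≤ Y) (r : ℤ) :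
    (#(cls U q r) : ℝ) ≤ 3 * Y / q := by
  have hqQ := S.mem_Q q hq
  have hq0 : (0 : ℤ) < q := by exact_mod_cast hqQ.1.pos
  have hqR : (0 : ℝ) < q := by exact_mod_cast hqQ.1.pos
  have h : #(cls U q r) ≤ #(Icc (Y0 / (q : ℤ)) (Y0 / (q : ℤ) + ((Y / q : ℕ) + 1))) := by
    refine card_le_card_of_injOn (fun u => u / (q : ℤ)) (fun u hu => ?_) fun u hu u' hu' h => ?_
    · have h1 := S.mem_U u (mem_cls.1 hu).1
      rw [coe_Icc]
      refine ⟨Int.ediv_le_ediv hq0 h1.1, ?_⟩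
      rw [← Int.add_mul_ediv_right _ _ hq0.ne']
      refine Int.ediv_le_ediv hq0 ?_
      have h2 : (Y : ℤ) < (((Y / q : ℕ) : ℤ) + 1) * q := by
        have := Nat.lt_mul_div_succ Y hqQ.1.pos
        rw [mul_comm] at this
        exact_mod_cast this
      linarith
    · have h1 := (mem_cls.1 hu).2
      have h2 := (mem_cls.1 hu').2
      simp only at h
      rw [← Int.mul_ediv_add_emod u q, ← Int.mul_ediv_add_emod u' q, h, h1, h2]
  have h2 : #(cls U q r) ≤ Y / q + 2 := by
    refine h.trans (le_of_eq ?_)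
    rw [Int.card_Icc]
    generalize Y / q = g
    omega
  have h3 : (1 : ℝ) ≤ Y / q := by rw [one_le_div hqR]; exact_mod_cast hqY
  have h4 : ((Y / q : ℕ) : ℝ) ≤ Y / q := Nat.cast_div_le
  have h5 : (#(cls U q r) : ℝ) ≤ (Y / q : ℕ) + 2 := by exact_mod_cast h2
  rw [mul_div_assoc]
  linarith

theorem sum_lam_le (S : SieveSetup w z X Y κ k Y0 U Q) {q : ℕ} (hq : q ∈ Q) (hqY : q ≤ Y) (b : ℕ → ℕ) :
    ∑ v ∈ U, lam w z b (cls U q (v % q)) ≤ 3 * Y / q * normSum w z U q b := by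
  have hqQ := S.mem_Q q hq
  have hq0 : (0 : ℤ) < q := by exact_mod_cast hqQ.1.pos
  have hmaps : ∀ v ∈ U, v % (q : ℤ) ∈ Ico (0 : ℤ) q := fun v _ =>
    mem_Ico.2 ⟨Int.emod_nonneg v hq0.ne', Int.emod_lt_of_pos v hq0⟩
  rw [← sum_fiberwise_of_maps_to hmaps, normSum, mul_sum]
  refine sum_le_sum fun r _ => ?_
  rw [sum_congr rfl fun v hv => by rw [(mem_filter.1 hv).2], sum_const, nsmul_eq_mul]
  exact mul_le_mul_of_nonneg_right (S.card_cls_le_div hq hqY r)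
    (lam_nonneg b (S.four_mul_card_cls_le hq r))

theorem normSum_nonneg (S : SieveSetup w z X Y κ k Y0 U Q) {q : ℕ} (hq : q ∈ Q) (b : ℕ → ℕ) :
    0 ≤ normSum w z U q b :=
  sum_nonneg fun r _ => lam_nonneg b (S.four_mul_card_cls_le hq r)

theorem avg_sum_loss_le (S : SieveSetup w z X Y κ k Y0 U Q) (hQY : ∀ q ∈ Q, q ≤ Y) (b : ℕ → ℕ) :
    avg (primesIoc w z) (fun b => ∑ v ∈ U, (degSum w z U Q b v -
      degSum w z U (goodMod w z U Q b) b v)) b ≤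
      330 * Y * (∑ q ∈ Q, 1 / (q : ℝ)) * ((piK w z (κ + 1))⁻¹ / X + 2 * modErr w κ) := by
  classical
  have hX0 : (0 : ℝ) < X := by exact_mod_cast (by have := S.ten_le; omega : 0 < X)
  have hqpos : ∀ q ∈ Q, (0 : ℝ) < q := fun q hq => by exact_mod_cast (S.mem_Q q hq).1.pos
  have hpi : 0 < piK w z (κ + 1) := piK_pos (by have := S.le_w; nlinarith)
  have h1 : ∀ b, ∑ v ∈ U, (degSum w z U Q b v - degSum w z U (goodMod w z U Q b) b v) ≤
      ∑ q ∈ Q, (330 * Y / (q : ℝ) ^ 3) * (normSum w z U q b - q) ^ 2 := by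
    intro b
    have h2 : ∀ v, degSum w z U Q b v - degSum w z U (goodMod w z U Q b) b v =
        ∑ q ∈ Q with ¬ normSum w z U q b ≤ 11 / 10 * q, 1 / (q : ℝ) * lam w z b (cls U q (v % q)) := by
      intro v
      rw [degSum, degSum, goodMod, ← sum_filter_add_sum_filter_not Q (fun q : ℕ => normSum w z U q b ≤ 11 / 10 * q)]
      ring
    simp only [h2]
    rw [sum_comm, sum_filter]
    refine sum_le_sum fun q hq => ?_
    have hq0 := hqpos q hq
    have hN := S.normSum_nonneg hq b
    split_ifs with h
    · positivity
    · rw [← mul_sum]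
      refine (mul_le_mul_of_nonneg_left (S.sum_lam_le hq (hQY q hq) b) (by positivity)).trans ?_
      have h3 : (q : ℝ) * normSum w z U q b ≤ 110 * (normSum w z U q b - q) ^ 2 := by
        push Not at h
        nlinarith
      calc 1 / (q : ℝ) * (3 * Y / q * normSum w z U q b)
          = 3 * Y / (q : ℝ) ^ 3 * (q * normSum w z U q b) := by field_simp
        _ ≤ 3 * Y / (q : ℝ) ^ 3 * (110 * (normSum w z U q b - q) ^ 2) := by gcongr
        _ = _ := by ring
  refine (avg_mono h1 b).trans ?_
  rw [avg_sum, mul_sum, sum_mul]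
  refine sum_le_sum fun q hq => ?_
  have hq0 := hqpos q hq
  have hqX : (X : ℝ) ≤ q := by exact_mod_cast (S.mem_Q q hq).2.1.le
  rw [avg_const_mul]
  calc _ ≤ 330 * Y / (q : ℝ) ^ 3 * (q * (piK w z (κ + 1))⁻¹ + 2 * (q : ℝ) ^ 2 * modErr w κ) := by
        gcongr
        exact S.avg_normSum_deviation_le hq b
    _ = 330 * Y * (1 / q) * ((piK w z (κ + 1))⁻¹ / q + 2 * modErr w κ) := by field_simp
    _ ≤ _ := by gcongr

theorem avg_card_badSet_le (S : SieveSetup w z X Y κ k Y0 U Q) (hQY : ∀ q ∈ Q, q ≤ Y)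
    (hne : Q.Nonempty) {τ : ℝ} (hτ : 0 < τ) (b : ℕ → ℕ) :
    avg (primesIoc w z) (fun b => (#(badSet w z U Q τ b) : ℝ)) b ≤
      piK w z 1 * (#U / (τ ^ 2 * ∑ q ∈ Q, 1 / (q : ℝ)) * (32 * k / Real.log X * modErr w κ +
        piK w z 1 * (piK w z (κ + 1))⁻¹ / X) +
        330 * Y / τ * ((piK w z (κ + 1))⁻¹ / X + 2 * modErr w κ)) := by
  classical
  have hκ := S.one_le
  have hqpos : ∀ q ∈ Q, (0 : ℝ) < q := fun q hq => by exact_mod_cast (S.mem_Q q hq).1.pos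
  set W := ∑ q ∈ Q, 1 / (q : ℝ) with hW
  set σ := piK w z 1 with hσ
  have hW0 : 0 < W := sum_pos (fun q hq => by have := hqpos q hq; positivity) hne
  have hσ0 : 0 < σ := piK_pos (by have := S.le_w; nlinarith)
  set t := τ * (W * σ⁻¹) with ht
  have ht0 : 0 < t := by positivity
  have hloss : ∀ b v, 0 ≤ degSum w z U Q b v - degSum w z U (goodMod w z U Q b) b v := by
    intro b v
    rw [sub_nonneg]
    refine sum_le_sum_of_subset_of_nonneg (filter_subset _ _) fun q hq _ => ?_
    exact mul_nonneg (by positivity) (lam_nonneg b (S.four_mul_card_cls_le hq _))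
  have h1 : ∀ b, (#(badSet w z U Q τ b) : ℝ) ≤
      (1 / t ^ 2) * ∑ v ∈ U, survInd (primesIoc w z) b {v} * (degSum w z U Q b v - W * σ⁻¹) ^ 2 +
      (1 / t) * ∑ v ∈ U, (degSum w z U Q b v - degSum w z U (goodMod w z U Q b) b v) := by
    intro b
    rw [badSet, card_filter, mul_sum, mul_sum, ← sum_add_distrib, Nat.cast_sum]
    refine sum_le_sum fun v _ => ?_
    have h2 := hloss b v
    have h3 := survInd_nonneg (primesIoc w z) b {v}
    split_ifs with h
    · rw [survInd_singleton h.1, one_mul, Nat.cast_one]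
      rcases le_or_gt t (degSum w z U Q b v - degSum w z U (goodMod w z U Q b) b v) with h4 | h4
      · have h5 : 1 ≤ 1 / t * (degSum w z U Q b v - degSum w z U (goodMod w z U Q b) b v) := by
          rw [one_div_mul_eq_div, one_le_div ht0]; exact h4
        have : 0 ≤ 1 / t ^ 2 * (degSum w z U Q b v - W * σ⁻¹) ^ 2 := by positivity
        linarith
      · have h5 : 1 ≤ 1 / t ^ 2 * (degSum w z U Q b v - W * σ⁻¹) ^ 2 := by
          rw [one_div_mul_eq_div, one_le_div (by positivity), ← sq_abs (degSum w z U Q b v - W * σ⁻¹)]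
          gcongr
          rw [abs_sub_comm]
          refine le_trans ?_ (le_abs_self _)
          have := h.2
          linarith
        have : 0 ≤ 1 / t * (degSum w z U Q b v - degSum w z U (goodMod w z U Q b) b v) := by positivity
        linarith
    · have : 0 ≤ 1 / t * (degSum w z U Q b v - degSum w z U (goodMod w z U Q b) b v) := by positivity
      have : 0 ≤ 1 / t ^ 2 * (survInd (primesIoc w z) b {v} * (degSum w z U Q b v - W * σ⁻¹) ^ 2) := by
        positivity
      push_cast
      linarith
  refine (avg_mono h1 b).trans ?_
  rw [avg_add, avg_const_mul, avg_const_mul, avg_sum]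
  have h2 := sum_le_sum fun v hv => S.avg_deviation_le (v := v) hv b
  rw [sum_const, nsmul_eq_mul] at h2
  have h3 := S.avg_sum_loss_le hQY b
  rw [← hW] at h3
  calc _ ≤ 1 / t ^ 2 * (#U * (W * (σ⁻¹ * (32 * k / Real.log X * modErr w κ) + (piK w z (κ + 1))⁻¹ / X))) +
        1 / t * (330 * Y * W * ((piK w z (κ + 1))⁻¹ / X + 2 * modErr w κ)) := by
        gcongr
    _ = _ := by
        rw [ht]
        field_simp

end SieveSetup

theorem exists_subset_sum_near {α : Type*} [DecidableEq α] (P : Finset α) (f : α → ℝ) {η t : ℝ}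
    (hf : ∀ q ∈ P, f q ≤ η) (ht : 0 ≤ t) (htP : t ≤ ∑ q ∈ P, f q) (hη : 0 ≤ η) :
    ∃ A ⊆ P, t - η ≤ ∑ q ∈ A, f q ∧ ∑ q ∈ A, f q ≤ t := by
  obtain ⟨A, hA, hmax⟩ := exists_max_image (P.powerset.filter fun A => ∑ q ∈ A, f q ≤ t) card
    ⟨∅, by simp [ht]⟩
  rw [mem_filter, mem_powerset] at hA
  refine ⟨A, hA.1, ?_, hA.2⟩
  rcases eq_or_ne A P with rfl | hne
  · linarith
  obtain ⟨q, hqP, hqA⟩ := exists_of_ssubset (hA.1.ssubset_of_ne hne)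
  by_contra! hcon
  have h1 := hmax (insert q A) (by
    rw [mem_filter, mem_powerset]
    refine ⟨insert_subset hqP hA.1, ?_⟩
    rw [sum_insert hqA]
    have := hf q hqP
    linarith)
  rw [card_insert_of_notMem hqA] at h1
  omega

theorem exists_disjoint_subsets_sum_near {α ι : Type*} [DecidableEq α] [DecidableEq ι] (J : Finset ι)
    (P : Finset α) (f : α → ℝ) {η : ℝ} (t : ι → ℝ) (hf : ∀ q ∈ P, f q ≤ η) (hη : 0 ≤ η)
    (ht : ∀ j ∈ J, 0 ≤ t j) (htP : ∑ j ∈ J, t j ≤ ∑ q ∈ P, f q) :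
    ∃ A : ι → Finset α, (∀ j, A j ⊆ P) ∧ (∀ j ∈ J, t j - η ≤ ∑ q ∈ A j, f q) ∧
      ∀ j j' q, q ∈ A j → q ∈ A j' → j = j' := by
  suffices h : ∃ A : ι → Finset α, (∀ j, A j ⊆ P) ∧ (∀ j ∉ J, A j = ∅) ∧
      (∀ j ∈ J, t j - η ≤ ∑ q ∈ A j, f q) ∧ ∀ j j' q, q ∈ A j → q ∈ A j' → j = j' by
    obtain ⟨A, h1, -, h2⟩ := h
    exact ⟨A, h1, h2⟩
  induction J using Finset.induction_on generalizing P with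
  | empty => exact ⟨fun _ => ∅, by simp, by simp, by simp, by simp⟩
  | insert i J hi ih =>
    rw [sum_insert hi] at htP
    have hJ : 0 ≤ ∑ j ∈ J, t j := sum_nonneg fun j hj => ht j (mem_insert_of_mem hj)
    obtain ⟨A0, hA0, h1, h2⟩ := exists_subset_sum_near P f hf (ht i (mem_insert_self i J))
      (by linarith) hη
    have h3 := sum_sdiff (f := f) hA0
    obtain ⟨A, hA, hAJ, hAs, hAd⟩ := ih (P \ A0) (fun q hq => hf q (Finset.mem_sdiff.1 hq).1)
      (fun j hj => ht j (mem_insert_of_mem hj)) (by linarith)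
    have hno : ∀ j q, q ∈ A0 → q ∈ A j → False := fun j q h h' => (Finset.mem_sdiff.1 (hA j h')).2 h
    refine ⟨Function.update A i A0, fun j => ?_, fun j hj => ?_, fun j hj => ?_, fun j j' q hq hq' => ?_⟩
    · rcases eq_or_ne j i with rfl | h
      · rwa [Function.update_self]
      · rw [Function.update_of_ne h]
        exact (hA j).trans sdiff_subset
    · rw [mem_insert, not_or] at hj
      rw [Function.update_of_ne hj.1, hAJ j hj.2]
    · rcases eq_or_ne j i with rfl | h
      · rwa [Function.update_self]
      · rw [Function.update_of_ne h]
        exact hAs j ((mem_insert.1 hj).resolve_left h)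
    · rcases eq_or_ne j i with h | h <;> rcases eq_or_ne j' i with h' | h'
      · rw [h, h']
      · rw [h, Function.update_self] at hq
        rw [Function.update_of_ne h'] at hq'
        exact (hno j' q hq hq').elim
      · rw [h', Function.update_self] at hq'
        rw [Function.update_of_ne h] at hq
        exact (hno j q hq' hq).elim
      · rw [Function.update_of_ne h] at hq
        rw [Function.update_of_ne h'] at hq'
        exact hAd j j' q hq hq'

theorem exists_residues {ι : Type*} [Fintype ι] {w X κ k : ι → ℕ} {z Y x m r : ℕ} {Y0 : ℤ}
    {b : ℕ → ℕ} {Q : ι → ℕ → Finset ℕ} {U : ι → Finset ℤ} {V : Finset ℤ} {C β B η τ : ℝ}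
    (S : ∀ i j, SieveSetup (w i) z (X i) Y (κ i) (k i) Y0 (U i) (Q i j))
    (hdisj : ∀ i j i' j' q, q ∈ Q i j → q ∈ Q i' j' → i = i' ∧ j = j')
    (hXX : ∀ i i', Y < X i * X i') (hx : ∀ i j, ∀ q ∈ Q i j, q ≤ x)
    (hr : ∀ i, κ i + 1 ≤ r) (hr1 : 1 ≤ r)
    (hβ : ∀ i, (piK (w i) z (κ i + 1))⁻¹ / X i ≤ β) (hβ0 : 0 < β) (hβ1 : β ≤ 1)
    (hB1 : 1 ≤ B) (hB : (x + 1 : ℕ) * β ≤ B) (hη : η ≤ 1)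
    (hC : 0 < C) (hC1 : 11 / 10 * C ≤ 1)
    (hsmall : 4 * (21 * r ^ 2 * B * Real.exp (C * m) ^ (3 * r) / (11 / 10 - 1) ^ 2) ^ 2
      * β ^ ((1 / 2 : ℝ) ^ m) ≤ η)
    (hdeg : ∀ j < m, 11 / 10 * C * Real.exp (-(C * j)) ≤ 10 / 11 * ∑ i, (1 - 2 * τ) *
      ((∑ q ∈ Q i j, 1 / (q : ℝ)) * (piK (w i) z 1)⁻¹))
    (hVU : ∀ v ∈ V, ∀ i, v ∈ U i) (hVS : ∀ v ∈ V, ∀ i, Surv (primesIoc (w i) z) b v)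
    (hVb : ∀ v ∈ V, ∀ i, ∀ j < m, v ∉ badSet (w i) z (U i) (Q i j) τ b) :
    ∃ a : ℕ → ℤ, ∃ R ⊆ V, (#R : ℝ) ≤ #V * (Real.exp (-(C * m)) + η) ∧
      ∀ v ∈ V, v ∉ R → ∃ i j, ∃ q ∈ Q i j, v % (q : ℤ) = a q := by
  classical
  -- the weight of the class `s` modulo `q`
  set lm : ℕ → ℕ → ℤ → ℝ := fun j q s => ∑ i, if q ∈ goodMod (w i) z (U i) (Q i j) b then
    lam (w i) z b (cls (U i) q s) / (11 / 10 * q) else 0 with hlm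
  have hgood : ∀ i j q, q ∈ goodMod (w i) z (U i) (Q i j) b → q ∈ Q i j := fun i j q h =>
    (mem_filter.1 h).1
  have hlm_eq : ∀ i j q s, q ∈ goodMod (w i) z (U i) (Q i j) b →
      lm j q s = lam (w i) z b (cls (U i) q s) / (11 / 10 * q) := by
    intro i j q s hq
    rw [hlm]
    simp only
    rw [sum_eq_single i, if_pos hq]
    · intro i' _ hi'
      rw [if_neg]
      intro hq'
      exact hi' (hdisj _ _ _ _ q (hgood _ _ _ hq') (hgood _ _ _ hq)).1
    · simp
  have hlm_zero : ∀ j q s, (∀ i, q ∉ goodMod (w i) z (U i) (Q i j) b) → lm j q s = 0 := by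
    intro j q s h
    exact sum_eq_zero fun i _ => if_neg (h i)
  have hlam0 : ∀ i j q s, q ∈ Q i j → 0 ≤ lam (w i) z b (cls (U i) q s) := fun i j q s hq =>
    lam_nonneg b ((S i j).four_mul_card_cls_le hq s)
  have hlm0 : ∀ j q s, 0 ≤ lm j q s := by
    intro j q s
    refine sum_nonneg fun i _ => ?_
    split_ifs with h
    · exact div_nonneg (hlam0 i j q s (hgood _ _ _ h)) (by positivity)
    · exact le_rfl
  have hlmβ : ∀ j q s, lm j q s ≤ β := by
    intro j q s
    by_cases h : ∃ i, q ∈ goodMod (w i) z (U i) (Q i j) b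
    · obtain ⟨i, hi⟩ := h
      rw [hlm_eq i j q s hi]
      refine le_trans ?_ (hβ i)
      have hq := hgood _ _ _ hi
      have hX0 : (0 : ℝ) < X i := by exact_mod_cast (by have := (S i j).ten_le; omega : 0 < X i)
      have hqX : (X i : ℝ) ≤ q := by exact_mod_cast ((S i j).mem_Q q hq).2.1.le
      have h4 : 4 * (κ i + 1) ≤ w i := by have := (S i j).le_w; nlinarith
      have h5 := piK_pos (z := z) h4
      have h6 : lam (w i) z b (cls (U i) q s) ≤ (piK (w i) z (κ i + 1))⁻¹ := by
        rw [lam]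
        calc _ ≤ 1 / piK (w i) z #(cls (U i) q s) := by
              have := piK_pos (z := z) ((S i j).four_mul_card_cls_le hq s)
              gcongr
              exact survInd_le_one _ _ _
          _ ≤ _ := by
              rw [one_div]
              exact inv_anti₀ h5 (piK_anti ((S i j).card_cls_le hq s) h4)
      have h7 := hlam0 i j q s hq
      gcongr
      linarith
    · push Not at h
      rw [hlm_zero j q s h]
      exact hβ0.le
  -- edges
  set E : ℕ → ℤ → Finset V := fun q s => univ.filter fun v : V => v.1 % (q : ℤ) = s with hE
  have hmemE : ∀ q s v, v ∈ E q s ↔ v.1 % (q : ℤ) = s := fun q s v => by simp [hE]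
  set wt : ℕ → Fin (x + 1) → Finset V → ℝ := fun j q e =>
    ∑ s ∈ Ico (0 : ℤ) (q : ℕ), if E q s = e then lm j q s else 0 with hwt
  have hsum : ∀ (P : Finset V → Prop) [DecidablePred P] (j : ℕ) (q : Fin (x + 1)),
      ∑ e, (if P e then wt j q e else 0) =
        ∑ s ∈ Ico (0 : ℤ) (q : ℕ), if P (E q s) then lm j q s else 0 := by
    intro P _ j q
    calc _ = ∑ e, ∑ s ∈ Ico (0 : ℤ) (q : ℕ), if E q s = e then (if P e then lm j q s else 0) else 0 := by
          refine sum_congr rfl fun e _ => ?_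
          split_ifs with h
          · simp [hwt]
          · simp
      _ = _ := by
          rw [sum_comm]
          refine sum_congr rfl fun s _ => ?_
          rw [sum_ite_eq]
          simp
  have hmem_res : ∀ (v : V) (q : ℕ), 0 < q → v.1 % (q : ℤ) ∈ Ico (0 : ℤ) q := fun v q hq => by
    have : (0 : ℤ) < q := by exact_mod_cast hq
    exact mem_Ico.2 ⟨Int.emod_nonneg _ this.ne', Int.emod_lt_of_pos _ this⟩
  have hlm_q0 : ∀ j s, lm j 0 s = 0 := fun j s => hlm_zero j 0 s fun i hi => by
    have := ((S i j).mem_Q 0 (hgood _ _ _ hi)).1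
    exact Nat.not_prime_zero this
  have hsum1 : ∀ (j : ℕ) (q : Fin (x + 1)) (v : V),
      ∑ e, (if v ∈ e then wt j q e else 0) = lm j q (v.1 % (q : ℕ)) := by
    intro j q v
    rw [hsum (fun e => v ∈ e)]
    simp only [hmemE]
    rcases Nat.eq_zero_or_pos (q : ℕ) with h0 | h0
    · rw [h0, hlm_q0]; simp
    · rw [sum_ite_eq, if_pos (hmem_res v q h0)]
  have hwt_ne : ∀ j (q : Fin (x + 1)) e, wt j q e ≠ 0 → ∃ i s, (q : ℕ) ∈ Q i j ∧ E q s = e := by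
    intro j q e h
    rw [hwt] at h
    obtain ⟨s, -, hs⟩ := exists_ne_zero_of_sum_ne_zero h
    by_cases hes : E q s = e
    · rw [if_pos hes] at hs
      by_contra hcon
      push Not at hcon
      exact hs (hlm_zero j q s fun i hi => hcon i s (hgood _ _ _ hi) hes)
    · rw [if_neg hes] at hs
      exact (hs rfl).elim
  have hEcls : ∀ i q s, #(E q s) ≤ #(cls (U i) q s) := by
    intro i q s
    refine card_le_card_of_injOn (fun v => v.1) (fun v hv => ?_) fun v _ v' _ h => Subtype.ext h
    exact mem_coe.2 (mem_cls.2 ⟨hVU v.1 v.2 i, (hmemE q s v).1 hv⟩)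
  obtain ⟨f, hf, hcard⟩ := nibble_cover (V := V) (κ := Fin (x + 1)) m r hr1 C (11 / 10) β B η hC
    (by norm_num) (by norm_num) hC1 hβ0 hβ1 hB1 (by rw [Fintype.card_fin]; exact hB) hη hsmall wt
    (fun j q e => sum_nonneg fun s _ => by split_ifs; exacts [hlm0 j q s, le_rfl])
    (fun j q => by
      have h1 := hsum (fun _ => True) j q
      simp only [if_true] at h1
      rw [h1]
      by_cases h : ∃ i, (q : ℕ) ∈ goodMod (w i) z (U i) (Q i j) b
      · obtain ⟨i, hi⟩ := h
        rw [sum_congr rfl fun s _ => hlm_eq i j q s hi, ← sum_div, ← normSum]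
        exact div_le_one_of_le₀ (mem_filter.1 hi).2 (by positivity)
      · push Not at h
        rw [sum_congr rfl fun s _ => hlm_zero j q s h]
        simp)
    (fun j q e h => by
      obtain ⟨i, s, hq, rfl⟩ := hwt_ne j q e h
      exact (hEcls i q s).trans (((S i j).card_cls_le hq s).trans (hr i)))
    (fun j hj v => by
      refine (hdeg j hj).trans ?_
      simp only [hsum1]
      rw [Fin.sum_univ_eq_sum_range (fun q => lm j q (v.1 % (q : ℕ))) (x + 1)]
      simp only [hlm]
      rw [sum_comm, mul_sum]
      refine sum_le_sum fun i _ => ?_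
      have h1 := hVb v.1 v.2 i j hj
      have h2 : (1 - 2 * τ) * ((∑ q ∈ Q i j, 1 / (q : ℝ)) * (piK (w i) z 1)⁻¹) ≤
          degSum (w i) z (U i) (goodMod (w i) z (U i) (Q i j) b) b v.1 := by
        by_contra! hcon
        exact h1 (mem_filter.2 ⟨hVU v.1 v.2 i, hVS v.1 v.2 i, hcon⟩)
      refine (mul_le_mul_of_nonneg_left h2 (by norm_num)).trans (le_of_eq ?_)
      rw [← sum_filter, degSum, mul_sum]
      have h3 : (range (x + 1)).filter (fun q => q ∈ goodMod (w i) z (U i) (Q i j) b) =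
          goodMod (w i) z (U i) (Q i j) b := by
        ext q
        rw [mem_filter, mem_range]
        exact ⟨fun h => h.2, fun h => ⟨Nat.lt_succ_of_le (hx i j q (hgood _ _ _ h)), h⟩⟩
      rw [h3]
      refine sum_congr rfl fun q hq => ?_
      have : (q : ℝ) ≠ 0 := by
        have := ((S i j).mem_Q q (hgood _ _ _ hq)).1.pos
        positivity
      field_simp)
    (fun j q v => by rw [hsum1]; exact hlmβ j q _)
    (fun j v v' hvv => by
      have h1 : ∀ q : Fin (x + 1), ∑ e, (if v ∈ e ∧ v' ∈ e then wt j q e else 0) =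
          if v'.1 % (q : ℕ) = v.1 % (q : ℕ) then lm j q (v.1 % (q : ℕ)) else 0 := by
        intro q
        rw [hsum (fun e => v ∈ e ∧ v' ∈ e)]
        simp only [hmemE]
        rcases Nat.eq_zero_or_pos (q : ℕ) with h0 | h0
        · rw [h0]; simp [hlm_q0]
        · rw [sum_eq_single (v.1 % (q : ℕ))]
          · simp
          · intro s _ hs
            exact if_neg fun h => hs h.1.symm
          · intro h
            exact (h (hmem_res v q h0)).elim
      simp only [h1]
      rw [← sum_filter]
      have h2 : ∀ q : Fin (x + 1), lm j q (v.1 % (q : ℕ)) ≠ 0 → ∃ i, (q : ℕ) ∈ Q i j := by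
        intro q h
        by_contra hcon
        push Not at hcon
        exact h (hlm_zero j q _ fun i hi => hcon i (hgood _ _ _ hi))
      set F := univ.filter fun q : Fin (x + 1) => v'.1 % ((q : ℕ) : ℤ) = v.1 % ((q : ℕ) : ℤ)
      have h3 : #(F.filter fun q : Fin (x + 1) => lm j q (v.1 % (q : ℕ)) ≠ 0) ≤ 1 := by
        rw [card_le_one]
        intro q hq q' hq'
        rw [mem_filter, mem_filter] at hq hq'
        obtain ⟨i, hi⟩ := h2 q hq.2
        obtain ⟨i', hi'⟩ := h2 q' hq'.2
        by_contra hne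
        have hp := (S i j).mem_Q q hi
        have hp' := (S i' j).mem_Q q' hi'
        have hcop : IsCoprime ((q : ℕ) : ℤ) ((q' : ℕ) : ℤ) := by
          rw [Nat.isCoprime_iff_coprime]
          exact (Nat.coprime_primes hp.1 hp'.1).2 fun h => hne (Fin.ext h)
        have hd : ((q : ℕ) : ℤ) ∣ v.1 - v'.1 := Int.ModEq.dvd (show v'.1 ≡ v.1 [ZMOD (q : ℕ)] from hq.1.2)
        have hd' : ((q' : ℕ) : ℤ) ∣ v.1 - v'.1 := Int.ModEq.dvd (show v'.1 ≡ v.1 [ZMOD (q' : ℕ)] from hq'.1.2)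
        have h4 : (Y : ℤ) < X i * X i' := by exact_mod_cast hXX i i'
        have h5 : (X i : ℤ) * X i' ≤ (q : ℕ) * (q' : ℕ) := by
          exact_mod_cast Nat.mul_le_mul hp.2.1.le hp'.2.1.le
        have h6 := (S i j).mem_U v.1 (hVU v.1 v.2 i)
        have h7 := (S i j).mem_U v'.1 (hVU v'.1 v'.2 i)
        refine hvv (Subtype.ext (sub_eq_zero.1 (Int.eq_zero_of_abs_lt_dvd (hcop.mul_dvd hd hd') ?_)))
        rw [abs_lt]
        constructor <;> linarith
      rw [← sum_filter_ne_zero]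
      calc _ ≤ ∑ q ∈ F.filter (fun q : Fin (x + 1) => lm j q (v.1 % (q : ℕ)) ≠ 0), β :=
            sum_le_sum fun q _ => hlmβ j q _
        _ ≤ β := by
            rw [sum_const, nsmul_eq_mul]
            have : (#(F.filter fun q : Fin (x + 1) => lm j q (v.1 % (q : ℕ)) ≠ 0) : ℝ) ≤ 1 := by exact_mod_cast h3
            nlinarith)
  have hres : ∀ q : ℕ, ∃ s : ℤ, ∀ i, ∀ j, q ∈ Q i j → ∀ hq : q < x + 1, ∀ v ∈ f j ⟨q, hq⟩,
      v.1 % (q : ℤ) = s := by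
    intro q
    by_cases h : ∃ j, ∃ hq : q < x + 1, (f j ⟨q, hq⟩).Nonempty ∧ ∃ i, q ∈ Q i j
    · obtain ⟨j, hq, hne, i, hi⟩ := h
      rcases hf j ⟨q, hq⟩ with h0 | ⟨e, he, hw⟩
      · rw [h0] at hne; exact (not_nonempty_empty hne).elim
      · obtain ⟨i', s, -, rfl⟩ := hwt_ne _ _ _ hw
        refine ⟨s, fun i'' j' h' hq' v hv => ?_⟩
        obtain rfl := (hdisj _ _ _ _ q h' hi).2
        exact (hmemE q s v).1 (he hv)
    · push Not at h
      refine ⟨0, fun i j hi hq v hv => ?_⟩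
      exact (h j hq ⟨v, hv⟩ i hi).elim
  choose a ha using hres
  set R := univ \ (range m).biUnion fun j => univ.biUnion (f j) with hR
  refine ⟨a, R.image Subtype.val, fun v hv => ?_, ?_, fun v hv hvR => ?_⟩
  · obtain ⟨u, -, rfl⟩ := mem_image.1 hv
    exact u.2
  · rw [card_image_of_injective _ Subtype.val_injective]
    exact hcard.trans_eq (by rw [Fintype.card_coe])
  · have h1 : (⟨v, hv⟩ : V) ∉ R := fun h => hvR (mem_image.2 ⟨_, h, rfl⟩)
    rw [hR, Finset.mem_sdiff, not_and_not_right] at h1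
    obtain ⟨j, -, h2⟩ := mem_biUnion.1 (h1 (mem_univ _))
    obtain ⟨q, -, h3⟩ := mem_biUnion.1 h2
    rcases hf j q with h0 | ⟨e, -, hw⟩
    · rw [h0] at h3
      exact (notMem_empty _ h3).elim
    · obtain ⟨i, -, hi, -⟩ := hwt_ne _ _ _ hw
      exact ⟨i, j, q, hi, ha q i j hi q.2 _ h3⟩

open Classical in
/-- Elements of `J` avoiding the chosen residues modulo the primes in `(u, z]`. -/
noncomputable def survSet (u z : ℕ) (J : Finset ℤ) (b : ℕ → ℕ) : Finset ℤ :=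
  J.filter fun v => Surv (primesIoc u z) b v

theorem mem_survSet {u z : ℕ} {J : Finset ℤ} {b : ℕ → ℕ} {v : ℤ} :
    v ∈ survSet u z J b ↔ v ∈ J ∧ Surv (primesIoc u z) b v := by
  classical
  unfold survSet
  exact mem_filter

theorem survSet_subset (u z : ℕ) (J : Finset ℤ) (b : ℕ → ℕ) : survSet u z J b ⊆ J :=
  fun _ hv => (mem_survSet.1 hv).1

theorem avg_card_survSet (u z : ℕ) (J : Finset ℤ) (b : ℕ → ℕ) :
    avg (primesIoc u z) (fun b => (#(survSet u z J b) : ℝ)) b = #J * piK u z 1 := by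
  have h1 : ∀ b, (#(survSet u z J b) : ℝ) = ∑ v ∈ J, survInd (primesIoc u z) b {v} := by
    intro b
    rw [survSet, card_filter, Nat.cast_sum]
    refine sum_congr rfl fun v _ => ?_
    by_cases h : Surv (primesIoc u z) b v <;> simp [survInd, h]
  simp only [h1]
  rw [avg_sum, sum_congr rfl fun v _ => avg_survInd_primesIoc u z {v} b]
  simp [piK, resCard]

theorem surv_congr {l : List ℕ} {b b' : ℕ → ℕ} (h : ∀ p ∈ l, b p = b' p) (v : ℤ) :
    Surv l b v ↔ Surv l b' v :=
  forall₂_congr fun p hp => by rw [h p hp]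

theorem avg_card_badSet_survSet_le {w z X Y κ k : ℕ} {Y0 : ℤ} {J : Finset ℤ} {Q : Finset ℕ} {τ ε : ℝ}
    (hwz : w ≤ z) (S : ∀ U ⊆ J, SieveSetup w z X Y κ k Y0 U Q) (hQY : ∀ q ∈ Q, q ≤ Y)
    (hne : Q.Nonempty) (hτ : 0 < τ)
    (hε : piK w z 1 * (#J / (τ ^ 2 * ∑ q ∈ Q, 1 / (q : ℝ)) * (32 * k / Real.log X * modErr w κ +
        piK w z 1 * (piK w z (κ + 1))⁻¹ / X) +
        330 * Y / τ * ((piK w z (κ + 1))⁻¹ / X + 2 * modErr w κ)) ≤ ε) (b : ℕ → ℕ) :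
    avg (primesIoc 0 z) (fun b => (#(badSet w z (survSet 0 w J b) Q τ b) : ℝ)) b ≤ ε := by
  rw [primesIoc_append (Nat.zero_le w) hwz, avg_append]
  have key : ∀ b, avg (primesIoc w z) (fun b => (#(badSet w z (survSet 0 w J b) Q τ b) : ℝ)) b ≤ ε := by
    intro b
    have h1 : avg (primesIoc w z) (fun b => (#(badSet w z (survSet 0 w J b) Q τ b) : ℝ)) b =
        avg (primesIoc w z) (fun b' => (#(badSet w z (survSet 0 w J b) Q τ b') : ℝ)) b := by
      refine avg_congr_off fun b' hb' => ?_
      have : survSet 0 w J b' = survSet 0 w J b := by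
        ext v
        rw [mem_survSet, mem_survSet, surv_congr]
        intro p hp
        refine hb' p fun hp' => ?_
        have h2 := (mem_primesIoc.1 hp).2.1
        have h3 := (mem_primesIoc.1 hp').1
        omega
      rw [this]
    have hsub : survSet 0 w J b ⊆ J := survSet_subset _ _ _ _
    have S' := S _ hsub
    rw [h1]
    refine (S'.avg_card_badSet_le hQY hne hτ b).trans (le_trans ?_ hε)
    have hκ := S'.one_le
    have hw := S'.le_w
    have hσ : 0 < piK w z 1 := piK_pos (by nlinarith)
    have hpi : 0 < piK w z (κ + 1) := piK_pos (by nlinarith)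
    have hlog := S'.log_pos
    have hM := modErr_nonneg w κ
    have hc : (#(survSet 0 w J b) : ℝ) ≤ #J := by exact_mod_cast card_le_card hsub
    have hW : 0 ≤ ∑ q ∈ Q, 1 / (q : ℝ) := sum_nonneg fun q _ => by positivity
    gcongr
  refine (avg_mono key b).trans (le_of_eq ?_)
  exact avg_const pos_of_mem_primesIoc ε b

theorem exists_map_onto {A : Finset ℤ} {P : Finset ℕ} (h : #A ≤ #P) :
    ∃ ψ : ℕ → ℤ, ∀ v ∈ A, ∃ p ∈ P, ψ p = v := by
  classical
  obtain ⟨P', hP', hc⟩ := exists_subset_card_eq h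
  have e := equivOfCardEq hc
  refine ⟨fun p => if h : p ∈ P' then (e ⟨p, h⟩).1 else 0, fun v hv => ?_⟩
  refine ⟨(e.symm ⟨v, hv⟩).1, hP' (e.symm ⟨v, hv⟩).2, ?_⟩
  dsimp only
  rw [dif_pos (e.symm ⟨v, hv⟩).2]
  simp

theorem exists_cover {ι : Type*} [Fintype ι] {w X κ k : ι → ℕ} {z Y x m r R : ℕ} {Y0 : Bool → ℤ}
    {Q : Bool → ι → ℕ → Finset ℕ} {C β B η τ ε : ℝ}
    (S : ∀ c i j, ∀ U ⊆ Icc (Y0 c) (Y0 c + Y),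
      SieveSetup (w i) z (X i) Y (κ i) (k i) (Y0 c) U (Q c i j))
    (hdisj : ∀ c i j c' i' j' q, q ∈ Q c i j → q ∈ Q c' i' j' → c = c' ∧ i = i' ∧ j = j')
    (hXX : ∀ i i', Y < X i * X i') (hQR : ∀ c i j, ∀ q ∈ Q c i j, q ≤ R) (hRx : R ≤ x)
    (hzR : z ≤ R) (hwz : ∀ i, w i ≤ z)
    (hQY : ∀ c i j, ∀ q ∈ Q c i j, q ≤ Y) (hne : ∀ c i, ∀ j < m, (Q c i j).Nonempty)
    (hr : ∀ i, κ i + 1 ≤ r) (hr1 : 1 ≤ r)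
    (hβ : ∀ i, (piK (w i) z (κ i + 1))⁻¹ / X i ≤ β) (hβ0 : 0 < β) (hβ1 : β ≤ 1)
    (hB1 : 1 ≤ B) (hB : (x + 1 : ℕ) * β ≤ B) (hη0 : 0 ≤ η) (hη : η ≤ 1)
    (hC : 0 < C) (hC1 : 11 / 10 * C ≤ 1) (hτ : 0 < τ)
    (hsmall : 4 * (21 * r ^ 2 * B * Real.exp (C * m) ^ (3 * r) / (11 / 10 - 1) ^ 2) ^ 2
      * β ^ ((1 / 2 : ℝ) ^ m) ≤ η)
    (hdeg : ∀ c, ∀ j < m, 11 / 10 * C * Real.exp (-(C * j)) ≤ 10 / 11 * ∑ i, (1 - 2 * τ) *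
      ((∑ q ∈ Q c i j, 1 / (q : ℝ)) * (piK (w i) z 1)⁻¹))
    (hε : ∀ c i, ∀ j < m, piK (w i) z 1 * ((Y + 1 : ℕ) / (τ ^ 2 * ∑ q ∈ Q c i j, 1 / (q : ℝ)) *
        (32 * k i / Real.log (X i) * modErr (w i) (κ i) +
        piK (w i) z 1 * (piK (w i) z (κ i + 1))⁻¹ / X i) +
        330 * Y / τ * ((piK (w i) z (κ i + 1))⁻¹ / X i + 2 * modErr (w i) (κ i))) ≤ ε)
    (hfin : 2 * ((Y + 1 : ℕ) * piK 0 z 1) * (Real.exp (-(C * m)) + η) +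
      2 * (Fintype.card ι * (m * ε)) ≤ #((Ioc R x).filter Nat.Prime)) :
    ∃ a : ℕ → ℤ, ∀ c, ∀ v ∈ Icc (Y0 c) (Y0 c + Y), ∃ p : ℕ, p ≤ x ∧ p.Prime ∧ v % (p : ℤ) = a p := by
  classical
  set J : Bool → Finset ℤ := fun c => Icc (Y0 c) (Y0 c + Y) with hJ
  have hJc : ∀ c, #(J c) = Y + 1 := fun c => by
    simp only [hJ, Int.card_Icc]
    omega
  set θ := Real.exp (-(C * m)) + η with hθ
  have hθ0 : 0 ≤ θ := by positivity
  set bad : Bool → ι → ℕ → (ℕ → ℕ) → Finset ℤ := fun c i j b =>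
    badSet (w i) z (survSet 0 (w i) (J c) b) (Q c i j) τ b with hbad
  obtain ⟨b, hb⟩ := exists_le_avg (l := primesIoc 0 z) pos_of_mem_primesIoc
    (fun b => ∑ c : Bool, (θ * #(survSet 0 z (J c) b) + ∑ i, ∑ j ∈ range m, (#(bad c i j b) : ℝ))) 0
  have hb' : ∑ c : Bool, (θ * #(survSet 0 z (J c) b) + ∑ i, ∑ j ∈ range m, (#(bad c i j b) : ℝ)) ≤
      #((Ioc R x).filter Nat.Prime) := by
    refine hb.trans (le_trans ?_ hfin)
    rw [avg_sum]
    have h1 : ∀ c : Bool, avg (primesIoc 0 z) (fun b => θ * #(survSet 0 z (J c) b) +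
        ∑ i, ∑ j ∈ range m, (#(bad c i j b) : ℝ)) 0 ≤
        θ * ((Y + 1 : ℕ) * piK 0 z 1) + Fintype.card ι * (m * ε) := by
      intro c
      rw [avg_add, avg_const_mul, avg_card_survSet, hJc, avg_sum]
      gcongr
      calc _ ≤ ∑ i : ι, (m * ε) := by
            refine sum_le_sum fun i _ => ?_
            rw [avg_sum]
            calc _ ≤ ∑ j ∈ range m, ε := by
                  refine sum_le_sum fun j hj => ?_
                  rw [mem_range] at hj
                  refine avg_card_badSet_survSet_le (hwz i) (S c i j) (hQY c i j) (hne c i j hj) hτ ?_ 0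
                  have := hε c i j hj
                  rwa [← hJc c] at this
              _ = m * ε := by simp
        _ = _ := by simp
    refine (sum_le_sum fun c _ => h1 c).trans (le_of_eq ?_)
    rw [Fintype.sum_bool]
    ring
  set V : Bool → Finset ℤ := fun c => (survSet 0 z (J c) b).filter fun v =>
    ∀ i, ∀ j ∈ range m, v ∉ bad c i j b with hV
  have hsurv : ∀ c, ∀ v ∈ V c, v ∈ J c ∧ Surv (primesIoc 0 z) b v := fun c v hv =>
    mem_survSet.1 (mem_filter.1 hv).1
  have hres : ∀ c, ∃ a : ℕ → ℤ, ∃ R ⊆ V c, (#R : ℝ) ≤ #(V c) * θ ∧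
      ∀ v ∈ V c, v ∉ R → ∃ i j, ∃ q ∈ Q c i j, v % (q : ℤ) = a q := by
    intro c
    refine exists_residues (U := fun i => survSet 0 (w i) (J c) b)
      (fun i j => S c i j _ (survSet_subset _ _ _ _))
      (fun i j i' j' q h h' => (hdisj c i j c i' j' q h h').2) hXX
      (fun i j q hq => (hQR c i j q hq).trans hRx) hr hr1 hβ hβ0 hβ1 hB1 hB hη hC hC1 hsmall (hdeg c)
      (fun v hv i => mem_survSet.2 ⟨(hsurv c v hv).1, fun p hp => (hsurv c v hv).2 p ?_⟩)
      (fun v hv i p hp => (hsurv c v hv).2 p ?_)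
      fun v hv i j hj => (mem_filter.1 hv).2 i j (mem_range.2 hj)
    · have := mem_primesIoc.1 hp
      exact mem_primesIoc.2 ⟨this.1, this.2.1.trans (hwz i), this.2.2⟩
    · have := mem_primesIoc.1 hp
      exact mem_primesIoc.2 ⟨by omega, this.2.1, this.2.2⟩
  choose a Rm hRV hRc hcov using hres
  set Left : Finset ℤ := univ.biUnion fun c : Bool => Rm c ∪ univ.biUnion fun i =>
    (range m).biUnion fun j => bad c i j b with hLeft
  have hLc : #Left ≤ #((Ioc R x).filter Nat.Prime) := by
    have : (#Left : ℝ) ≤ #((Ioc R x).filter Nat.Prime) := by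
      refine le_trans ?_ hb'
      calc (#Left : ℝ) ≤ ∑ c : Bool, (#(Rm c ∪ univ.biUnion fun i =>
            (range m).biUnion fun j => bad c i j b) : ℝ) := by exact_mod_cast card_biUnion_le
        _ ≤ _ := by
            refine sum_le_sum fun c _ => ?_
            calc (#(Rm c ∪ univ.biUnion fun i => (range m).biUnion fun j => bad c i j b) : ℝ)
                ≤ #(Rm c) + #(univ.biUnion fun i => (range m).biUnion fun j => bad c i j b) := by
                  exact_mod_cast card_union_le _ _
              _ ≤ θ * #(survSet 0 z (J c) b) + ∑ i, ∑ j ∈ range m, (#(bad c i j b) : ℝ) := by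
                  refine add_le_add ?_ ?_
                  · refine (hRc c).trans ?_
                    rw [mul_comm]
                    gcongr
                    exact filter_subset _ _
                  · have : #(univ.biUnion fun i => (range m).biUnion fun j => bad c i j b) ≤
                        ∑ i, ∑ j ∈ range m, #(bad c i j b) :=
                      card_biUnion_le.trans (sum_le_sum fun i _ => card_biUnion_le)
                    exact_mod_cast this
    exact_mod_cast this
  obtain ⟨ψ, hψ⟩ := exists_map_onto hLc
  refine ⟨fun p => if p ≤ z then (b p : ℤ) else if R < p then ψ p % (p : ℤ) else
    if ∃ i j, p ∈ Q true i j then a true p else a false p, fun c v hv => ?_⟩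
  have hleft : v ∈ Left → ∃ p : ℕ, p ≤ x ∧ p.Prime ∧ v % (p : ℤ) = (if p ≤ z then (b p : ℤ) else
      if R < p then ψ p % (p : ℤ) else if ∃ i j, p ∈ Q true i j then a true p else a false p) := by
    intro h
    obtain ⟨p, hp, rfl⟩ := hψ v h
    rw [mem_filter, mem_Ioc] at hp
    refine ⟨p, hp.1.2, hp.2, ?_⟩
    rw [if_neg (by omega), if_pos hp.1.1]
  by_cases hs : Surv (primesIoc 0 z) b v
  · by_cases hVm : v ∈ V c
    · by_cases hvR : v ∈ Rm c
      · exact hleft (mem_biUnion.2 ⟨c, mem_univ _, mem_union_left _ hvR⟩)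
      · obtain ⟨i, j, q, hq, hvq⟩ := hcov c v hVm hvR
        have hS := S c i j ∅ (empty_subset _)
        have hqm := hS.mem_Q q hq
        have hzX := hS.z_le
        refine ⟨q, (hQR c i j q hq).trans hRx, hqm.1, ?_⟩
        dsimp only
        rw [if_neg (by omega), if_neg (by have := hQR c i j q hq; omega), hvq]
        cases c with
        | true => rw [if_pos ⟨i, j, hq⟩]
        | false =>
          rw [if_neg]
          rintro ⟨i', j', hq'⟩
          exact absurd (hdisj _ _ _ _ _ _ q hq hq').1 (by simp)
    · have : ∃ i, ∃ j ∈ range m, v ∈ bad c i j b := by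
        by_contra hcon
        push Not at hcon
        exact hVm (mem_filter.2 ⟨mem_survSet.2 ⟨hv, hs⟩, hcon⟩)
      obtain ⟨i, j, hj, hvb⟩ := this
      exact hleft (mem_biUnion.2 ⟨c, mem_univ _, mem_union_right _
        (mem_biUnion.2 ⟨i, mem_univ _, mem_biUnion.2 ⟨j, hj, hvb⟩⟩)⟩)
  · unfold Surv at hs
    push Not at hs
    obtain ⟨p, hp, hpv⟩ := hs
    have hp' := mem_primesIoc.1 hp
    refine ⟨p, hp'.2.1.trans (hzR.trans hRx), hp'.2.2, ?_⟩
    dsimp only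
    rw [if_pos hp'.2.1, hpv]

theorem lt_primeDist {n : ℤ} {x y : ℕ} (hn : (x + y : ℕ) < n)
    (h : ∀ u : ℤ, |u| ≤ y → ∃ p : ℕ, p ≤ x ∧ p.Prime ∧ (p : ℤ) ∣ n + u) : y < primeDist n := by
  unfold primeDist
  refine Nat.succ_le_of_lt (lt_of_lt_of_le (Nat.lt_succ_self y) (le_csInf ⟨_, 2, Nat.prime_two, rfl⟩ ?_))
  rintro d ⟨q, hq, rfl⟩
  by_contra! hlt
  obtain ⟨p, hpx, hp, hdvd⟩ := h (q - n) (by rw [abs_sub_comm, Int.abs_eq_natAbs]; exact_mod_cast (by omega))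
  have h2 : p ∣ q := by
    have : n + (q - n) = q := by ring
    rw [this] at hdvd
    exact_mod_cast hdvd
  have := (Nat.prime_dvd_prime_iff_eq hp hq).1 h2
  push_cast at hn
  omega

theorem exists_congr_primes (x : ℕ) (a : ℕ → ℤ) (M : ℕ) :
    ∃ n : ℤ, M ≤ n ∧ n < M + 4 ^ x ∧ ∀ p : ℕ, p ≤ x → p.Prime → (p : ℤ) ∣ n + a p := by
  set t := (range (x + 1)).filter Nat.Prime with ht
  obtain ⟨k, hk⟩ := Nat.chineseRemainderOfFinset (fun p => ((-a p) % (p : ℤ)).toNat) id t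
    (fun p hp => (mem_filter.1 hp).2.ne_zero)
    (fun p hp q hq hpq => (Nat.coprime_primes (mem_filter.1 hp).2 (mem_filter.1 hq).2).2 hpq)
  have hP0 : 0 < primorial x := primorial_pos x
  refine ⟨M + (k - M) % (primorial x : ℤ), ?_, ?_, fun p hpx hp => ?_⟩
  · have := Int.emod_nonneg ((k : ℤ) - M) (b := (primorial x : ℤ)) (by positivity)
    linarith
  · have h1 := Int.emod_lt_of_pos ((k : ℤ) - M) (b := (primorial x : ℤ)) (by positivity)
    have h2 : (primorial x : ℤ) ≤ 4 ^ x := by exact_mod_cast primorial_le_four_pow x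
    linarith
  · have hpt : p ∈ t := by simp [ht, hp]; omega
    have hp0 : (0 : ℤ) < p := by exact_mod_cast hp.pos
    have hdvd : (p : ℤ) ∣ (primorial x : ℤ) := by
      exact_mod_cast dvd_prod_of_mem (fun q => q) hpt
    have h1 : (p : ℤ) ∣ k + a p := by
      have := (Nat.modEq_iff_dvd.1 (hk p hpt))
      rw [Int.toNat_of_nonneg (Int.emod_nonneg _ hp0.ne')] at this
      simp only [id] at this
      have h3 := Int.emod_add_mul_ediv (-a p) p
      have h4 : (k : ℤ) + a p = -((-a p) % (p : ℤ) - k) - p * (-a p / p) := by linarith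
      rw [h4]
      exact dvd_sub (this.neg_right) (dvd_mul_right _ _)
    have h2 := Int.emod_add_mul_ediv ((k : ℤ) - M) (primorial x : ℤ)
    have h5 : (M : ℤ) + (k - M) % (primorial x : ℤ) + a p =
        (k + a p) - (primorial x : ℤ) * ((k - M) / (primorial x : ℤ)) := by linarith
    rw [h5]
    exact dvd_sub h1 (hdvd.mul_right _)

theorem exists_split_of_cover {N x y : ℕ} (hN : x + y + 4 ^ x < N / 3)
    (hcov : ∀ Y0 : Bool → ℤ, ∃ a : ℕ → ℤ, ∀ c, ∀ v ∈ Icc (Y0 c) (Y0 c + (2 * y : ℕ)),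
      ∃ p : ℕ, p ≤ x ∧ p.Prime ∧ v % (p : ℤ) = a p) :
    ∃ n₁ n₂ : ℕ, 0 < n₁ ∧ 0 < n₂ ∧ N = n₁ + n₂ ∧ y < primeDist (n₁ : ℤ) ∧ y < primeDist (n₂ : ℤ) := by
  obtain ⟨a, ha⟩ := hcov fun c => if c then -(y : ℤ) else -(N : ℤ) - y
  obtain ⟨n, hn1, hn2, hn⟩ := exists_congr_primes x a (N / 3)
  have h4 : (x : ℤ) + y + 4 ^ x < (N / 3 : ℕ) := by exact_mod_cast hN
  have h5 : 3 * ((N / 3 : ℕ) : ℤ) ≤ N := by exact_mod_cast Nat.mul_div_le N 3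
  have h6 : (0 : ℤ) < 4 ^ x := by positivity
  have hdv : ∀ v : ℤ, ∀ p : ℕ, p ≤ x → p.Prime → v % (p : ℤ) = a p → (p : ℤ) ∣ n + v := by
    intro v p hpx hp hv
    have h7 := hn p hpx hp
    have h8 : n + v = (n + a p) + p * (v / p) := by
      rw [← hv]
      linarith [Int.emod_add_mul_ediv v p]
    rw [h8]
    exact dvd_add h7 (dvd_mul_right _ _)
  lift n to ℕ using by linarith [Int.natCast_nonneg (N / 3)]
  have hnN : (n : ℤ) + (x + y) < N := by linarith
  have hnN' : n + (x + y) < N := by exact_mod_cast hnN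
  refine ⟨n, N - n, ?_, by omega, by omega, lt_primeDist (x := x) ?_ ?_, lt_primeDist (x := x) ?_ ?_⟩
  · have : (0 : ℤ) < n := by linarith [Int.natCast_nonneg x, Int.natCast_nonneg y]
    exact_mod_cast this
  · push_cast
    linarith
  · intro u hu
    rw [abs_le] at hu
    obtain ⟨p, hpx, hp, hv⟩ := ha true u (by simp only [if_true, mem_Icc]; push_cast; constructor <;> linarith)
    exact ⟨p, hpx, hp, hdv u p hpx hp hv⟩
  · omega
  · intro u hu
    rw [abs_le] at hu
    obtain ⟨p, hpx, hp, hv⟩ := ha false (-N - u) (by simp only [Bool.false_eq_true, if_false, mem_Icc]; push_cast; constructor <;> linarith)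
    refine ⟨p, hpx, hp, ?_⟩
    have := hdv _ p hpx hp hv
    rw [← dvd_neg] at this
    have hc : ((N - n : ℕ) : ℤ) + u = -((n : ℤ) + (-N - u)) := by
      rw [Nat.cast_sub (by omega)]
      ring
    rwa [hc]

theorem piK_one_le_exp (w z : ℕ) :
    piK w z 1 ≤ Real.exp (-∑ p ∈ (Ioc w z).filter Nat.Prime, (1 : ℝ) / p) := by
  rw [piK, ← sum_neg_distrib, Real.exp_sum]
  refine prod_le_prod (fun p hp => ?_) fun p hp => ?_
  · have : (1 : ℝ) ≤ p := by exact_mod_cast (mem_filter.1 hp).2.one_lt.le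
    rw [sub_nonneg, Nat.cast_one]
    exact div_le_one_of_le₀ this (by linarith)
  · have := Real.add_one_le_exp (-(1 / (p : ℝ)))
    push_cast
    linarith

theorem inv_piK_le_exp {w z k : ℕ} (hk : 4 * k ≤ w) :
    (piK w z k)⁻¹ ≤ Real.exp (2 * k * ∑ p ∈ (Ioc w z).filter Nat.Prime, (1 : ℝ) / p) := by
  rw [piK, ← prod_inv_distrib, mul_sum, Real.exp_sum]
  refine prod_le_prod (fun p hp => ?_) fun p hp => ?_ <;>
    have h1 := (mem_Ioc.1 (mem_filter.1 hp).1).1 <;>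
    have hp0 : (0 : ℝ) < p := by exact_mod_cast (by omega : 0 < p)
  all_goals
    have h2 : (k : ℝ) / p ≤ 1 / 2 := by
      rw [div_le_div_iff₀ hp0 two_pos]
      exact_mod_cast (by omega : k * 2 ≤ 1 * p)
  · exact inv_nonneg.2 (by linarith)
  · have h3 : 0 ≤ (k : ℝ) / p := by positivity
    have h4 : 2 * (k : ℝ) * (1 / p) = 2 * (k / p) := by ring
    rw [h4]
    refine le_trans ?_ (Real.add_one_le_exp _)
    rw [inv_le_comm₀ (by linarith) (by linarith)]
    rw [inv_le_iff_one_le_mul₀ (by linarith)]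
    nlinarith

theorem card_primes_ge (R x : ℕ) :
    R * ∑ p ∈ (Ioc R x).filter Nat.Prime, (1 : ℝ) / p ≤ #((Ioc R x).filter Nat.Prime) := by
  rw [mul_sum, card_eq_sum_ones, Nat.cast_sum]
  refine sum_le_sum fun p hp => ?_
  have h1 := (mem_Ioc.1 (mem_filter.1 hp).1).1
  have hp0 : (0 : ℝ) < p := by exact_mod_cast (by omega : 0 < p)
  rw [mul_one_div, div_le_iff₀ hp0]
  push_cast
  rw [one_mul]
  exact_mod_cast h1.le

theorem eventually_mul_rpow_le {a b : ℝ} (hab : a < b) (K : ℝ) :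
    ∀ᶠ L : ℝ in atTop, K * L ^ a ≤ L ^ b := by
  filter_upwards [(tendsto_rpow_atTop (sub_pos.2 hab)).eventually_ge_atTop K, eventually_gt_atTop 0]
    with L h1 h2
  have : L ^ b = L ^ (b - a) * L ^ a := by rw [← Real.rpow_add h2]; ring_nf
  rw [this]
  gcongr

theorem eventually_mul_log_le {a : ℝ} (ha : 0 < a) (K : ℝ) :
    ∀ᶠ L : ℝ in atTop, K * Real.log L ≤ L ^ a := by
  have h := (isLittleO_log_rpow_atTop ha).bound (c := (|K| + 1)⁻¹) (by positivity)
  filter_upwards [h, eventually_ge_atTop 1] with L h1 h2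
  have h3 : 0 ≤ Real.log L := Real.log_nonneg h2
  have h4 : 0 ≤ L ^ a := Real.rpow_nonneg (by linarith) a
  rw [Real.norm_of_nonneg h3, Real.norm_of_nonneg h4, inv_mul_eq_div, le_div_iff₀ (by positivity)] at h1
  nlinarith [le_abs_self K]

theorem eventually_mul_rpow_le_exp (a K : ℝ) {b : ℝ} (hb : 0 < b) :
    ∀ᶠ L : ℝ in atTop, K * L ^ a ≤ Real.exp (b * L) := by
  have h := (isLittleO_rpow_exp_pos_mul_atTop a hb).bound (c := (|K| + 1)⁻¹) (by positivity)
  filter_upwards [h, eventually_ge_atTop 1] with L h1 h2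
  have h4 : 0 ≤ L ^ a := Real.rpow_nonneg (by linarith) a
  rw [Real.norm_of_nonneg h4, Real.norm_of_nonneg (Real.exp_pos _).le, inv_mul_eq_div,
    le_div_iff₀ (by positivity)] at h1
  nlinarith [le_abs_self K]

theorem tendsto_log_natCast : Tendsto (fun x : ℕ => Real.log x) atTop atTop :=
  Real.tendsto_log_atTop.comp tendsto_natCast_atTop_atTop

/-- A positive proportion of the primes up to `x` is larger than `x / K`. -/
theorem exists_card_primes_ge : ∃ K : ℕ, 1 ≤ K ∧ ∀ᶠ x : ℕ in atTop,
    (x : ℝ) / (K * Real.log x) ≤ #((Ioc (x / K) x).filter Nat.Prime) := by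
  obtain ⟨C, hC, hm⟩ := mertens_two
  set K : ℕ := ⌈Real.exp (2 * C + 2)⌉₊ with hK
  have hK1 : Real.exp (2 * C + 2) ≤ K := Nat.le_ceil _
  have hKpos : (0 : ℝ) < K := (Real.exp_pos _).trans_le hK1
  have hK0 : 1 ≤ K := by exact_mod_cast hKpos
  have hKlog : 2 * C + 2 ≤ Real.log K := (Real.le_log_iff_exp_le hKpos).2 hK1
  refine ⟨K, hK0, ?_⟩
  filter_upwards [eventually_ge_atTop (4 * K), eventually_ge_atTop (4 * K ^ 2),
    tendsto_log_natCast.eventually_ge_atTop 1] with x hx hx2 hL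
  set L := Real.log x with hLd
  have hx0 : (0 : ℝ) < x := by exact_mod_cast (by omega : 0 < x)
  set R := x / K with hR
  have hR4 : 4 ≤ R := (Nat.le_div_iff_mul_le (by omega)).2 hx
  have hRle : (R : ℝ) ≤ x / K := Nat.cast_div_le
  have hRge : (x : ℝ) / (2 * K) ≤ R := by
    have h1 : x < K * (R + 1) := by
      have := Nat.lt_mul_div_succ x (show 0 < K by omega)
      exact this
    have h2 : (x : ℝ) < K * (R + 1) := by exact_mod_cast h1
    have h3 : (4 : ℝ) ≤ R := by exact_mod_cast hR4
    rw [div_le_iff₀ (by positivity)]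
    nlinarith
  have hR0 : (0 : ℝ) < R := by exact_mod_cast (by omega : 0 < R)
  have hRx : R ≤ x := Nat.div_le_self _ _
  have hlogR1 : Real.log R ≤ L - Real.log K := by
    rw [hLd, ← Real.log_div hx0.ne' hKpos.ne']
    exact Real.log_le_log hR0 hRle
  have hlogR2 : L / 2 ≤ Real.log R := by
    have h1 : (x : ℝ) ≤ R ^ 2 := by
      have h2 : (4 * K ^ 2 : ℝ) ≤ x := by exact_mod_cast hx2
      calc (x : ℝ) ≤ (x / (2 * K)) ^ 2 := by
            rw [div_pow, le_div_iff₀ (by positivity)]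
            nlinarith
        _ ≤ R ^ 2 := by gcongr
    have := Real.log_le_log hx0 h1
    rw [Real.log_pow] at this
    push_cast at this
    linarith
  have hlogR0 : 0 < Real.log R := by linarith
  have h1 := (abs_le.1 (hm R x (by omega) hRx)).1
  have h2 : C / Real.log R ≤ 2 * C / L := by
    rw [div_le_div_iff₀ hlogR0 (by linarith)]
    nlinarith
  have h3 : Real.log K / L ≤ Real.log (Real.log x) - Real.log (Real.log R) := by
    rw [← Real.log_div (by linarith) hlogR0.ne']
    have h4 := Real.one_sub_inv_le_log_of_pos (show 0 < L / Real.log R by positivity)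
    refine le_trans ?_ h4
    rw [inv_div, div_le_iff₀ (by linarith), sub_mul, div_mul_cancel₀ _ (by linarith)]
    linarith
  have h5 : 2 / L ≤ Real.log K / L - 2 * C / L := by
    rw [← sub_div]
    gcongr
    linarith
  refine le_trans ?_ (card_primes_ge R x)
  calc (x : ℝ) / (K * L) = x / (2 * K) * (2 / L) := by field_simp
    _ ≤ _ := by
        gcongr
        linarith

theorem exists_piK_zero_le : ∃ C : ℝ, 0 < C ∧ ∀ z : ℕ, 2 ≤ z → piK 0 z 1 ≤ C / Real.log z := by
  obtain ⟨C, hC, hm⟩ := mertens_two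
  have hl2 : 0 < Real.log 2 := Real.log_pos (by norm_num)
  refine ⟨Real.exp (C / Real.log 2), by positivity, fun z hz => ?_⟩
  have h1 := (abs_le.1 (hm 2 z le_rfl hz)).1
  have hz1 : 0 < Real.log z := Real.log_pos (by exact_mod_cast hz)
  have h2 : ∑ p ∈ (Ioc 2 z).filter Nat.Prime, (1 : ℝ) / p ≤
      ∑ p ∈ (Ioc 0 z).filter Nat.Prime, (1 : ℝ) / p :=
    sum_le_sum_of_subset_of_nonneg (filter_subset_filter _ (Ioc_subset_Ioc_left (by norm_num)))
      fun _ _ _ => by positivity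
  have h3 : Real.log (Real.log 2) ≤ 0 := by
    refine Real.log_nonpos hl2.le ?_
    have := Real.log_two_lt_d9
    linarith
  calc piK 0 z 1 ≤ Real.exp (C / Real.log 2 - Real.log (Real.log z)) := by
        refine (piK_one_le_exp 0 z).trans (Real.exp_le_exp.2 ?_)
        push_cast at h1
        linarith
    _ = _ := by rw [Real.exp_sub, Real.exp_log hz1]

/-- Length of the intervals to be covered. -/
noncomputable def covLen (c : ℝ) (x : ℕ) : ℕ := ⌊c * x * Real.log x ^ (1 / 300000 : ℝ)⌋₊

/-- Upper end of the range of primes used for the random sieve. -/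
noncomputable def sieveLim (x : ℕ) : ℕ := ⌊x / Real.log x⌋₊

/-- Lower end of the range of primes in the group with exponent `α`. -/
noncomputable def grpLow (c α : ℝ) (x : ℕ) : ℕ := ⌊covLen c x / Real.log x ^ α⌋₊

/-- Number of dyadic intervals spanned by the group with exponent `α`. -/
noncomputable def grpDyad (α : ℝ) (x : ℕ) : ℕ := ⌊α / 2 * Real.log (Real.log x) / Real.log 2⌋₊

/-- Bound for the size of a residue class modulo a prime in the group with exponent `α`. -/
noncomputable def grpMult (α : ℝ) (x : ℕ) : ℕ := ⌈2 * Real.log x ^ α⌉₊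

/-- Threshold separating the small sieving primes for the group with exponent `α`. -/
noncomputable def grpCut (α : ℝ) (x : ℕ) : ℕ := ⌊Real.log x ^ (9 / 4 * α)⌋₊

theorem eventually_log_of {P : ℝ → Prop} (h : ∀ᶠ L in atTop, P L) :
    ∀ᶠ x : ℕ in atTop, P (Real.log x) := tendsto_log_natCast.eventually h

theorem eventually_covLen {c : ℝ} (hc : 0 < c) : ∀ᶠ x : ℕ in atTop,
    (x : ℝ) ≤ covLen c x ∧ ((covLen c x + 1 : ℕ) : ℝ) ≤ 2 * c * x * Real.log x ^ (1 / 300000 : ℝ) ∧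
      (covLen c x : ℝ) ≤ c * x * Real.log x ^ (1 / 300000 : ℝ) := by
  filter_upwards [eventually_log_of (eventually_mul_rpow_le (a := 0) (b := 1 / 300000) (by norm_num) (2 / c)),
    eventually_ge_atTop 1] with x h1 h2
  have hx : (1 : ℝ) ≤ x := by exact_mod_cast h2
  rw [Real.rpow_zero, mul_one, div_le_iff₀ hc] at h1
  set D := Real.log x ^ (1 / 300000 : ℝ)
  have h3 : 2 * (x : ℝ) ≤ c * x * D := by nlinarith
  have h4 : c * x * D < covLen c x + 1 := Nat.lt_floor_add_one _
  have h5 : (covLen c x : ℝ) ≤ c * x * D := Nat.floor_le (by linarith)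
  refine ⟨by linarith, ?_, h5⟩
  push_cast
  linarith

theorem eventually_grpLow {c α : ℝ} (hc : 0 < c) (hc1 : c ≤ 1) (hα : 0 ≤ α) (hα1 : α ≤ 15 / 16) :
    ∀ᶠ x : ℕ in atTop, (x : ℝ) / Real.log x ≤ grpLow c α x ∧ (grpLow c α x : ℝ) ≤ x * Real.log x ∧
      (covLen c x : ℝ) ≤ 2 * Real.log x ^ α * grpLow c α x ∧
      (grpLow c α x : ℝ) ≤ covLen c x / Real.log x ^ α := by
  filter_upwards [eventually_covLen hc, eventually_log_of (eventually_mul_rpow_le (a := 15 / 16) (b := 1) (by norm_num) 2),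
    eventually_log_of (eventually_ge_atTop 1),
    eventually_log_of (eventually_mul_rpow_le_exp (15 / 16) 2 one_pos), eventually_ge_atTop 1]
    with x ⟨h1, _, h2⟩ h3 hL h4 hx
  have hx : (1 : ℝ) ≤ x := by exact_mod_cast hx
  rw [one_mul, Real.exp_log (by linarith)] at h4
  rw [Real.rpow_one] at h3
  set L := Real.log x with hLd
  have hL0 : 0 < L := by linarith
  have hα0 : L ^ α ≤ L ^ (15 / 16 : ℝ) := Real.rpow_le_rpow_of_exponent_le hL hα1
  have hp : 0 < L ^ α := Real.rpow_pos_of_pos hL0 _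
  have hp1 : 1 ≤ L ^ α := Real.one_le_rpow hL hα
  have h5 : (covLen c x : ℝ) / L ^ α < grpLow c α x + 1 := Nat.lt_floor_add_one _
  have h6 : (grpLow c α x : ℝ) ≤ covLen c x / L ^ α := Nat.floor_le (by positivity)
  have h7 : 2 * (x : ℝ) / L ≤ covLen c x / L ^ α := by
    rw [div_le_div_iff₀ hL0 hp]
    nlinarith
  have h8 : 2 ≤ (covLen c x : ℝ) / L ^ α := by
    rw [le_div_iff₀ hp]
    nlinarith
  refine ⟨?_, ?_, ?_, h6⟩
  · rw [mul_div_assoc] at h7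
    linarith
  · refine h6.trans ?_
    calc (covLen c x : ℝ) / L ^ α ≤ covLen c x := div_le_self (by positivity) hp1
      _ ≤ c * x * L ^ (1 / 300000 : ℝ) := h2
      _ ≤ 1 * x * L ^ (1 : ℝ) := by
          gcongr
          norm_num
      _ = x * L := by rw [Real.rpow_one, one_mul]
  · have : (covLen c x : ℝ) / L ^ α ≤ 2 * grpLow c α x := by linarith
    rw [div_le_iff₀ hp] at this
    linarith

theorem eventually_log_grpLow {c α : ℝ} (hc : 0 < c) (hc1 : c ≤ 1) (hα : 0 ≤ α) (hα1 : α ≤ 15 / 16) :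
    ∀ᶠ x : ℕ in atTop, 999 / 1000 * Real.log x ≤ Real.log (grpLow c α x) ∧
      Real.log (grpLow c α x) ≤ 1001 / 1000 * Real.log x := by
  filter_upwards [eventually_grpLow hc hc1 hα hα1, eventually_log_of (eventually_mul_log_le one_pos 1000),
    eventually_log_of (eventually_ge_atTop 1), eventually_ge_atTop 1] with x ⟨h1, h2, _, _⟩ h3 hL hx
  have hx : (1 : ℝ) ≤ x := by exact_mod_cast hx
  have hL0 : 0 < Real.log x := by linarith
  have h4 := Real.log_le_log (by positivity) h1
  have h5 := Real.log_le_log (lt_of_lt_of_le (by positivity) h1) h2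
  rw [Real.log_div (by linarith) hL0.ne'] at h4
  rw [Real.log_mul (by linarith) hL0.ne'] at h5
  rw [Real.rpow_one] at h3
  constructor <;> linarith

theorem eventually_sieveLim : ∀ᶠ x : ℕ in atTop, (sieveLim x : ℝ) ≤ x / Real.log x ∧
    999 / 1000 * Real.log x ≤ Real.log (sieveLim x) ∧ Real.log (sieveLim x) ≤ Real.log x ∧
    Real.log x ^ (3 : ℝ) ≤ sieveLim x := by
  filter_upwards [eventually_log_of (eventually_mul_log_le one_pos 2000),
    eventually_log_of (eventually_ge_atTop 2000), eventually_log_of (eventually_mul_rpow_le_exp 4 2 one_pos),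
    eventually_ge_atTop 1] with x h1 hL h2 hx
  have hx : (1 : ℝ) ≤ x := by exact_mod_cast hx
  have hx0 : (0 : ℝ) < x := by linarith
  rw [one_mul, Real.exp_log hx0] at h2
  rw [Real.rpow_one] at h1
  set L := Real.log x with hLd
  have hL0 : 0 < L := by linarith
  have h3 : (sieveLim x : ℝ) ≤ x / L := Nat.floor_le (by positivity)
  have h4 : x / L < sieveLim x + 1 := Nat.lt_floor_add_one _
  have h5 : 2 * L ^ (3 : ℝ) ≤ x / L := by
    rw [le_div_iff₀ hL0, mul_assoc, ← Real.rpow_add_one hL0.ne']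
    rwa [show (3 : ℝ) + 1 = 4 by norm_num]
  have h6 : 1 ≤ L ^ (3 : ℝ) := Real.one_le_rpow (by linarith) (by norm_num)
  have h7 : x / L / 2 ≤ sieveLim x := by linarith
  have h8 : (0 : ℝ) < sieveLim x := lt_of_lt_of_le (by positivity) h7
  refine ⟨h3, ?_, Real.log_le_log h8 (h3.trans (div_le_self hx0.le (by linarith))), by linarith⟩
  have h9 := Real.log_le_log (by positivity) h7
  rw [Real.log_div (by positivity) (by norm_num), Real.log_div (by positivity) (by positivity), ← hLd] at h9
  have := Real.log_two_lt_d9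
  linarith

theorem eventually_grpDyad {c α : ℝ} (hc : 0 < c) (hc1 : c ≤ 1) (hα : 0 ≤ α) (hα1 : α ≤ 15 / 16) :
    ∀ᶠ x : ℕ in atTop, (2 : ℝ) ^ grpDyad α x ≤ Real.log x ^ (α / 2) ∧
      (grpDyad α x : ℝ) ≤ Real.log (Real.log x) ∧
      α / 2 * Real.log (Real.log x) - Real.log 2 ≤ grpDyad α x * Real.log 2 ∧
      (2 : ℝ) ^ grpDyad α x * grpLow c α x ≤ covLen c x / Real.log x ^ (α / 2) := by
  filter_upwards [eventually_grpLow hc hc1 hα hα1, eventually_log_of (eventually_ge_atTop 1)]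
    with x ⟨_, _, _, h1⟩ hL
  set L := Real.log x with hLd
  have hL0 : 0 < L := by linarith
  have hl : 0 ≤ Real.log L := Real.log_nonneg hL
  have hl2 : 0 < Real.log 2 := Real.log_pos (by norm_num)
  have h2 : (grpDyad α x : ℝ) ≤ α / 2 * Real.log L / Real.log 2 := Nat.floor_le (by positivity)
  have h3 : α / 2 * Real.log L / Real.log 2 < grpDyad α x + 1 := Nat.lt_floor_add_one _
  have h2' := h2
  rw [le_div_iff₀ hl2] at h2
  rw [div_lt_iff₀ hl2] at h3
  have h4 : (2 : ℝ) ^ grpDyad α x ≤ L ^ (α / 2) := by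
    rw [Real.rpow_def_of_pos hL0, ← Real.rpow_natCast, Real.rpow_def_of_pos two_pos]
    gcongr 1
    linarith
  refine ⟨h4, ?_, by linarith, ?_⟩
  · refine h2'.trans ?_
    rw [div_le_iff₀ hl2]
    have := Real.log_two_gt_d9
    nlinarith
  · calc (2 : ℝ) ^ grpDyad α x * grpLow c α x ≤ L ^ (α / 2) * (covLen c x / L ^ α) := by gcongr
      _ = covLen c x / L ^ (α / 2) := by
          have : L ^ α = L ^ (α / 2) * L ^ (α / 2) := by rw [← Real.rpow_add hL0]; ring_nf
          rw [this]
          have := Real.rpow_pos_of_pos hL0 (α / 2)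
          field_simp

theorem eventually_grpMult {α : ℝ} (hα : 0 < α) : ∀ᶠ x : ℕ in atTop, 1 ≤ grpMult α x ∧
    2 * Real.log x ^ α ≤ grpMult α x ∧ (grpMult α x + 1 : ℝ) ≤ 3 * Real.log x ^ α := by
  filter_upwards [eventually_log_of (eventually_mul_rpow_le (a := 0) (b := α) hα 2)] with x h1
  rw [Real.rpow_zero, mul_one] at h1
  have h2 : 2 * Real.log x ^ α ≤ grpMult α x := Nat.le_ceil _
  have h3 : (grpMult α x : ℝ) < 2 * Real.log x ^ α + 1 := Nat.ceil_lt_add_one (by linarith)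
  refine ⟨?_, h2, by linarith⟩
  have : (1 : ℝ) ≤ grpMult α x := by linarith
  exact_mod_cast this

theorem eventually_grpCut {α : ℝ} (hα : 0 < α) (hα1 : α ≤ 15 / 16) : ∀ᶠ x : ℕ in atTop,
    Real.log x ^ (9 / 4 * α) / 2 ≤ grpCut α x ∧ 8 * (grpMult α x + 1) ^ 2 ≤ grpCut α x ∧
    Real.log (grpCut α x) ≤ 9 / 4 * α * Real.log (Real.log x) ∧ grpCut α x ≤ sieveLim x := by
  filter_upwards [eventually_grpMult hα,
    eventually_log_of (eventually_mul_rpow_le (a := 2 * α) (b := 9 / 4 * α) (by linarith) 144),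
    eventually_sieveLim, eventually_log_of (eventually_ge_atTop 1)] with x ⟨_, _, h1⟩ h2 ⟨_, _, _, h3⟩ hL
  set L := Real.log x with hLd
  have hL0 : 0 < L := by linarith
  have h4 : (grpCut α x : ℝ) ≤ L ^ (9 / 4 * α) := Nat.floor_le (by positivity)
  have h5 : L ^ (9 / 4 * α) < grpCut α x + 1 := Nat.lt_floor_add_one _
  have h6 : 1 ≤ L ^ (2 * α) := Real.one_le_rpow hL (by linarith)
  have h7 : L ^ (9 / 4 * α) / 2 ≤ grpCut α x := by linarith
  refine ⟨h7, ?_, ?_, ?_⟩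
  · have : (8 * (grpMult α x + 1) ^ 2 : ℝ) ≤ grpCut α x := by
      calc (8 * (grpMult α x + 1) ^ 2 : ℝ) ≤ 8 * (3 * L ^ α) ^ 2 := by gcongr
        _ = 72 * L ^ (2 * α) := by
            rw [two_mul, Real.rpow_add hL0]
            ring
        _ ≤ L ^ (9 / 4 * α) / 2 := by linarith
        _ ≤ _ := h7
    exact_mod_cast this
  · have h8 := Real.log_le_log (by linarith) h4
    rwa [Real.log_rpow hL0] at h8
  · have : (grpCut α x : ℝ) ≤ sieveLim x := by
      refine (h4.trans ?_).trans h3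
      exact Real.rpow_le_rpow_of_exponent_le hL (by linarith)
    exact_mod_cast this

/-- The primes in the group with exponent `α`. -/
noncomputable def grpPrimes (c α : ℝ) (x : ℕ) : Finset ℕ :=
  (Ioc (grpLow c α x) (2 ^ grpDyad α x * grpLow c α x)).filter Nat.Prime

theorem eventually_sieveSetup {c α : ℝ} (hc : 0 < c) (hc1 : c ≤ 1) (hα : 0 < α) (hα1 : α ≤ 15 / 16) :
    ∀ᶠ x : ℕ in atTop, ∀ Y0 : ℤ, ∀ U ⊆ Icc Y0 (Y0 + covLen c x), ∀ Q ⊆ grpPrimes c α x,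
      SieveSetup (grpCut α x) (sieveLim x) (grpLow c α x) (covLen c x) (grpMult α x) (grpDyad α x)
        Y0 U Q := by
  filter_upwards [eventually_grpLow hc hc1 hα.le hα1, eventually_log_grpLow hc hc1 hα.le hα1,
    eventually_sieveLim, eventually_grpDyad hc hc1 hα.le hα1, eventually_grpMult hα,
    eventually_grpCut hα hα1, eventually_log_of (eventually_ge_atTop 3),
    eventually_log_of (eventually_mul_rpow_le (a := 3 / 2 * α) (b := 2) (by linarith) 24)]
    with x ⟨h1, h2, h3, _⟩ ⟨h4, _⟩ ⟨h5, _, _, h6⟩ ⟨h7, _, _, _⟩ ⟨h8, h9, h10⟩ ⟨_, h11, _, h12⟩ hL h13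
    Y0 U hU Q hQ
  set L := Real.log x with hLd
  have hL0 : 0 < L := by linarith
  have hzX : sieveLim x ≤ grpLow c α x := by exact_mod_cast h5.trans h1
  have hL3 : (27 : ℝ) ≤ L ^ (3 : ℝ) := by
    have : (3 : ℝ) ^ (3 : ℝ) ≤ L ^ (3 : ℝ) := Real.rpow_le_rpow (by norm_num) hL (by norm_num)
    norm_num at this ⊢
    exact this
  refine ⟨h8, h11, hzX, h12.trans hzX, ?_, ?_, ?_, ?_, ?_⟩
  · refine le_trans ?_ hzX
    exact_mod_cast (by linarith : (10 : ℝ) ≤ sieveLim x)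
  · have : (covLen c x : ℝ) ≤ grpMult α x * grpLow c α x := h3.trans (by gcongr)
    exact_mod_cast this
  · have h14 : (grpMult α x : ℝ) ≤ 3 * L ^ α := by linarith
    calc (2 * grpMult α x * 2 ^ grpDyad α x : ℝ) ≤ 2 * (3 * L ^ α) * L ^ (α / 2) := by gcongr
      _ = 6 * L ^ (3 / 2 * α) := by
          rw [show 3 / 2 * α = α + α / 2 by ring, Real.rpow_add hL0]
          ring
      _ ≤ (999 / 1000 * L) ^ 2 := by
          rw [Real.rpow_two] at h13
          nlinarith [sq_nonneg L]
      _ ≤ _ := by gcongr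
  · exact fun u hu => mem_Icc.1 (hU hu)
  · intro q hq
    have := mem_filter.1 (hQ hq)
    exact ⟨this.2, mem_Ioc.1 this.1⟩

theorem eventually_le_log_grpCut {α : ℝ} (hα : 0 < α) (hα1 : α ≤ 15 / 16) (M : ℝ) :
    ∀ᶠ x : ℕ in atTop, M ≤ Real.log (grpCut α x) := by
  filter_upwards [eventually_grpCut hα hα1,
    eventually_log_of (eventually_mul_rpow_le (a := 0) (b := 9 / 4 * α) (by linarith) (2 * Real.exp M))]
    with x ⟨h1, _, _, _⟩ h2
  rw [Real.rpow_zero, mul_one] at h2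
  have h3 : Real.exp M ≤ grpCut α x := by linarith
  exact (Real.le_log_iff_exp_le ((Real.exp_pos _).trans_le h3)).2 h3

theorem eventually_inv_piK_le {α : ℝ} (hα : 0 < α) (hα1 : α ≤ 15 / 16) : ∀ᶠ x : ℕ in atTop,
    (piK (grpCut α x) (sieveLim x) (grpMult α x + 1))⁻¹ ≤ Real.exp (Real.log x ^ (19 / 20 : ℝ)) := by
  obtain ⟨C, hC, hm⟩ := mertens_two
  filter_upwards [eventually_grpCut hα hα1, eventually_le_log_grpCut hα hα1 (C + 1), eventually_sieveLim,
    eventually_grpMult hα, eventually_log_of (eventually_ge_atTop (Real.exp 1)),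
    eventually_log_of (eventually_mul_log_le (a := 1 / 80) (by norm_num) 12)]
    with x ⟨_, h1, h2, h3⟩ h4 ⟨_, h5, h6, _⟩ ⟨h7, _, h8⟩ hL h9
  set L := Real.log x with hLd
  have hL0 : 0 < L := (Real.exp_pos 1).trans_le hL
  have hl1 : 1 ≤ Real.log L := (Real.le_log_iff_exp_le hL0).2 hL
  have hL1 : 1 ≤ L := by
    have := Real.add_one_le_exp 1
    linarith
  have hk : 4 * (grpMult α x + 1) ≤ grpCut α x := by nlinarith
  have h10 := (abs_le.1 (hm (grpCut α x) (sieveLim x) (by omega) h3)).2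
  have h11 : C / Real.log (grpCut α x) ≤ 1 := div_le_one_of_le₀ (by linarith) (by linarith)
  have h12 : 0 ≤ Real.log (Real.log (grpCut α x)) := Real.log_nonneg (by linarith)
  have h13 : Real.log (Real.log (sieveLim x)) ≤ Real.log L := Real.log_le_log (by linarith) h6
  refine (inv_piK_le_exp hk).trans (Real.exp_le_exp.2 ?_)
  have h14 : ∑ p ∈ (Ioc (grpCut α x) (sieveLim x)).filter Nat.Prime, (1 : ℝ) / p ≤ 2 * Real.log L := by
    linarith
  push_cast
  have h15 : L ^ α ≤ L ^ (15 / 16 : ℝ) := Real.rpow_le_rpow_of_exponent_le hL1 hα1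
  calc _ ≤ 2 * (3 * L ^ (15 / 16 : ℝ)) * (2 * Real.log L) := by
        gcongr
        linarith
    _ = L ^ (15 / 16 : ℝ) * (12 * Real.log L) := by ring
    _ ≤ L ^ (15 / 16 : ℝ) * L ^ (1 / 80 : ℝ) := by gcongr
    _ = L ^ (19 / 20 : ℝ) := by rw [← Real.rpow_add hL0]; norm_num

theorem eventually_piK_one_le {α : ℝ} (hα : 0 < α) (hα1 : α ≤ 15 / 16) : ∀ᶠ x : ℕ in atTop,
    piK (grpCut α x) (sieveLim x) 1 ≤ 100 / 99 * (9 / 4 * α * Real.log (Real.log x)) / Real.log x := by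
  obtain ⟨C, hC, hm⟩ := mertens_two
  filter_upwards [eventually_grpCut hα hα1, eventually_le_log_grpCut hα hα1 (1000 * C + 1),
    eventually_sieveLim, eventually_log_of (eventually_ge_atTop 1)]
    with x ⟨_, h1, h2, h3⟩ h4 ⟨_, h5, _, _⟩ hL
  set L := Real.log x with hLd
  have hL0 : 0 < L := by linarith
  have hw2 : 2 ≤ grpCut α x := by
    have := Nat.one_le_pow 2 (grpMult α x + 1) (by omega)
    omega
  have h6 := (abs_le.1 (hm (grpCut α x) (sieveLim x) hw2 h3)).1
  have hw0 : 0 < Real.log (grpCut α x) := by linarith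
  have hz0 : 0 < Real.log (sieveLim x) := by linarith
  have hwL : 0 ≤ 9 / 4 * α * Real.log L := hw0.le.trans h2
  have h7 : C / Real.log (grpCut α x) ≤ 1 / 1000 := by
    rw [div_le_div_iff₀ hw0 (by norm_num)]
    linarith
  have h8 : Real.exp (1 / 1000) ≤ 1002 / 1000 := by
    have := Real.exp_bound_div_one_sub_of_interval' (x := 1 / 1000) (by norm_num) (by norm_num)
    norm_num at this ⊢
    linarith
  calc piK (grpCut α x) (sieveLim x) 1 ≤ Real.exp (1 / 1000 + Real.log (Real.log (grpCut α x)) -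
        Real.log (Real.log (sieveLim x))) :=
        (piK_one_le_exp _ _).trans (Real.exp_le_exp.2 (by linarith))
    _ = Real.exp (1 / 1000) * Real.log (grpCut α x) / Real.log (sieveLim x) := by
        rw [Real.exp_sub, Real.exp_add, Real.exp_log hw0, Real.exp_log hz0]
    _ ≤ 1002 / 1000 * (9 / 4 * α * Real.log L) / (999 / 1000 * L) := by gcongr
    _ = 1002 / 999 * (9 / 4 * α * Real.log L) / L := by field_simp
    _ ≤ _ := div_le_div_of_nonneg_right (mul_le_mul_of_nonneg_right (by norm_num) hwL) hL0.le

theorem eventually_grp_sum_ge {c α : ℝ} (hc : 0 < c) (hc1 : c ≤ 1) (hα : 0 < α) (hα1 : α ≤ 15 / 16) :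
    ∀ᶠ x : ℕ in atTop, 99 / 100 * (α / 2 * Real.log (Real.log x)) / Real.log x ≤
      ∑ q ∈ grpPrimes c α x, 1 / (q : ℝ) := by
  obtain ⟨C, hC, hm⟩ := mertens_two
  have hll : Tendsto (fun x : ℕ => Real.log (Real.log x)) atTop atTop :=
    Real.tendsto_log_atTop.comp tendsto_log_natCast
  filter_upwards [eventually_log_grpLow hc hc1 hα.le hα1, eventually_grpDyad hc hc1 hα.le hα1,
    eventually_log_of (eventually_ge_atTop 3), eventually_log_of (eventually_mul_log_le one_pos 1000),
    hll.eventually_ge_atTop (2000 * (1 + 2 * C) / α)]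
    with x ⟨h1, h2⟩ ⟨_, h3, h4, _⟩ hL h5 h6
  rw [Real.rpow_one] at h5
  set L := Real.log x with hLd
  have hL0 : 0 < L := by linarith
  rw [div_le_iff₀ hα] at h6
  set X := grpLow c α x with hX
  set k := grpDyad α x with hk
  have hX2 : 2 ≤ X := by
    by_contra! h
    have : Real.log X ≤ 0 := Real.log_nonpos (by positivity) (by exact_mod_cast (by omega : X ≤ 1))
    linarith
  have hX0 : (0 : ℝ) < X := by exact_mod_cast (by omega : 0 < X)
  have hlogX : 0 < Real.log X := by linarith
  have hl2 : 0 < Real.log 2 := Real.log_pos (by norm_num)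
  have hl2' := Real.log_two_lt_d9
  have h7 := (abs_le.1 (hm X (2 ^ k * X) hX2 (Nat.le_mul_of_pos_left _ (by positivity)))).1
  have h8 : Real.log ((2 ^ k * X : ℕ) : ℝ) = k * Real.log 2 + Real.log X := by
    push_cast
    rw [Real.log_mul (by positivity) hX0.ne', Real.log_pow]
  set u := k * Real.log 2 with hu
  have hu0 : 0 ≤ u := by positivity
  have hu1 : u ≤ 1 / 1000 * L := by
    have : u ≤ k * 1 := by
      rw [hu]
      gcongr
      linarith
    linarith
  have h9 : u / (1002 / 1000 * L) ≤ Real.log (Real.log ((2 ^ k * X : ℕ) : ℝ)) - Real.log (Real.log X) := by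
    rw [h8, ← Real.log_div (by linarith) hlogX.ne']
    have h10 := Real.one_sub_inv_le_log_of_pos (show 0 < (u + Real.log X) / Real.log X by positivity)
    refine le_trans ?_ h10
    rw [inv_div, show 1 - Real.log X / (u + Real.log X) = u / (u + Real.log X) by field_simp; ring]
    gcongr
    linarith
  have h11 : C / Real.log X ≤ (1 + 2 * C) * (1 / (1002 / 1000 * L)) - (1 / (1002 / 1000 * L)) := by
    rw [← sub_one_mul, mul_one_div, div_le_div_iff₀ hlogX (by positivity)]
    nlinarith
  have h12 : 99 / 100 * (α / 2 * Real.log L) / L ≤ (u - 2 * C) / (1002 / 1000 * L) := by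
    rw [div_le_div_iff₀ hL0 (by positivity)]
    nlinarith
  have h13 : (u - 2 * C) / (1002 / 1000 * L) ≤ u / (1002 / 1000 * L) - C / Real.log X := by
    rw [sub_div]
    have : (1 + 2 * C) * (1 / (1002 / 1000 * L)) - (1 / (1002 / 1000 * L)) = 2 * C / (1002 / 1000 * L) := by
      ring
    linarith
  unfold grpPrimes
  linarith

theorem eventually_modErr_le {α : ℝ} (hα : 0 < α) (hα1 : α ≤ 15 / 16) : ∀ᶠ x : ℕ in atTop,
    modErr (grpCut α x) (grpMult α x) ≤ 1152 * 145 ^ 4 * Real.log x ^ (-(3 / 16 * α)) := by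
  filter_upwards [eventually_grpCut hα hα1, eventually_grpMult hα, eventually_log_of (eventually_ge_atTop 1),
    eventually_log_of (eventually_mul_rpow_le (a := -(3 / 16 * α)) (b := 0) (by linarith) (576 * 145 ^ 4))]
    with x ⟨h1, _, _, _⟩ ⟨_, _, h2⟩ hL h3
  rw [Real.rpow_zero] at h3
  set L := Real.log x with hLd
  have hL0 : 0 < L := by linarith
  set t := 16 * ((grpMult α x : ℝ) + 1) ^ 2 * (2 * 145 ^ 4 * (grpCut α x : ℝ) ^ (-(35 / 36) : ℝ)) with ht
  have ht0 : 0 ≤ t := by positivity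
  have hw : (grpCut α x : ℝ) ^ (-(35 / 36) : ℝ) ≤ 2 * L ^ (-(35 / 16 * α)) := by
    calc (grpCut α x : ℝ) ^ (-(35 / 36) : ℝ) ≤ (L ^ (9 / 4 * α) / 2) ^ (-(35 / 36) : ℝ) :=
          Real.rpow_le_rpow_of_nonpos (by positivity) h1 (by norm_num)
      _ = L ^ (-(35 / 16 * α)) * 2 ^ (35 / 36 : ℝ) := by
          rw [Real.div_rpow (by positivity) (by norm_num), ← Real.rpow_mul hL0.le,
            Real.rpow_neg (by norm_num : (0 : ℝ) ≤ 2), div_inv_eq_mul]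
          ring_nf
      _ ≤ L ^ (-(35 / 16 * α)) * 2 ^ (1 : ℝ) := by
          gcongr <;> norm_num
      _ = _ := by rw [Real.rpow_one, mul_comm]
  have ht1 : t ≤ 576 * 145 ^ 4 * L ^ (-(3 / 16 * α)) := by
    calc t ≤ 16 * (3 * L ^ α) ^ 2 * (2 * 145 ^ 4 * (2 * L ^ (-(35 / 16 * α)))) := by
          rw [ht]
          gcongr
      _ = 576 * 145 ^ 4 * (L ^ α * L ^ α * L ^ (-(35 / 16 * α))) := by ring
      _ = _ := by
          rw [← Real.rpow_add hL0, ← Real.rpow_add hL0]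
          ring_nf
  have h4 := Real.abs_exp_sub_one_le (x := t) (by rw [abs_of_nonneg ht0]; linarith)
  rw [abs_of_nonneg ht0] at h4
  calc modErr (grpCut α x) (grpMult α x) = Real.exp t - 1 := rfl
    _ ≤ 2 * t := (le_abs_self _).trans h4
    _ ≤ _ := by linarith

/-- Number of stages of the covering procedure. -/
noncomputable def stageNum (x : ℕ) : ℕ := ⌈Real.log (Real.log x) / 30000⌉₊

theorem exp_neg_stageNum_le {x : ℕ} (hL : 0 < Real.log x) :
    Real.exp (-(1 / 10 * stageNum x)) ≤ Real.log x ^ (-(1 / 300000) : ℝ) := by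
  rw [Real.rpow_def_of_pos hL]
  have : Real.log (Real.log x) / 30000 ≤ stageNum x := Nat.le_ceil _
  gcongr
  linarith

theorem le_exp_neg_of_lt_stageNum {x j : ℕ} (hL : 0 < Real.log x) (hj : j < stageNum x) :
    Real.log x ^ (-(1 / 300000) : ℝ) ≤ Real.exp (-(1 / 10 * j)) := by
  rw [Real.rpow_def_of_pos hL]
  have := Nat.lt_ceil.1 hj
  gcongr
  linarith

theorem sum_exp_neg_le (m : ℕ) : ∑ j ∈ range m, Real.exp (-(1 / 10 * (j : ℝ))) ≤ 200 / 19 := by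
  set r := Real.exp (-(1 / 10)) with hr
  have hr1 : r ≤ 181 / 200 := by
    have h1 := Real.quadratic_le_exp_of_nonneg (x := 1 / 10) (by norm_num)
    rw [hr, Real.exp_neg, inv_le_comm₀ (Real.exp_pos _) (by norm_num)]
    norm_num at h1 ⊢
    linarith
  have hr0 : 0 < r := Real.exp_pos _
  have h2 : ∀ j : ℕ, Real.exp (-(1 / 10 * (j : ℝ))) = r ^ j := fun j => by
    rw [hr, ← Real.exp_nat_mul]
    ring_nf
  simp only [h2]
  have h3 := geom_sum_mul_neg r m
  have h4 : 0 < r ^ m := by positivity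
  have h5 : 0 ≤ ∑ j ∈ range m, r ^ j := sum_nonneg fun _ _ => by positivity
  nlinarith

theorem eventually_blocks {c α : ℝ} (hc : 0 < c) (hc1 : c ≤ 1) (hα : 0 < α) (hα1 : α ≤ 15 / 16) :
    ∀ᶠ x : ℕ in atTop, ∃ Q : Bool → ℕ → Finset ℕ, (∀ s j, Q s j ⊆ grpPrimes c α x) ∧
      (∀ s j s' j' q, q ∈ Q s j → q ∈ Q s' j' → s = s' ∧ j = j') ∧ ∀ s, ∀ j < stageNum x,
        1 / 100 * Real.exp (-(1 / 10 * j)) ≤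
          (∑ q ∈ Q s j, 1 / (q : ℝ)) * (piK (grpCut α x) (sieveLim x) 1)⁻¹ ∧
        Real.log x ^ (-(1 + 1 / 300000) : ℝ) ≤ ∑ q ∈ Q s j, 1 / (q : ℝ) := by
  have hll : Tendsto (fun x : ℕ => Real.log (Real.log x)) atTop atTop :=
    Real.tendsto_log_atTop.comp tendsto_log_natCast
  filter_upwards [eventually_grp_sum_ge hc hc1 hα hα1, eventually_piK_one_le hα hα1,
    eventually_grpLow hc hc1 hα.le hα1, eventually_log_of (eventually_ge_atTop 1),
    hll.eventually_ge_atTop (50 / α), eventually_grpCut hα hα1,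
    eventually_log_of (eventually_mul_rpow_le_exp 3 100 one_pos), eventually_ge_atTop 1]
    with x h1 h2 ⟨h3, _, _, _⟩ hL hl ⟨_, h4, _, _⟩ h5 hx
  have hx0 : (0 : ℝ) < x := by exact_mod_cast hx
  rw [one_mul, Real.exp_log hx0] at h5
  rw [div_le_iff₀ hα] at hl
  set L := Real.log x with hLd
  have hL0 : 0 < L := by linarith
  have hl0 : 0 < Real.log L := by nlinarith
  set W := ∑ q ∈ grpPrimes c α x, 1 / (q : ℝ) with hW
  set σ := piK (grpCut α x) (sieveLim x) 1 with hσ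
  have hσ0 : 0 < σ := piK_pos (by
    have := Nat.one_le_pow 2 (grpMult α x + 1) (by omega)
    omega)
  set X := grpLow c α x with hX
  have hX0 : (0 : ℝ) < X := lt_of_lt_of_le (by positivity) h3
  have hW1 : 24 / L ≤ W := by
    refine le_trans ?_ h1
    gcongr
    nlinarith
  have hW0 : 0 < W := lt_of_lt_of_le (by positivity) hW1
  have hWσ : 217 / 1000 ≤ W * σ⁻¹ := by
    rw [← div_eq_mul_inv, le_div_iff₀ hσ0]
    refine le_trans ?_ h1
    refine (mul_le_mul_of_nonneg_left h2 (by norm_num)).trans ?_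
    rw [← mul_div_assoc]
    have : 0 < α * Real.log L := by positivity
    refine div_le_div_of_nonneg_right ?_ hL0.le
    linarith
  obtain ⟨A, hA1, hA2, hA3⟩ := exists_disjoint_subsets_sum_near (univ ×ˢ range (stageNum x))
    (grpPrimes c α x) (fun q => 1 / (q : ℝ)) (η := 1 / (X : ℝ))
    (fun i : Bool × ℕ => 95 / 2000 * Real.exp (-(1 / 10 * (i.2 : ℝ))) * W)
    (fun q hq => by
      have := (mem_Ioc.1 (mem_filter.1 hq).1).1
      have h6 : (X : ℝ) ≤ q := by exact_mod_cast this.le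
      gcongr)
    (by positivity) (fun i _ => by positivity) (by
      rw [sum_product, Fintype.sum_bool]
      simp only
      rw [← sum_mul, ← mul_sum]
      have := sum_exp_neg_le (stageNum x)
      nlinarith)
  refine ⟨fun s j => A (s, j), fun s j => hA1 _, fun s j s' j' q h h' => ?_, fun s j hj => ?_⟩
  · have := hA3 _ _ q h h'
    simpa using this
  · have h6 := hA2 (s, j) (by simpa using hj)
    simp only at h6
    have h7 := le_exp_neg_of_lt_stageNum hL0 hj
    rw [← hLd] at h7
    set e := Real.exp (-(1 / 10 * (j : ℝ))) with he
    have he0 : 0 < e := Real.exp_pos _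
    have h8 : L ^ (-(1 + 1 / 300000) : ℝ) ≤ e / L := by
      rw [show (-(1 + 1 / 300000) : ℝ) = -(1 / 300000) - 1 by ring, Real.rpow_sub_one hL0.ne']
      gcongr
    have h9 : 1 / (X : ℝ) ≤ 1 / 100 * L ^ (-(1 + 1 / 300000) : ℝ) := by
      calc 1 / (X : ℝ) ≤ 1 / (x / L) := by gcongr
        _ = L / x := by rw [one_div_div]
        _ ≤ L / (100 * L ^ (3 : ℝ)) := by gcongr
        _ = 1 / 100 * L ^ (-2 : ℝ) := by
            rw [show (3 : ℝ) = 2 + 1 by norm_num, Real.rpow_add_one hL0.ne', Real.rpow_neg hL0.le]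
            have := Real.rpow_pos_of_pos hL0 (2 : ℝ)
            field_simp
        _ ≤ _ := by
            gcongr
            norm_num
    have h10 : 24 * (e / L) ≤ e * W := by
      calc 24 * (e / L) = e * (24 / L) := by ring
        _ ≤ _ := by gcongr
    have h11 : 0 < e / L := by positivity
    have h12 : 47 / 1000 * (e * W) ≤ ∑ q ∈ A (s, j), 1 / (q : ℝ) := by nlinarith
    refine ⟨?_, by linarith⟩
    calc 1 / 100 * e ≤ 47 / 1000 * e * (W * σ⁻¹) := by nlinarith
      _ = 47 / 1000 * (e * W) * σ⁻¹ := by ring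
      _ ≤ _ := by gcongr

/-- Bound for the weight of a single residue class. -/
noncomputable def clsBound (x : ℕ) : ℝ := Real.exp (Real.log x ^ (24 / 25 : ℝ)) / x

/-- Bound for the number of elements of an edge. -/
noncomputable def edgeBound (x : ℕ) : ℕ := ⌈3 * Real.log x ^ (15 / 16 : ℝ)⌉₊

theorem eventually_clsBound_le : ∀ᶠ x : ℕ in atTop,
    clsBound x ≤ Real.exp (-(Real.log x / 2)) := by
  filter_upwards [eventually_log_of (eventually_mul_rpow_le (a := 24 / 25) (b := 1) (by norm_num) 2),
    eventually_ge_atTop 1] with x h1 hx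
  have hx0 : (0 : ℝ) < x := by exact_mod_cast hx
  rw [Real.rpow_one] at h1
  unfold clsBound
  nth_rewrite 2 [← Real.exp_log hx0]
  rw [← Real.exp_sub]
  gcongr
  linarith

theorem eventually_inv_piK_div_le {c α : ℝ} (hc : 0 < c) (hc1 : c ≤ 1) (hα : 0 < α) (hα1 : α ≤ 15 / 16) :
    ∀ᶠ x : ℕ in atTop, (piK (grpCut α x) (sieveLim x) (grpMult α x + 1))⁻¹ / grpLow c α x ≤ clsBound x := by
  filter_upwards [eventually_inv_piK_le hα hα1, eventually_grpLow hc hc1 hα.le hα1,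
    eventually_log_of (eventually_mul_rpow_le (a := 19 / 20) (b := 24 / 25) (by norm_num) 2),
    eventually_log_of (eventually_mul_log_le (a := 19 / 20) (by norm_num) 1),
    eventually_log_of (eventually_ge_atTop 1), eventually_ge_atTop 1] with x h1 ⟨h2, _, _, _⟩ h3 h4 hL hx
  have hx0 : (0 : ℝ) < x := by exact_mod_cast hx
  unfold clsBound
  set L := Real.log x with hLd
  have hL0 : 0 < L := by linarith
  calc _ ≤ Real.exp (L ^ (19 / 20 : ℝ)) / (x / L) := by gcongr
    _ = Real.exp (Real.log L + L ^ (19 / 20 : ℝ)) / x := by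
        rw [Real.exp_add, Real.exp_log hL0]
        field_simp
    _ ≤ _ := by
        gcongr
        linarith

set_option maxHeartbeats 1000000 in
theorem eventually_excess_le {c α : ℝ} (hc : 0 < c) (hc1 : c ≤ 1) (hα : 1 / 18000 ≤ α) (hα1 : α ≤ 15 / 16) :
    ∀ᶠ x : ℕ in atTop, ∀ W : ℝ, Real.log x ^ (-(1 + 1 / 300000) : ℝ) ≤ W →
      piK (grpCut α x) (sieveLim x) 1 * ((covLen c x + 1 : ℕ) / ((1 / 20) ^ 2 * W) *
        (32 * grpDyad α x / Real.log (grpLow c α x) * modErr (grpCut α x) (grpMult α x) +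
        piK (grpCut α x) (sieveLim x) 1 * (piK (grpCut α x) (sieveLim x) (grpMult α x + 1))⁻¹ /
          grpLow c α x) +
        330 * covLen c x / (1 / 20) * ((piK (grpCut α x) (sieveLim x) (grpMult α x + 1))⁻¹ / grpLow c α x +
          2 * modErr (grpCut α x) (grpMult α x))) ≤ x / Real.log x * Real.log x ^ (-(1 / 300000) : ℝ) := by
  have hα0 : 0 < α := by linarith
  set K : ℝ := 1152 * 145 ^ 4 with hK
  filter_upwards [eventually_piK_one_le hα0 hα1, eventually_covLen hc, eventually_grpDyad hc hc1 hα0.le hα1,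
    eventually_log_grpLow hc hc1 hα0.le hα1, eventually_modErr_le hα0 hα1,
    eventually_inv_piK_div_le hc hc1 hα0 hα1, eventually_clsBound_le, eventually_grpCut hα0 hα1,
    eventually_log_of (eventually_ge_atTop (Real.exp 1)),
    eventually_log_of (eventually_mul_log_le (a := 1 / 4800000) (by norm_num)
      (3 * (800 * (64 * K + 1) + 13200 * (2 * K + 1)))),
    eventually_log_of (eventually_mul_log_le (a := 1 / 4800000) (by norm_num) 1),
    eventually_log_of (eventually_mul_log_le one_pos 3),
    eventually_log_of (eventually_mul_rpow_le_exp 2 1 (b := 1 / 2) (by norm_num)), eventually_ge_atTop 1]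
    with x h1 ⟨_, h2, _⟩ ⟨_, h3, _, _⟩ ⟨h4, _⟩ h5 h6 h7 ⟨_, h8, _, _⟩ hL h9 h10 h11 h12 hx W hW
  have hx0 : (0 : ℝ) < x := by exact_mod_cast hx
  rw [Real.rpow_one] at h11
  set L := Real.log x with hLd
  have hL0 : 0 < L := (Real.exp_pos 1).trans_le hL
  have hl1 : 1 ≤ Real.log L := (Real.le_log_iff_exp_le hL0).2 hL
  have hL1 : 1 ≤ L := by
    have := Real.add_one_le_exp 1
    linarith
  set l := Real.log L with hl
  set σ := piK (grpCut α x) (sieveLim x) 1 with hσ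
  have hσ0 : 0 < σ := piK_pos (by
    have := Nat.one_le_pow 2 (grpMult α x + 1) (by omega)
    omega)
  set M := modErr (grpCut α x) (grpMult α x) with hM
  have hM0 : 0 ≤ M := modErr_nonneg _ _
  set Dd := L ^ (1 / 300000 : ℝ) with hD
  set μ := L ^ (-(1 / 96000) : ℝ) with hμ
  have hμ0 : 0 < μ := Real.rpow_pos_of_pos hL0 _
  have hD1 : 1 ≤ Dd := Real.one_le_rpow hL1 (by norm_num)
  have hσ3 : σ ≤ 3 * l / L := by
    have h13 : α * l ≤ 15 / 16 * l := by gcongr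
    refine h1.trans (div_le_div_of_nonneg_right ?_ hL0.le)
    linarith
  have hσ1 : σ ≤ 1 := hσ3.trans (div_le_one_of_le₀ h11 hL0.le)
  have hMμ : M ≤ K * μ := by
    have h13 : L ^ (-(3 / 16 * α)) ≤ μ := Real.rpow_le_rpow_of_exponent_le hL1 (by linarith)
    refine h5.trans ?_
    gcongr
  set g := (piK (grpCut α x) (sieveLim x) (grpMult α x + 1))⁻¹ / grpLow c α x with hg
  have hg1 : g ≤ μ / L := by
    refine (h6.trans h7).trans ?_
    rw [Real.exp_neg, show L / 2 = 1 / 2 * L by ring]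
    calc (Real.exp (1 / 2 * L))⁻¹ ≤ (1 * L ^ (2 : ℝ))⁻¹ := by gcongr
      _ = L ^ (-2 : ℝ) := by rw [one_mul, Real.rpow_neg hL0.le]
      _ ≤ L ^ (-(1 / 96000) - 1 : ℝ) := Real.rpow_le_rpow_of_exponent_le hL1 (by norm_num)
      _ = μ / L := Real.rpow_sub_one hL0.ne' _
  have hpi : 0 < piK (grpCut α x) (sieveLim x) (grpMult α x + 1) := piK_pos (by nlinarith)
  have hg0 : 0 ≤ g := by positivity
  have hgμ : g ≤ μ := hg1.trans (div_le_self hμ0.le hL1)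
  have hY : ((covLen c x + 1 : ℕ) : ℝ) ≤ 2 * x * Dd := by
    refine h2.trans ?_
    gcongr
    linarith
  have hY' : (covLen c x : ℝ) ≤ 2 * x * Dd := by
    push_cast at hY
    linarith
  have hk : 32 * (grpDyad α x : ℝ) / Real.log (grpLow c α x) ≤ 64 * l / L := by
    calc 32 * (grpDyad α x : ℝ) / Real.log (grpLow c α x) ≤ 32 * l / (1 / 2 * L) := by
          gcongr
          linarith
      _ = _ := by field_simp; norm_num
  have hW' : L ^ (-(1 + 1 / 300000) : ℝ) = (L * Dd)⁻¹ := by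
    rw [Real.rpow_neg hL0.le, Real.rpow_add hL0, Real.rpow_one]
  rw [hW'] at hW
  have hW0 : 0 < W := lt_of_lt_of_le (by positivity) hW
  have e1 : ((covLen c x + 1 : ℕ) : ℝ) / ((1 / 20) ^ 2 * W) ≤ 800 * x * Dd ^ 2 * L := by
    rw [div_le_iff₀ (by positivity)]
    calc ((covLen c x + 1 : ℕ) : ℝ) ≤ 2 * x * Dd := hY
      _ = 800 * x * Dd ^ 2 * L * ((1 / 20) ^ 2 * (L * Dd)⁻¹) := by
          field_simp
          norm_num
      _ ≤ _ := by gcongr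
  have e2 : 32 * grpDyad α x / Real.log (grpLow c α x) * M +
      σ * (piK (grpCut α x) (sieveLim x) (grpMult α x + 1))⁻¹ / grpLow c α x ≤ (64 * K + 1) * l * μ / L := by
    rw [mul_div_assoc σ, ← hg]
    calc _ ≤ 64 * l / L * (K * μ) + 1 * (μ / L) := by gcongr
      _ = (64 * K * l + 1) * μ / L := by ring
      _ ≤ _ := by
          gcongr
          nlinarith
  have e3 : 330 * (covLen c x : ℝ) / (1 / 20) * (g + 2 * M) ≤ 13200 * (2 * K + 1) * x * Dd ^ 2 * l * μ := by
    calc _ ≤ 330 * (2 * x * Dd) / (1 / 20) * (μ + 2 * (K * μ)) := by gcongr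
      _ = 13200 * (2 * K + 1) * x * Dd * μ * (1 * 1) := by ring
      _ ≤ 13200 * (2 * K + 1) * x * Dd * μ * (Dd * l) := by gcongr
      _ = _ := by ring
  calc _ ≤ 3 * l / L * (800 * x * Dd ^ 2 * L * ((64 * K + 1) * l * μ / L) +
        13200 * (2 * K + 1) * x * Dd ^ 2 * l * μ) := by
        gcongr
    _ = x / L * (3 * (800 * (64 * K + 1) + 13200 * (2 * K + 1)) * l * (1 * l) * (Dd * Dd) * μ) := by
        field_simp
    _ ≤ x / L * (L ^ (1 / 4800000 : ℝ) * L ^ (1 / 4800000 : ℝ) * (Dd * Dd) * μ) := by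
        gcongr
    _ = x / L * L ^ (-(1 / 300000) : ℝ) := by
        rw [hD, hμ, ← Real.rpow_add hL0, ← Real.rpow_add hL0, ← Real.rpow_add hL0, ← Real.rpow_add hL0]
        norm_num

theorem eventually_edgeBound : ∀ᶠ x : ℕ in atTop, 1 ≤ edgeBound x ∧
    3 * Real.log x ^ (15 / 16 : ℝ) ≤ edgeBound x ∧ (edgeBound x : ℝ) ≤ 4 * Real.log x ^ (15 / 16 : ℝ) := by
  filter_upwards [eventually_log_of (eventually_ge_atTop 1)] with x hL
  have h1 : 3 * Real.log x ^ (15 / 16 : ℝ) ≤ edgeBound x := Nat.le_ceil _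
  have h2 : 1 ≤ Real.log x ^ (15 / 16 : ℝ) := Real.one_le_rpow hL (by norm_num)
  have h3 : (edgeBound x : ℝ) < 3 * Real.log x ^ (15 / 16 : ℝ) + 1 := Nat.ceil_lt_add_one (by linarith)
  refine ⟨?_, h1, by linarith⟩
  have : (1 : ℝ) ≤ edgeBound x := by linarith
  exact_mod_cast this

theorem eventually_nibble_error_le : ∀ᶠ x : ℕ in atTop,
    4 * (21 * (edgeBound x : ℝ) ^ 2 * (2 * Real.exp (Real.log x ^ (24 / 25 : ℝ))) *
      Real.exp (1 / 10 * stageNum x) ^ (3 * edgeBound x) / (11 / 10 - 1) ^ 2) ^ 2 *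
      clsBound x ^ ((1 / 2 : ℝ) ^ stageNum x) ≤ Real.log x ^ (-(1 / 300000) : ℝ) := by
  filter_upwards [eventually_edgeBound, eventually_clsBound_le,
    eventually_log_of (eventually_ge_atTop 67200),
    eventually_log_of (eventually_mul_log_le (a := 1 / 80) (by norm_num) 12),
    eventually_log_of (eventually_mul_log_le (a := 19 / 20) (by norm_num) 3),
    eventually_log_of (eventually_mul_rpow_le (a := 19 / 20) (b := 24 / 25) (by norm_num) 2),
    eventually_log_of (eventually_mul_rpow_le (a := 24 / 25) (b := 99 / 100) (by norm_num) 12),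
    (Real.tendsto_log_atTop.comp tendsto_log_natCast).eventually_ge_atTop 1000, eventually_ge_atTop 1]
    with x ⟨_, _, h1⟩ h2 hL h3 h4 h5 h6 hl hx
  have hx0 : (0 : ℝ) < x := by exact_mod_cast hx
  simp only [Function.comp] at hl
  set L := Real.log x with hLd
  have hL0 : 0 < L := by linarith
  have hL1 : 1 ≤ L := by linarith
  set l := Real.log L with hld
  set r := edgeBound x with hr
  set m := stageNum x with hm
  set E := L ^ (24 / 25 : ℝ) with hE
  have hm1 : (m : ℝ) ≤ l / 30000 + 1 := (Nat.ceil_lt_add_one (by linarith)).le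
  have hr2 : (r : ℝ) ^ 2 ≤ 16 * L ^ 2 := by
    have h7 : L ^ (15 / 16 : ℝ) ≤ L := by
      conv_rhs => rw [← Real.rpow_one L]
      exact Real.rpow_le_rpow_of_exponent_le hL1 (by norm_num)
    calc (r : ℝ) ^ 2 ≤ (4 * L) ^ 2 := by
          gcongr
          linarith
      _ = _ := by ring
  have e1 : 21 * (r : ℝ) ^ 2 * 200 ≤ Real.exp (L ^ (19 / 20 : ℝ)) := by
    calc 21 * (r : ℝ) ^ 2 * 200 ≤ L * L ^ 2 := by nlinarith [sq_nonneg L]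
      _ = Real.exp (3 * l) := by
          rw [show 3 * l = l + l + l by ring, Real.exp_add, Real.exp_add, Real.exp_log hL0]
          ring
      _ ≤ _ := Real.exp_le_exp.2 h4
  have e2 : Real.exp (1 / 10 * m) ^ (3 * r) ≤ Real.exp (L ^ (19 / 20 : ℝ)) := by
    rw [← Real.exp_nat_mul, Real.exp_le_exp]
    push_cast
    calc 3 * (r : ℝ) * (1 / 10 * m) ≤ 3 * (4 * L ^ (15 / 16 : ℝ)) * l := by
          gcongr
          linarith
      _ = L ^ (15 / 16 : ℝ) * (12 * l) := by ring
      _ ≤ L ^ (15 / 16 : ℝ) * L ^ (1 / 80 : ℝ) := by gcongr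
      _ = L ^ (19 / 20 : ℝ) := by rw [← Real.rpow_add hL0]; norm_num
  have e3 : 21 * (r : ℝ) ^ 2 * (2 * Real.exp E) * Real.exp (1 / 10 * m) ^ (3 * r) / (11 / 10 - 1) ^ 2 ≤
      Real.exp (2 * E) := by
    calc _ = 21 * (r : ℝ) ^ 2 * 200 * Real.exp E * Real.exp (1 / 10 * m) ^ (3 * r) := by ring
      _ ≤ Real.exp (L ^ (19 / 20 : ℝ)) * Real.exp E * Real.exp (L ^ (19 / 20 : ℝ)) := by gcongr
      _ = Real.exp (L ^ (19 / 20 : ℝ) + E + L ^ (19 / 20 : ℝ)) := by rw [Real.exp_add, Real.exp_add]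
      _ ≤ _ := by
          gcongr
          linarith
  have e4 : L ^ (-(1 / 100) : ℝ) ≤ (1 / 2 : ℝ) ^ m := by
    have h8 : (1 / 2 : ℝ) ^ m = Real.exp (-(m * Real.log 2)) := by
      rw [Real.exp_neg, Real.exp_nat_mul, Real.exp_log two_pos, one_div, inv_pow]
    rw [h8, Real.rpow_def_of_pos hL0, Real.exp_le_exp]
    have := Real.log_two_lt_d9
    have h9 : (m : ℝ) * Real.log 2 ≤ m * 1 := by
      gcongr
      linarith
    linarith
  have e5 : clsBound x ^ ((1 / 2 : ℝ) ^ m) ≤ Real.exp (-(L ^ (99 / 100 : ℝ) / 2)) := by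
    have h8 : 0 ≤ clsBound x := by unfold clsBound; positivity
    calc clsBound x ^ ((1 / 2 : ℝ) ^ m) ≤ Real.exp (-(L / 2)) ^ ((1 / 2 : ℝ) ^ m) := by gcongr
      _ = Real.exp (-(L / 2) * (1 / 2 : ℝ) ^ m) := by rw [← Real.exp_mul]
      _ ≤ Real.exp (-(L / 2) * L ^ (-(1 / 100) : ℝ)) := by
          rw [Real.exp_le_exp]
          nlinarith
      _ = _ := by
          congr 1
          have : L ^ (99 / 100 : ℝ) = L * L ^ (-(1 / 100) : ℝ) := by
            rw [show (99 / 100 : ℝ) = 1 + -(1 / 100) by norm_num, Real.rpow_add hL0, Real.rpow_one]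
          rw [this]
          ring
  have h19 : L ^ (19 / 20 : ℝ) ≤ E := by
    have := Real.rpow_pos_of_pos hL0 (19 / 20 : ℝ)
    linarith
  have h8 : 0 ≤ clsBound x := by unfold clsBound; positivity
  have h9 : (4 : ℝ) ≤ L := by linarith
  calc _ ≤ L * Real.exp (2 * E) ^ 2 * Real.exp (-(L ^ (99 / 100 : ℝ) / 2)) := by gcongr
    _ = Real.exp (l + 2 * (2 * E) - L ^ (99 / 100 : ℝ) / 2) := by
        rw [Real.exp_sub, Real.exp_add, Real.exp_log hL0, Real.exp_neg, two_mul (2 * E), Real.exp_add]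
        ring
    _ ≤ Real.exp (l * -(1 / 300000)) := by
        rw [Real.exp_le_exp]
        linarith
    _ = _ := by rw [Real.rpow_def_of_pos hL0]

/-- The exponents of the groups of primes. -/
noncomputable def grpExp (i : Fin 15) : ℝ := 15 / 16 / 2 ^ (i : ℕ)

theorem le_grpExp (i : Fin 15) : 1 / 18000 ≤ grpExp i := by
  have h : (2 : ℝ) ^ (i : ℕ) ≤ 2 ^ 14 := pow_le_pow_right₀ one_le_two (by omega)
  unfold grpExp
  rw [le_div_iff₀ (by positivity)]
  linarith

theorem grpExp_le (i : Fin 15) : grpExp i ≤ 15 / 16 :=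
  div_le_self (by norm_num) (one_le_pow₀ one_le_two)

theorem grpExp_le_half {i i' : Fin 15} (h : i < i') : grpExp i' ≤ grpExp i / 2 := by
  unfold grpExp
  rw [div_div _ _ (2 : ℝ), ← pow_succ]
  gcongr
  · exact one_le_two
  · exact h

theorem eventually_grpPrimes_le {c α : ℝ} (hc : 0 < c) (hc1 : c ≤ 1) (hα : 1 / 18000 ≤ α) (hα1 : α ≤ 15 / 16)
    {K : ℕ} (hK : 0 < K) : ∀ᶠ x : ℕ in atTop, ∀ q ∈ grpPrimes c α x,
      (q : ℝ) ≤ covLen c x / Real.log x ^ (α / 2) ∧ q ≤ x / K ∧ q ≤ covLen c x := by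
  filter_upwards [eventually_grpDyad hc hc1 (by linarith) hα1, eventually_covLen hc,
    eventually_log_of (eventually_ge_atTop 1),
    eventually_log_of (eventually_mul_rpow_le (a := 1 / 300000) (b := α / 2) (by linarith) K)]
    with x ⟨_, _, _, h1⟩ ⟨_, _, h2⟩ hL h3 q hq
  set L := Real.log x with hLd
  have hL0 : 0 < L := by linarith
  have hq1 : (q : ℝ) ≤ 2 ^ grpDyad α x * grpLow c α x := by
    have := (mem_Ioc.1 (mem_filter.1 hq).1).2
    exact_mod_cast this
  have h4 : 1 ≤ L ^ (α / 2) := Real.one_le_rpow hL (by linarith)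
  have h5 : (q : ℝ) ≤ covLen c x / L ^ (α / 2) := hq1.trans h1
  refine ⟨h5, (Nat.le_div_iff_mul_le hK).2 ?_, ?_⟩
  · rw [le_div_iff₀ (by positivity)] at h5
    have h6 : (q : ℝ) * K * L ^ (1 / 300000 : ℝ) ≤ x * L ^ (1 / 300000 : ℝ) := by
      calc (q : ℝ) * K * L ^ (1 / 300000 : ℝ) = q * (K * L ^ (1 / 300000 : ℝ)) := by ring
        _ ≤ q * L ^ (α / 2) := by gcongr
        _ ≤ c * x * L ^ (1 / 300000 : ℝ) := h5.trans h2
        _ ≤ 1 * x * L ^ (1 / 300000 : ℝ) := by gcongr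
        _ = _ := by ring
    have h7 := le_of_mul_le_mul_right h6 (by positivity)
    exact_mod_cast h7
  · have h6 : (q : ℝ) ≤ covLen c x := h5.trans (div_le_self (by positivity) h4)
    exact_mod_cast h6

theorem exists_eventually_cover : ∃ c : ℝ, 0 < c ∧ c ≤ 1 ∧ ∀ᶠ x : ℕ in atTop, ∀ Y0 : Bool → ℤ,
    ∃ a : ℕ → ℤ, ∀ s, ∀ v ∈ Icc (Y0 s) (Y0 s + covLen c x),
      ∃ p : ℕ, p ≤ x ∧ p.Prime ∧ v % (p : ℤ) = a p := by
  obtain ⟨K, hK1, hK⟩ := exists_card_primes_ge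
  obtain ⟨D, hD0, hD⟩ := exists_piK_zero_le
  have hK0 : (0 : ℝ) < K := by exact_mod_cast hK1
  set c : ℝ := min 1 (1 / (32 * K * D)) with hcd
  have hc : 0 < c := lt_min one_pos (by positivity)
  have hc1 : c ≤ 1 := min_le_left _ _
  have hc2 : c * (32 * K * D) ≤ 1 := by
    rw [← le_div_iff₀ (by positivity)]
    exact min_le_right _ _
  have hα0 : ∀ i, 0 < grpExp i := fun i => lt_of_lt_of_le (by norm_num) (le_grpExp i)
  refine ⟨c, hc, hc1, ?_⟩
  have E1 := eventually_all.2 fun i => eventually_sieveSetup hc hc1 (hα0 i) (grpExp_le i)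
  have E2 := eventually_all.2 fun i => eventually_blocks hc hc1 (hα0 i) (grpExp_le i)
  have E3 := eventually_all.2 fun i => eventually_grpPrimes_le hc hc1 (le_grpExp i) (grpExp_le i) hK1
  have E4 := eventually_all.2 fun i => eventually_excess_le hc hc1 (le_grpExp i) (grpExp_le i)
  have E5 := eventually_all.2 fun i => eventually_inv_piK_div_le hc hc1 (hα0 i) (grpExp_le i)
  have E6 := eventually_all.2 fun i => eventually_grpLow hc hc1 (hα0 i).le (grpExp_le i)
  have E7 := eventually_all.2 fun i => eventually_grpMult (hα0 i)
  have E8 := eventually_all.2 fun i => eventually_grpCut (hα0 i) (grpExp_le i)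
  filter_upwards [E1, E2, E3, E4, E5, E6, E7, E8, eventually_covLen hc, eventually_sieveLim,
    eventually_clsBound_le, eventually_edgeBound, eventually_nibble_error_le, hK,
    eventually_log_of (eventually_ge_atTop 3), eventually_log_of (eventually_ge_atTop (K : ℝ)),
    eventually_log_of (eventually_mul_rpow_le_exp 3 2 one_pos),
    eventually_log_of (eventually_mul_log_le (a := 1 / 300000) (by norm_num) (60 * K)),
    (Real.tendsto_log_atTop.comp tendsto_log_natCast).eventually_ge_atTop 2, eventually_ge_atTop 1]
    with x e1 e2 e3 e4 e5 e6 e7 e8 ⟨_, h1, h2⟩ ⟨h3, h4, _, h5⟩ h6 ⟨h7, h8, _⟩ h9 hK hL hLK h10 h11 hl hx Y0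
  have hx1 : (1 : ℝ) ≤ x := by exact_mod_cast hx
  have hx0 : (0 : ℝ) < x := by linarith
  simp only [Function.comp] at hl
  choose Q hQs hQd hQ using e2
  rw [one_mul, Real.exp_log hx0] at h10
  set L := Real.log x with hLd
  have hL0 : 0 < L := by linarith
  have hL1 : 1 ≤ L := by linarith
  set d := L ^ (1 / 300000 : ℝ) with hd
  have hdL : d ≤ L := by
    conv_rhs => rw [← Real.rpow_one L]
    exact Real.rpow_le_rpow_of_exponent_le hL1 (by norm_num)
  have hd0 : 0 < d := Real.rpow_pos_of_pos hL0 _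
  have hdinv : L ^ (-(1 / 300000) : ℝ) = d⁻¹ := Real.rpow_neg hL0.le _
  have hcls : 0 < clsBound x := by unfold clsBound; positivity
  have hm : (stageNum x : ℝ) ≤ Real.log L / 30000 + 1 := (Nat.ceil_lt_add_one (by linarith)).le
  have hlow : ∀ i j s q, q ∈ Q i s j → grpLow c (grpExp i) x < q := fun i j s q hq =>
    (mem_Ioc.1 (mem_filter.1 (hQs i s j hq)).1).1
  have hsep : ∀ i j s i' j' s' q, i < i' → q ∈ Q i s j → q ∈ Q i' s' j' → False := by
    intro i j s i' j' s' q hlt hq hq'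
    have hq1 := (e3 i q (hQs i s j hq)).1
    have hq2 : (q : ℝ) ≤ covLen c x / L ^ grpExp i' := by
      refine hq1.trans ?_
      gcongr
      exact grpExp_le_half hlt
    exact absurd (Nat.le_floor hq2) (not_le.2 (hlow i' j' s' q hq'))
  refine exists_cover (ι := Fin 15) (w := fun i => grpCut (grpExp i) x) (X := fun i => grpLow c (grpExp i) x)
    (κ := fun i => grpMult (grpExp i) x) (k := fun i => grpDyad (grpExp i) x) (z := sieveLim x)
    (Q := fun s i j => Q i s j) (m := stageNum x) (r := edgeBound x) (R := x / K) (C := 1 / 10)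
    (β := clsBound x) (B := 2 * Real.exp (L ^ (24 / 25 : ℝ))) (η := L ^ (-(1 / 300000) : ℝ)) (τ := 1 / 20)
    (ε := x / L * L ^ (-(1 / 300000) : ℝ)) (fun s i j U hU => e1 i (Y0 s) U hU _ (hQs i s j)) ?_ ?_
    (fun s i j q hq => (e3 i q (hQs i s j hq)).2.1) (Nat.div_le_self x K) ?_ (fun i => (e8 i).2.2.2)
    (fun s i j q hq => (e3 i q (hQs i s j hq)).2.2) ?_ ?_ h7 e5 hcls ?_ ?_ ?_ ?_ ?_ (by norm_num) (by norm_num)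
    (by norm_num) h9 ?_ (fun s i j hj => e4 i _ (hQ i s j hj).2) ?_
  · intro s i j s' i' j' q hq hq'
    rcases lt_trichotomy i i' with h | rfl | h
    · exact (hsep _ _ _ _ _ _ _ h hq hq').elim
    · have := hQd i _ _ _ _ q hq hq'
      exact ⟨this.1, rfl, this.2⟩
    · exact (hsep _ _ _ _ _ _ _ h hq' hq).elim
  · intro i i'
    have h12 : (covLen c x : ℝ) < grpLow c (grpExp i) x * grpLow c (grpExp i') x := by
      calc (covLen c x : ℝ) ≤ c * x * d := h2
        _ ≤ 1 * x * L := by gcongr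
        _ < x / L * (x / L) := by
            rw [div_mul_div_comm, lt_div_iff₀ (by positivity)]
            have h13 : L ^ (3 : ℝ) = L * (L * L) := by
              rw [show (3 : ℝ) = ((3 : ℕ) : ℝ) by norm_num, Real.rpow_natCast]
              ring
            rw [h13] at h10
            have h14 : 0 < L * (L * L) := by positivity
            calc 1 * x * L * (L * L) = x * (L * (L * L)) := by ring
              _ < x * x := by
                  gcongr
                  linarith
        _ ≤ _ := by
            gcongr
            · exact (e6 i).1
            · exact (e6 i').1
    exact_mod_cast h12
  · refine (Nat.le_div_iff_mul_le hK1).2 ?_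
    have h12 : (sieveLim x : ℝ) * K ≤ x := by
      calc (sieveLim x : ℝ) * K ≤ x / L * L := by gcongr
        _ = x := by field_simp
    exact_mod_cast h12
  · intro s i j hj
    have h12 := (hQ i s j hj).2
    by_contra h13
    rw [not_nonempty_iff_eq_empty] at h13
    simp only [h13, sum_empty] at h12
    have := Real.rpow_pos_of_pos hL0 (-(1 + 1 / 300000) : ℝ)
    linarith
  · intro i
    have h12 : (grpMult (grpExp i) x + 1 : ℝ) ≤ edgeBound x := by
      refine ((e7 i).2.2.trans ?_).trans h8
      gcongr
      exact grpExp_le i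
    exact_mod_cast h12
  · exact h6.trans (Real.exp_le_one_iff.2 (by linarith))
  · have := Real.one_le_exp (x := L ^ (24 / 25 : ℝ)) (by positivity)
    linarith
  · unfold clsBound
    rw [← hLd, mul_div_assoc', div_le_iff₀ hx0]
    push_cast
    have := Real.exp_pos (L ^ (24 / 25 : ℝ))
    nlinarith
  · positivity
  · exact Real.rpow_le_one_of_one_le_of_nonpos hL1 (by norm_num)
  · intro s j hj
    have h12 : ∑ _i : Fin 15, (1 - 2 * (1 / 20 : ℝ)) * (1 / 100 * Real.exp (-(1 / 10 * j))) ≤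
        ∑ i, (1 - 2 * (1 / 20 : ℝ)) * ((∑ q ∈ Q i s j, 1 / (q : ℝ)) *
          (piK (grpCut (grpExp i) x) (sieveLim x) 1)⁻¹) := by
      refine sum_le_sum fun i _ => ?_
      have := (hQ i s j hj).1
      gcongr
    rw [sum_const, card_univ, Fintype.card_fin, nsmul_eq_mul] at h12
    have := Real.exp_pos (-(1 / 10 * (j : ℝ)))
    push_cast at h12
    linarith
  · have hz : 2 ≤ sieveLim x := by
      have h13 : (2 : ℝ) ≤ sieveLim x := by
        refine le_trans ?_ h5
        calc (2 : ℝ) ≤ L := by linarith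
          _ = L ^ (1 : ℝ) := (Real.rpow_one L).symm
          _ ≤ _ := Real.rpow_le_rpow_of_exponent_le hL1 (by norm_num)
      exact_mod_cast h13
    have h12 : piK 0 (sieveLim x) 1 ≤ 2 * D / L := by
      refine (hD _ hz).trans ?_
      rw [div_le_div_iff₀ (by linarith) hL0]
      nlinarith
    have hpi : 0 ≤ piK 0 (sieveLim x) 1 := prod_nonneg fun p hp => by
      have h13 : (1 : ℝ) ≤ p := by exact_mod_cast (mem_filter.1 hp).2.one_le
      rw [Nat.cast_one, sub_nonneg]
      exact div_le_one_of_le₀ h13 (by linarith)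
    have h13 := exp_neg_stageNum_le hL0
    rw [hdinv] at h13 ⊢
    have h14 : 2 * (((covLen c x + 1 : ℕ) : ℝ) * piK 0 (sieveLim x) 1) *
        (Real.exp (-(1 / 10 * stageNum x)) + d⁻¹) ≤ x / (K * L) / 2 := by
      calc _ ≤ 2 * ((2 * c * x * d) * (2 * D / L)) * (d⁻¹ + d⁻¹) := by gcongr
        _ = c * (32 * K * D) * (x / (K * L) / 2) := by
            field_simp
            norm_num
        _ ≤ 1 * (x / (K * L) / 2) := by gcongr
        _ = _ := one_mul _
    have h15 : 2 * ((Fintype.card (Fin 15) : ℝ) * (stageNum x * (x / L * d⁻¹))) ≤ x / (K * L) / 2 := by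
      rw [Fintype.card_fin]
      push_cast
      calc 2 * (15 * (stageNum x * (x / L * d⁻¹))) ≤ 2 * (15 * (Real.log L * (x / L * d⁻¹))) := by
            gcongr
            linarith
        _ = 60 * K * Real.log L * d⁻¹ * (x / (K * L) / 2) := by
            field_simp
            norm_num
        _ ≤ d * d⁻¹ * (x / (K * L) / 2) := by gcongr
        _ = _ := by rw [mul_inv_cancel₀ hd0.ne', one_mul]
    linarith

theorem lt_of_twelve_mul_lt_log {δ : ℝ} (hδ0 : 0 < δ)
    (hδ : 12 * (10 : ℝ) ^ (2 * δ) < Real.log (1 / (2 * δ))) : δ < 1 / 300000 := by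
  have h1 : (1 : ℝ) ≤ 10 ^ (2 * δ) := Real.one_le_rpow (by norm_num) (by linarith)
  have h2 : Real.exp 12 < 1 / (2 * δ) := (Real.lt_log_iff_exp_lt (by positivity)).1 (by linarith)
  have h3 : (150000 : ℝ) < Real.exp 12 := by
    calc (150000 : ℝ) < 2.71 ^ 12 := by norm_num
      _ ≤ Real.exp 1 ^ 12 := by
          have := Real.exp_one_gt_d9
          gcongr
          linarith
      _ = Real.exp 12 := by
          rw [← Real.exp_nat_mul]
          norm_num
  have h4 := h3.trans h2
  rw [lt_div_iff₀ (by positivity)] at h4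
  linarith

/-- A lower bound for `covLen` at the scale `x = log N / 4`, in terms of `T = log N`. -/
theorem le_half_covLen {c δ T : ℝ} {x : ℕ} (hc : 0 < c) (hδ : δ ≤ 1 / 300000) (hx : T / 8 ≤ x)
    (hx8 : 8 ≤ T) (hT : 2 * Real.log 8 ≤ Real.log T) (hcov : 3 ≤ covLen c x) :
    c / 64 * T * Real.log T ^ δ ≤ (covLen c x / 2 : ℕ) := by
  have h8 : 1 ≤ Real.log 8 := by
    rw [Real.le_log_iff_exp_le (by norm_num)]
    linarith [Real.exp_one_lt_d9]
  have h1 : Real.log T / 2 ≤ Real.log x := by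
    have := Real.log_le_log (by positivity) hx
    rw [Real.log_div (by linarith) (by norm_num)] at this
    linarith
  have hT1 : 1 ≤ Real.log T := by linarith
  have hT0 : 0 ≤ Real.log T := by linarith
  have h22 : (2 : ℝ) ^ (1 / 300000 : ℝ) ≤ 2 := by
    calc (2 : ℝ) ^ (1 / 300000 : ℝ) ≤ 2 ^ (1 : ℝ) :=
          Real.rpow_le_rpow_of_exponent_le one_le_two (by norm_num)
      _ = 2 := Real.rpow_one 2
  have h2 : Real.log T ^ δ / 2 ≤ Real.log x ^ (1 / 300000 : ℝ) := by
    calc Real.log T ^ δ / 2 ≤ Real.log T ^ (1 / 300000 : ℝ) / 2 ^ (1 / 300000 : ℝ) := by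
          gcongr
      _ = (Real.log T / 2) ^ (1 / 300000 : ℝ) := (Real.div_rpow hT0 zero_le_two _).symm
      _ ≤ _ := by gcongr
  have h3 : c * x * Real.log x ^ (1 / 300000 : ℝ) < covLen c x + 1 := Nat.lt_floor_add_one _
  have h4 : (covLen c x + 1 : ℝ) ≤ 4 * (covLen c x / 2 : ℕ) := by
    have : covLen c x + 1 ≤ 4 * (covLen c x / 2) := by omega
    exact_mod_cast this
  have h5 : 0 ≤ Real.log T ^ δ := Real.rpow_nonneg (by linarith) _
  have h6 : c * (T / 8) * (Real.log T ^ δ / 2) ≤ c * x * Real.log x ^ (1 / 300000 : ℝ) := by gcongr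
  linarith

theorem stmt0 (δ : ℝ) (hδ0 : 0 < δ) (hδ1 : δ < 1/2)
    (hδ : 12 * (10 : ℝ) ^ (2 * δ) < Real.log (1 / (2 * δ))) :
    ∃ c : ℝ, 0 < c ∧ ∃ N₀ : ℕ, ∀ N : ℕ, N₀ ≤ N →
      ∃ n₁ n₂ : ℕ, 0 < n₁ ∧ 0 < n₂ ∧ N = n₁ + n₂ ∧
        c * Real.log N * Real.log (Real.log N) ^ δ ≤ (primeDist (n₁ : ℤ) : ℝ) ∧
        c * Real.log N * Real.log (Real.log N) ^ δ ≤ (primeDist (n₂ : ℤ) : ℝ) := by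
  obtain ⟨c, hc, hc1, hcov⟩ := exists_eventually_cover
  refine ⟨c / 64, by positivity, eventually_atTop.1 ?_⟩
  have hx : Tendsto (fun N : ℕ => ⌊Real.log N / 4⌋₊) atTop atTop :=
    tendsto_nat_floor_atTop.comp (tendsto_log_natCast.atTop_div_const (by norm_num))
  filter_upwards [hx.eventually hcov, hx.eventually (eventually_covLen hc),
    hx.eventually (eventually_log_of (eventually_ge_atTop 1)), hx.eventually (eventually_ge_atTop 3),
    eventually_log_of (eventually_ge_atTop 10),
    eventually_log_of (eventually_mul_rpow_le_exp 2 24 one_pos),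
    (Real.tendsto_log_atTop.comp tendsto_log_natCast).eventually_ge_atTop (2 * Real.log 8),
    eventually_ge_atTop 1] with N h1 ⟨h2, _, h3⟩ h4 h5 hT h6 h7 hN
  have hN0 : (0 : ℝ) < N := by exact_mod_cast hN
  simp only [Function.comp] at h7
  rw [one_mul] at h6
  set T := Real.log N with hTd
  have hNT : Real.exp T = N := Real.exp_log hN0
  set x := ⌊T / 4⌋₊ with hxd
  have hx1 : (x : ℝ) ≤ T / 4 := Nat.floor_le (by linarith)
  have hx2 : T / 4 < x + 1 := Nat.lt_floor_add_one _
  have hx0 : (0 : ℝ) < x := by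
    have : (3 : ℝ) ≤ x := by exact_mod_cast h5
    linarith
  have hY : (covLen c x : ℝ) ≤ x * x := by
    calc (covLen c x : ℝ) ≤ c * x * Real.log x ^ (1 / 300000 : ℝ) := h3
      _ ≤ 1 * x * Real.log x ^ (1 : ℝ) := by
          gcongr
          norm_num
      _ ≤ 1 * x * x := by
          rw [Real.rpow_one]
          gcongr
          exact Real.log_le_self hx0.le
      _ = _ := by ring
  have h8 : 3 ≤ covLen c x := h5.trans (by exact_mod_cast h2)
  have hpow : (4 : ℝ) ^ x ≤ Real.exp (T / 2) := by
    calc (4 : ℝ) ^ x = Real.exp (x * Real.log 4) := by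
          rw [Real.exp_nat_mul, Real.exp_log (by norm_num)]
      _ ≤ Real.exp (T / 2) := by
          have h9 : Real.log 4 ≤ 2 := by
            rw [show (4 : ℝ) = 2 * 2 by norm_num, Real.log_mul two_ne_zero two_ne_zero]
            linarith [Real.log_two_lt_d9]
          gcongr
          nlinarith
  have hsize : x + covLen c x / 2 + 4 ^ x < N / 3 := by
    have h9 : covLen c x / 2 ≤ covLen c x := Nat.div_le_self _ _
    suffices h10 : (x + covLen c x + 4 ^ x + 1) * 3 ≤ N by omega
    have h11 : Real.exp T = Real.exp (T / 2) * Real.exp (T / 2) := by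
      rw [← Real.exp_add]
      ring_nf
    have h12 : 6 ≤ Real.exp (T / 2) := by linarith [Real.add_one_le_exp (T / 2), hT]
    have h13 : ((x : ℝ) + covLen c x + 4 ^ x + 1) * 3 ≤ N := by
      rw [Real.rpow_two] at h6
      nlinarith
    exact_mod_cast h13
  have hlow := le_half_covLen hc (lt_of_twelve_mul_lt_log hδ0 hδ).le
    (show T / 8 ≤ x by linarith) (by linarith) h7 h8
  obtain ⟨n₁, n₂, hn1, hn2, hn, hd1, hd2⟩ := exists_split_of_cover hsize (by
    intro Y0
    obtain ⟨a, ha⟩ := h1 Y0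
    refine ⟨a, fun s v hv => ha s v ?_⟩
    rw [mem_Icc] at hv ⊢
    omega)
  exact ⟨n₁, n₂, hn1, hn2, hn, hlow.trans (by exact_mod_cast hd1.le), hlow.trans (by exact_mod_cast hd2.le)⟩
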